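/- Let (R,m) be a complete Noetherian local domain of mixed characteristic p > 0 with perfect residue field, of dimension d. Then the nonzero element g ∈ R and the R-algebra T ⊆ R^+ of the preceding construction ((pg)^{1/p^∞}-almost Cohen-Macaulay normal domain with compatible p-power roots of p and g) can be chosen so that the ideal M := ⋃_{n>0} (pg)^{1/p^n}·T of T satisfies: the inclusion M ⊆ T is a (pg)^{1/p^∞}-almost isomorphism, H^i_m(M) = 0 for every 0 ≤ i ≤ d − 1, and M ≠ mM; in particular M is a big Cohen-Macaulay R-module. -/

import Mathlib

section
def NZ {Q : Type*} [CommRing Q] (I : Ideal Q) (a : Q) : Prop := ∀ z, a * z ∈ I → z ∈ I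

def WR {Q : Type*} [CommRing Q] : Ideal Q → List Q → Prop
  | _, [] => True
  | I, a :: l => NZ I a ∧ WR (I ⊔ Ideal.span {a}) l

section L1
variable {Q : Type*} [CommRing Q]

theorem mem_sup_span {I : Ideal Q} {a z : Q} :
    z ∈ I ⊔ Ideal.span {a} ↔ ∃ i ∈ I, ∃ c, z = i + a * c := by
  rw [Submodule.mem_sup]
  constructor
  · rintro ⟨i, hi, y, hy, rfl⟩
    obtain ⟨c, rfl⟩ := Ideal.mem_span_singleton'.1 hy
    exact ⟨i, hi, c, by ring⟩
  · rintro ⟨i, hi, c, rfl⟩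
    exact ⟨i, hi, a * c, Ideal.mul_mem_right _ _ (Ideal.mem_span_singleton_self a), rfl⟩

theorem NZ.pow {I : Ideal Q} {a : Q} (h : NZ I a) (n : ℕ) : NZ I (a ^ n) := by
  induction n with
  | zero => intro z hz; simpa using hz
  | succ n ih => intro z hz; exact h _ (ih _ (by rw [← mul_assoc, ← pow_succ]; exact hz))

theorem NZ.swap {I : Ideal Q} {a r : Q} (h : NZ I a) (h2 : NZ (I ⊔ Ideal.span {a}) r) :
    NZ (I ⊔ Ideal.span {r}) a := by
  intro z hz
  obtain ⟨i, hi, c, hc⟩ := mem_sup_span.1 hz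
  obtain ⟨j, hj, e, he⟩ := mem_sup_span.1 (h2 c (mem_sup_span.2 ⟨-i, I.neg_mem hi, z, by
    linear_combination -hc⟩))
  have := h (z - r * e) (by
    have : a * (z - r * e) = i + r * j := by subst he; linear_combination hc
    rw [this]; exact I.add_mem hi (I.mul_mem_left _ hj))
  exact mem_sup_span.2 ⟨_, this, e, by ring⟩

theorem WR.pow_mod {I : Ideal Q} {a : Q} {l : List Q} (h : NZ I a)
    (h2 : WR (I ⊔ Ideal.span {a}) l) (N : ℕ) : WR (I ⊔ Ideal.span {a ^ N}) l := by
  induction l generalizing I with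
  | nil => trivial
  | cons r l ih =>
    obtain ⟨h3, h4⟩ := h2
    have hs := h.swap h3
    refine ⟨?_, ?_⟩
    · clear ih
      induction N with
      | zero => intro z _; simp
      | succ N ihN =>
        intro z hz
        have hle : I ⊔ Ideal.span {a ^ (N+1)} ≤ I ⊔ Ideal.span {a ^ N} := by
          refine sup_le_sup_left ?_ _
          rw [Ideal.span_singleton_le_span_singleton]; exact pow_dvd_pow _ (Nat.le_succ _)
        obtain ⟨i, hi, w, rfl⟩ := mem_sup_span.1 (ihN z (hle hz))
        obtain ⟨j, hj, c, hc⟩ := mem_sup_span.1 hz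
        have h5 := (h.pow N) (r * w - a * c) (by
          have : a ^ N * (r * w - a * c) = j - r * i := by linear_combination hc
          rw [this]; exact I.sub_mem hj (I.mul_mem_left _ hi))
        obtain ⟨k, hk, e, he⟩ := mem_sup_span.1 (h3 w (mem_sup_span.2 ⟨_, h5, c, by ring⟩))
        exact mem_sup_span.2 ⟨i + a ^ N * k, I.add_mem hi (I.mul_mem_left _ hk), e, by
          rw [he]; ring⟩
    · rw [sup_right_comm] at h4 ⊢
      exact ih hs h4

theorem WR.pow {I : Ideal Q} {l : List Q} (h : WR I l) (N : ℕ) : WR I (l.map (· ^ N)) := by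
  induction l generalizing I with
  | nil => trivial
  | cons a l ih => exact ⟨h.1.pow N, ih (WR.pow_mod h.1 h.2 N)⟩

theorem NZ.swap_seq {I : Ideal Q} {a : Q} (r : ℕ → Q) (h : NZ I a)
    (h2 : ∀ n, NZ (I ⊔ Ideal.span {a} ⊔ Ideal.span (r '' Set.Iio n)) (r n)) (n : ℕ) :
    NZ (I ⊔ Ideal.span (r '' Set.Iio n)) a := by
  induction n with
  | zero => simpa using h
  | succ n ih =>
    have e : Set.Iio (n+1) = insert n (Set.Iio n) := by ext; simp
    rw [e, Set.image_insert_eq, Ideal.span_insert, sup_comm (Ideal.span {r n}), ← sup_assoc]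
    refine ih.swap ?_
    rw [sup_right_comm]; exact h2 n

theorem NZ.swap_range {I : Ideal Q} {a : Q} (r : ℕ → Q) (h : NZ I a)
    (h2 : ∀ n, NZ (I ⊔ Ideal.span {a} ⊔ Ideal.span (r '' Set.Iio n)) (r n)) :
    NZ (I ⊔ Ideal.span (Set.range r)) a := by
  have key : ∀ z, z ∈ I ⊔ Ideal.span (Set.range r) ↔
      ∃ n, z ∈ I ⊔ Ideal.span (r '' Set.Iio n) := by
    intro z
    have : I ⊔ Ideal.span (Set.range r) = ⨆ n, (I ⊔ Ideal.span (r '' Set.Iio n)) := by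
      rw [← sup_iSup, ← Ideal.span_iUnion, ← Set.image_iUnion, Set.iUnion_Iio, Set.image_univ]
    rw [this, Submodule.mem_iSup_of_directed]
    refine Monotone.directed_le fun m n hmn => sup_le_sup_left (Ideal.span_mono ?_) _
    exact Set.image_mono (Set.Iio_subset_Iio hmn)
  intro z hz
  obtain ⟨n, hn⟩ := (key _).1 hz
  exact (key _).2 ⟨n, h.swap_seq r h2 n z hn⟩
end L1
end

section
open MvPolynomial in
def TriMonic {k : Type*} [CommRing k] (r : ℕ → MvPolynomial ℕ k) : Prop :=
  ∀ n, ∃ e : MvPolynomial ℕ k, IsUnit e ∧ ∃ G : Polynomial k, G.Monic ∧ 0 < G.natDegree ∧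
    ∃ s ∈ supported k (Set.Iio n), r n = e * (Polynomial.aeval (X n) G - s)

theorem nz_monic {B : Type*} [CommRing B] (I : Ideal B) {f : Polynomial B} (hf : f.Monic) :
    NZ (I.map Polynomial.C) f := by
  intro g hg
  have key : ∀ h : Polynomial B, h ∈ I.map Polynomial.C ↔
      h.map (Ideal.Quotient.mk I) = 0 := by
    intro h
    rw [Ideal.mem_map_C_iff, Polynomial.ext_iff]
    simp [Ideal.Quotient.eq_zero_iff_mem]
  rw [key] at hg ⊢
  rw [Polynomial.map_mul] at hg
  exact (hf.map _).mul_right_eq_zero_iff.1 hg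

theorem NZ.comap {A B : Type*} [CommRing A] [CommRing B] (f : A →+* B)
    {J : Ideal B} {a : A} (h : NZ J (f a)) : NZ (J.comap f) a := by
  intro z hz
  rw [Ideal.mem_comap] at hz ⊢
  rw [map_mul] at hz
  exact h _ hz

theorem NZ.unit_mul {B : Type*} [CommRing B] {J : Ideal B} {e a : B} (he : IsUnit e)
    (h : NZ J a) : NZ J (e * a) := by
  intro z hz
  rw [mul_assoc] at hz
  obtain ⟨u, rfl⟩ := he
  exact h _ (by simpa using J.mul_mem_left (↑u⁻¹) hz)

open MvPolynomial in
theorem TriMonic.nz {k : Type*} [CommRing k] {r : ℕ → MvPolynomial ℕ k} (h : TriMonic r) (n : ℕ) :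
    NZ (Ideal.span (r '' Set.Iio n)) (r n) := by
  classical
  let Φ : MvPolynomial ℕ k ≃ₐ[k] Polynomial (MvPolynomial {j : ℕ // j ≠ n} k) :=
    (renameEquiv k (Equiv.optionSubtypeNe n).symm).trans (optionEquivLeft k _)
  have hΦn : Φ (X n) = Polynomial.X := by
    simp [Φ, optionEquivLeft_X_none]
  have hΦ : ∀ j, ∀ hj : j ≠ n, Φ (X j) = Polynomial.C (X ⟨j, hj⟩) := by
    intro j hj
    simp [Φ, Equiv.optionSubtypeNe_symm_of_ne hj, optionEquivLeft_X_some]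
  have hΦs : ∀ s ∈ supported k (Set.Iio n), ∃ c, Φ s = Polynomial.C c := by
    intro s hs
    rw [supported_eq_adjoin_X] at hs
    induction hs using Algebra.adjoin_induction with
    | mem y hy =>
      obtain ⟨j, hj, rfl⟩ := hy
      exact ⟨_, hΦ j (ne_of_lt hj)⟩
    | algebraMap c => exact ⟨C c, by rw [AlgEquiv.commutes]; rfl⟩
    | add a b _ _ ha hb =>
      obtain ⟨a', ha⟩ := ha
      obtain ⟨b', hb⟩ := hb
      exact ⟨a' + b', by rw [map_add, ha, hb, Polynomial.C_add]⟩
    | mul a b _ _ ha hb =>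
      obtain ⟨a', ha⟩ := ha
      obtain ⟨b', hb⟩ := hb
      exact ⟨a' * b', by rw [map_mul, ha, hb, Polynomial.C_mul]⟩
  have hlow : ∀ j < n, ∃ c u, IsUnit u ∧ Φ (r j) = u * Polynomial.C c := by
    intro j hj
    obtain ⟨e, he, G, -, -, s, hs, hr⟩ := h j
    have : Polynomial.aeval (X j) G - s ∈ supported k (Set.Iio n) := by
      refine sub_mem ?_ (supported_mono (Set.Iio_subset_Iio hj.le) hs)
      have : X j ∈ supported k (Set.Iio n) := by
        rw [supported_eq_adjoin_X]; exact Algebra.subset_adjoin ⟨j, hj, rfl⟩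
      have h2 := Polynomial.aeval_mem_adjoin_singleton k (X j : MvPolynomial ℕ k) (p := G)
      exact (Algebra.adjoin_le (by simpa using this)) h2
    obtain ⟨c, hc⟩ := hΦs _ this
    exact ⟨c, Φ e, he.map Φ, by rw [hr, map_mul, hc]⟩
  choose! c u hu hc using hlow
  have hJ : Ideal.span (r '' Set.Iio n) =
      ((Ideal.span (c '' Set.Iio n)).map Polynomial.C).comap (Φ : _ →+* _) := by
    rw [Ideal.map_span]
    apply le_antisymm
    · rw [Ideal.span_le]
      rintro _ ⟨j, hj, rfl⟩
      rw [SetLike.mem_coe, Ideal.mem_comap]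
      change Φ (r j) ∈ Ideal.span _
      rw [hc j hj]
      exact Ideal.mul_mem_left _ _ (Ideal.subset_span ⟨_, ⟨j, hj, rfl⟩, rfl⟩)
    · intro z hz
      have hz : Φ z ∈ Ideal.span (Polynomial.C '' (c '' Set.Iio n)) := hz
      have := Ideal.mem_map_of_mem (Φ.symm : Polynomial (MvPolynomial {j : ℕ // j ≠ n} k) →+* MvPolynomial ℕ k) hz
      rw [Ideal.map_span] at this
      have h2 : (Φ.symm : Polynomial (MvPolynomial {j : ℕ // j ≠ n} k) →+* MvPolynomial ℕ k) (Φ z) = z := Φ.symm_apply_apply z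
      rw [h2] at this
      refine (Ideal.span_le.2 ?_) this
      rintro _ ⟨_, ⟨_, ⟨j, hj, rfl⟩, rfl⟩, rfl⟩
      obtain ⟨v, hv⟩ := hu j hj
      have : Polynomial.C (c j) = ↑v⁻¹ * Φ (r j) := by rw [hc j hj, ← hv]; simp
      rw [this, map_mul]
      refine Ideal.mul_mem_left _ _ (Ideal.subset_span ⟨j, hj, ?_⟩)
      exact (Φ.symm_apply_apply _).symm
  obtain ⟨e, he, G, hG, hG0, s, hs, hr⟩ := h n
  rw [hJ, hr]
  refine NZ.unit_mul he (NZ.comap _ ?_)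
  obtain ⟨t, ht⟩ := hΦs s hs
  apply nz_monic
  have h1 : (Φ : MvPolynomial ℕ k →+* _) (Polynomial.aeval (X n) G - s) =
      G.map (algebraMap k _) - Polynomial.C t := by
    change Φ _ = _
    rw [map_sub, ht]
    congr 1
    rw [← Polynomial.aeval_algHom_apply Φ, hΦn, Polynomial.aeval_def, Polynomial.eval₂_eq_sum_range,
      (G.map _).as_sum_range_C_mul_X_pow' (n := G.natDegree + 1) (by
        have := Polynomial.natDegree_map_le (f := algebraMap k (MvPolynomial {j : ℕ // j ≠ n} k)) (p := G)
        omega)]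
    simp [Polynomial.coeff_map]
  rw [h1]
  nontriviality (MvPolynomial {j : ℕ // j ≠ n} k)
  refine (hG.map _).sub_of_left ?_
  refine lt_of_le_of_lt Polynomial.degree_C_le ?_
  rw [hG.degree_map]
  exact Polynomial.natDegree_pos_iff_degree_pos.1 hG0
end

section
open WittVector in
noncomputable def dF0 (p : ℕ) [Fact p.Prime] {E : Type*} [CommRing E] (f : Polynomial (WittVector p E)) :
    WittVector p (Polynomial E) :=
  f.eval₂ (WittVector.map Polynomial.C) (teichmuller p Polynomial.X)

noncomputable def dH (p : ℕ) (E : Type*) [CommRing E] : WittVector p (MvPolynomial ℕ E) :=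
  WittVector.mk p (fun n => MvPolynomial.X (n+1))

noncomputable def dF (p : ℕ) [Fact p.Prime] {E : Type*} [CommRing E] (f : Polynomial (WittVector p E)) :
    WittVector p (MvPolynomial ℕ E) :=
  WittVector.map (Polynomial.aeval (MvPolynomial.X 0 : MvPolynomial ℕ E) :
    Polynomial E →ₐ[E] MvPolynomial ℕ E).toRingHom (dF0 p f)

noncomputable def dr (p : ℕ) [Fact p.Prime] {E : Type*} [CommRing E] (f : Polynomial (WittVector p E))
    (w : E) (n : ℕ) : MvPolynomial ℕ E :=
  (dF p f + WittVector.teichmuller p (MvPolynomial.C w) * dH p E).coeff n - (dH p E * p).coeff n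

section
variable (p : ℕ) [Fact p.Prime] {E : Type*} [CommRing E]
  (f : Polynomial (WittVector p E)) (w : E)

theorem dF0_coeff_zero : (dF0 p f).coeff 0 = f.map WittVector.constantCoeff := by
  change WittVector.constantCoeff (dF0 p f) = _
  rw [dF0, Polynomial.hom_eval₂]
  have : (WittVector.constantCoeff).comp (WittVector.map (p := p) (Polynomial.C (R := E))) =
    Polynomial.C.comp WittVector.constantCoeff := by
    ext; simp
  rw [this]
  have h2 : WittVector.constantCoeff (p := p) (WittVector.teichmuller p (Polynomial.X : Polynomial E)) =
    Polynomial.X := WittVector.teichmuller_coeff_zero p _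
  rw [h2, Polynomial.map]

theorem dr_triMonic [CharP E p] (hf : f.Monic) (hf0 : 0 < f.natDegree) (K : Ideal E) (hw : w ∈ K) :
    TriMonic (fun n => MvPolynomial.map (Ideal.Quotient.mk K) (dr p f w n)) ∨ K = ⊤ := by
  by_cases hK : K = ⊤
  · exact Or.inr hK
  refine Or.inl fun n => ?_
  have : Nontrivial (E ⧸ K) := Ideal.Quotient.nontrivial_iff.2 hK
  set φ := MvPolynomial.map (σ := ℕ) (Ideal.Quotient.mk K) with hφ
  have h1 : ∀ n, φ ((dF p f + WittVector.teichmuller p (MvPolynomial.C w) * dH p E).coeff n) =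
      Polynomial.aeval (MvPolynomial.X 0) (((dF0 p f).coeff n).map (Ideal.Quotient.mk K)) := by
    intro n
    rw [← WittVector.map_coeff, map_add, map_mul, WittVector.map_teichmuller, hφ,
      MvPolynomial.map_C, Ideal.Quotient.eq_zero_iff_mem.2 hw, MvPolynomial.C_0,
      WittVector.teichmuller_zero, zero_mul, add_zero, WittVector.map_coeff, dF,
      WittVector.map_coeff]
    change MvPolynomial.map _ (Polynomial.aeval _ _) = _
    rw [Polynomial.aeval_def, Polynomial.hom_eval₂, Polynomial.aeval_def, Polynomial.eval₂_map]
    congr 1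
    · ext; simp [MvPolynomial.algebraMap_eq]
    · simp
  rcases n with _ | n
  · refine ⟨1, isUnit_one, (f.map WittVector.constantCoeff).map (Ideal.Quotient.mk K),
      (hf.map _).map _, ?_, 0, zero_mem _, ?_⟩
    · have : Nontrivial E := (Ideal.Quotient.mk K).domain_nontrivial
      rwa [(hf.map _).natDegree_map, hf.natDegree_map]
    · change φ _ = _
      rw [dr, map_sub, h1, WittVector.mul_charP_coeff_zero, map_zero, dF0_coeff_zero]
      ring
  · refine ⟨-1, isUnit_one.neg, Polynomial.X ^ p, Polynomial.monic_X_pow _, ?_,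
      Polynomial.aeval (MvPolynomial.X 0) (((dF0 p f).coeff (n+1)).map (Ideal.Quotient.mk K)), ?_, ?_⟩
    · rw [Polynomial.natDegree_X_pow]; exact (Fact.out : p.Prime).pos
    · rw [MvPolynomial.supported_eq_adjoin_X]
      refine (Algebra.adjoin_mono ?_) (Polynomial.aeval_mem_adjoin_singleton _ _)
      simp
    · change φ _ = _
      rw [dr, map_sub, h1, WittVector.mul_charP_coeff_succ]
      simp [dH, hφ]

theorem dr_nz [CharP E p] (hf : f.Monic) (hf0 : 0 < f.natDegree) (I : Ideal E) (a : E) (ha : NZ I a)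
    (hw : w ∈ I ⊔ Ideal.span {a}) :
    NZ (I.map (MvPolynomial.C : E →+* MvPolynomial ℕ E) ⊔ Ideal.span (Set.range (dr p f w)))
      (MvPolynomial.C a) := by
  apply NZ.swap_range
  · intro z hz
    rw [MvPolynomial.mem_map_C_iff] at hz ⊢
    intro m
    have := hz m
    rw [MvPolynomial.coeff_C_mul] at this
    exact ha _ this
  · intro n
    set K := I ⊔ Ideal.span {a} with hK
    have e : I.map (MvPolynomial.C : E →+* MvPolynomial ℕ E) ⊔ Ideal.span {MvPolynomial.C a} =
        RingHom.ker (MvPolynomial.map (σ := ℕ) (Ideal.Quotient.mk K)) := by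
      rw [MvPolynomial.ker_map, Ideal.mk_ker, hK, Ideal.map_sup, Ideal.map_span,
        Set.image_singleton]
    rcases dr_triMonic p f w hf hf0 K hw with h | h
    · rw [e, sup_comm]
      have h2 := h.nz n
      have h3 := h2.comap (MvPolynomial.map (σ := ℕ) (Ideal.Quotient.mk K))
      have h4 : (fun n => MvPolynomial.map (Ideal.Quotient.mk K) (dr p f w n)) '' Set.Iio n =
        (MvPolynomial.map (Ideal.Quotient.mk K)) '' (dr p f w '' Set.Iio n) := by
        rw [Set.image_image]
      rw [h4, ← Ideal.map_span, Ideal.comap_map_of_surjective (MvPolynomial.map (σ := ℕ) (Ideal.Quotient.mk K))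
        (MvPolynomial.map_surjective (Ideal.Quotient.mk K) Ideal.Quotient.mk_surjective)] at h3
      exact h3
    · intro z _
      rw [e, MvPolynomial.ker_map, Ideal.mk_ker, h, Ideal.map_top]
      simp
end
end

section
theorem WR_iff {Q : Type*} [CommRing Q] {I : Ideal Q} {l : List Q} :
    WR I l ↔ ∀ l₁ a l₂, l = l₁ ++ a :: l₂ → NZ (I ⊔ Ideal.ofList l₁) a := by
  induction l generalizing I with
  | nil => simp [WR]
  | cons b l ih =>
    rw [WR, ih]
    constructor
    · rintro ⟨h1, h2⟩ l₁ a l₂ h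
      rcases l₁ with _ | ⟨c, l₁⟩
      · simp at h; rw [← h.1]; simpa using h1
      · simp at h; rw [Ideal.ofList_cons, ← sup_assoc, ← h.1]; exact h2 _ _ _ h.2
    · intro h
      refine ⟨by simpa using h [] b l rfl, fun l₁ a l₂ h3 => ?_⟩
      rw [sup_assoc, ← Ideal.ofList_cons]; exact h (b :: l₁) a l₂ (by simp [h3])

section
variable (p : ℕ) [Fact p.Prime] {D : Type*} [CommRing D] [CharP D p]

theorem frob_ofList (l : List D) (N : ℕ) {y : D} (hy : y ∈ Ideal.ofList l) :
    y ^ p ^ N ∈ Ideal.ofList (l.map (· ^ p ^ N)) := by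
  have := Ideal.mem_map_of_mem (iterateFrobenius D p N) hy
  rw [Ideal.map_ofList] at this
  exact this

theorem pc_of_eq {y y' : D} (h : PerfectClosure.of D p y = PerfectClosure.of D p y') :
    ∃ M, y ^ p ^ M = y' ^ p ^ M := by
  rw [PerfectClosure.of_apply, PerfectClosure.of_apply, PerfectClosure.mk_eq_iff] at h
  obtain ⟨z, hz⟩ := h
  exact ⟨z, by simpa [iterate_frobenius] using hz⟩

theorem pc_exists (z : PerfectClosure D p) : ∃ N y, z ^ p ^ N = PerfectClosure.of D p y := by
  induction z using PerfectClosure.induction_on with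
  | _ x =>
  obtain ⟨n, x⟩ := x
  exact ⟨n, x, by rw [← PerfectClosure.iterate_frobenius_mk D p n x, iterate_frobenius]⟩

theorem root_mem_ofList {P : Type*} [CommRing P] [CharP P p] [PerfectRing P p] {l : List P} {z : P} {N : ℕ}
    (h : z ^ p ^ N ∈ Ideal.ofList (l.map (· ^ p ^ N))) : z ∈ Ideal.ofList l := by
  have := Ideal.mem_map_of_mem ((iterateFrobeniusEquiv P p N).symm : P →+* P) h
  rw [Ideal.map_ofList] at this
  have e : ∀ x : P, (iterateFrobeniusEquiv P p N).symm (x ^ p ^ N) = x := fun x =>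
    (RingEquiv.symm_apply_eq _).2 rfl
  simpa [Function.comp_def, e] using this

theorem pc_mem_ofList {l : List D} {z : PerfectClosure D p}
    (h : z ∈ Ideal.ofList (l.map (PerfectClosure.of D p))) :
    ∃ N y, z ^ p ^ N = PerfectClosure.of D p y ∧ y ∈ Ideal.ofList (l.map (· ^ p ^ N)) := by
  have up : ∀ {z : PerfectClosure D p} {N y}, z ^ p ^ N = PerfectClosure.of D p y →
    y ∈ Ideal.ofList (l.map (· ^ p ^ N)) → ∀ M, z ^ p ^ (N+M) = PerfectClosure.of D p (y ^ p ^ M) ∧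
      y ^ p ^ M ∈ Ideal.ofList (l.map (· ^ p ^ (N+M))) := by
    intro z N y h1 h2 M
    refine ⟨by rw [pow_add, pow_mul, h1, map_pow], ?_⟩
    have := frob_ofList p _ M h2
    simpa [Function.comp_def, ← pow_mul, ← pow_add] using this
  rw [Ideal.ofList] at h
  induction h using Submodule.span_induction with
  | mem x hx =>
    simp only [List.mem_map, Set.mem_ofPred_eq] at hx
    obtain ⟨a, ha, rfl⟩ := hx
    exact ⟨0, a, by simp, Ideal.subset_span (by simpa using ha)⟩
  | zero => exact ⟨0, 0, by simp, zero_mem _⟩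
  | add z z' _ _ h1 h3 =>
    obtain ⟨N, y, h1, h2⟩ := h1
    obtain ⟨M, y', h3, h4⟩ := h3
    obtain ⟨a1, a2⟩ := up h1 h2 M
    obtain ⟨b1, b2⟩ := up h3 h4 N
    rw [add_comm M N] at b1 b2
    exact ⟨N + M, _, by rw [add_pow_char_pow, a1, b1, ← map_add], add_mem a2 b2⟩
  | smul c z _ h1 =>
    obtain ⟨N, y, h1, h2⟩ := h1
    obtain ⟨M, e, he⟩ := pc_exists p c
    obtain ⟨a1, a2⟩ := up h1 h2 M
    refine ⟨N + M, e ^ p ^ N * y ^ p ^ M, ?_, Ideal.mul_mem_left _ _ a2⟩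
    rw [smul_eq_mul, mul_pow, a1, add_comm, pow_add, pow_mul, he, map_mul, map_pow, map_pow]

theorem WR.perfectClosure {l : List D} (h : WR ⊥ l) : WR ⊥ (l.map (PerfectClosure.of D p)) := by
  rw [WR_iff]
  intro l₁' a' l₂' hl
  obtain ⟨l₁, m, rfl, rfl, hm⟩ := List.map_eq_append_iff.1 hl
  obtain ⟨a, l₂, rfl, rfl, rfl⟩ := List.map_eq_cons_iff.1 hm
  have hN : ∀ N, NZ (Ideal.ofList (l₁.map (· ^ p ^ N))) (a ^ p ^ N) := by
    intro N
    have := WR_iff.1 (h.pow (p ^ N)) (l₁.map (· ^ p ^ N)) (a ^ p ^ N) (l₂.map (· ^ p ^ N)) (by simp)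
    simpa using this
  rw [bot_sup_eq]
  intro z hz
  obtain ⟨N, y, h1, h2⟩ := pc_mem_ofList p hz
  obtain ⟨n, x, hx⟩ := pc_exists p z
  have h3 : PerfectClosure.of D p (y ^ p ^ n) =
      PerfectClosure.of D p (a ^ p ^ (N + n) * x ^ p ^ N) := by
    rw [map_pow, ← h1, mul_pow, mul_pow, map_mul, map_pow, map_pow, ← hx, ← pow_mul, ← pow_mul,
      ← pow_mul, ← pow_add, ← pow_add, add_comm n N]
  obtain ⟨M, hM⟩ := pc_of_eq p h3
  have h4 := frob_ofList p _ (n + M) h2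
  rw [pow_add, pow_mul, hM, mul_pow, ← pow_mul, ← pow_add, ← pow_mul, ← pow_add, ] at h4
  have h5 := hN (N + n + M) (x ^ p ^ (N + M)) (by
    simpa [Function.comp_def, ← pow_mul, ← pow_add, add_assoc] using h4)
  refine root_mem_ofList p (N := N + n + M) ?_
  have := Ideal.mem_map_of_mem (PerfectClosure.of D p) h5
  rw [Ideal.map_ofList, map_pow, ← hx, ← pow_mul, ← pow_add] at this
  rw [show N + n + M = n + (N + M) by ring] at this ⊢
  simpa [Function.comp_def] using this
end
end

section
def WEq (p : ℕ) [Fact p.Prime] {E L : Type*} [CommRing E] [CommRing L] (f : Polynomial (WittVector p E))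
    (w : E) (j : E →+* L) (x : L) (h : WittVector p L) : Prop :=
  f.eval₂ (WittVector.map j) (WittVector.teichmuller p x) + WittVector.teichmuller p (j w) * h = h * p

section
universe u
variable (p : ℕ) [Fact p.Prime] {E : Type u} [CommRing E]
  (f : Polynomial (WittVector p E)) (w : E)

theorem WittVector.map_comp' {A B C : Type*} [CommRing A] [CommRing B] [CommRing C] (g : B →+* C) (h : A →+* B) :
    (WittVector.map (p := p) g).comp (WittVector.map h) = WittVector.map (g.comp h) := by
  ext; simp

theorem WEq.map {f : Polynomial (WittVector p E)} {w : E} {L M : Type*} [CommRing L] [CommRing M]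
    {j : E →+* L} {x : L} {h : WittVector p L}
    (e : WEq p f w j x h) (g : L →+* M) : WEq p f w (g.comp j) (g x) (WittVector.map g h) := by
  have := congrArg (WittVector.map g) e
  rw [map_add, map_mul, map_mul, Polynomial.hom_eval₂, WittVector.map_teichmuller,
    WittVector.map_teichmuller, WittVector.map_comp', map_natCast] at this
  exact this

theorem dF_map {L : Type*} [CommRing L] (g : MvPolynomial ℕ E →+* L) :
    WittVector.map g (dF p f) = f.eval₂ (WittVector.map (g.comp MvPolynomial.C))
      (WittVector.teichmuller p (g (MvPolynomial.X 0))) := by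
  rw [dF, dF0, Polynomial.hom_eval₂, Polynomial.hom_eval₂, WittVector.map_comp',
    WittVector.map_comp', WittVector.map_teichmuller, WittVector.map_teichmuller]
  congr 2
  · congr 1
    ext
    simp [MvPolynomial.algebraMap_eq]
  · simp

set_option maxHeartbeats 1000000 in
theorem exists_P [CharP E p] (hf : f.Monic) (hf0 : 0 < f.natDegree) (xs : List E) (hWR : WR ⊥ (w :: xs))
    {L₀ : Type u} [CommRing L₀] [Nontrivial L₀] {j₀ : E →+* L₀} {x₀ : L₀} {h₀ : WittVector p L₀}
    (e₀ : WEq p f w j₀ x₀ h₀) :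
    ∃ (P : Type u) (_ : CommRing P) (_ : CharP P p) (_ : PerfectRing P p) (ι : E →+* P) (X : P)
      (H : WittVector p P), WEq p f w ι X H ∧ WR ⊥ ((w :: xs).map ι) ∧
      (∀ (L : Type u) [CommRing L] [CharP L p] [PerfectRing L p] (j : E →+* L) (x : L)
        (h : WittVector p L), WEq p f w j x h →
        ∃ ψ : P →+* L, ψ.comp ι = j ∧ ψ X = x ∧ WittVector.map ψ H = h) ∧
      (∀ S : Subring P, (∀ a, ι a ∈ S) → X ∈ S → (∀ n, H.coeff n ∈ S) →
        (∀ z, z ^ p ∈ S → z ∈ S) → S = ⊤) := by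
  set J := Ideal.span (Set.range (dr p f w)) with hJ
  let D := MvPolynomial ℕ E ⧸ J
  let π : MvPolynomial ℕ E →+* D := Ideal.Quotient.mk J
  have univ : ∀ (L : Type u) [CommRing L] (j : E →+* L) (x : L) (h : WittVector p L),
      WEq p f w j x h → ∃ ψ : D →+* L, ψ.comp (π.comp MvPolynomial.C) = j ∧
        ψ (π (MvPolynomial.X 0)) = x ∧ ∀ n, ψ (π (MvPolynomial.X (n+1))) = h.coeff n := by
    intro L _ j x h e
    let g : MvPolynomial ℕ E →+* L := MvPolynomial.eval₂Hom j (fun n => n.casesOn x h.coeff)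
    have gC : g.comp MvPolynomial.C = j := by ext; simp [g]
    have gX : g (MvPolynomial.X 0) = x := by simp [g]
    have gH : WittVector.map g (dH p E) = h := by ext n; simp [g, dH]
    have hg : ∀ a ∈ J, g a = 0 := by
      have : J ≤ RingHom.ker g := by
        rw [hJ, Ideal.span_le]
        rintro _ ⟨n, rfl⟩
        have e' : WittVector.map g (dF p f + WittVector.teichmuller p (MvPolynomial.C w) * dH p E) =
            WittVector.map g (dH p E * (p : WittVector p (MvPolynomial ℕ E))) := by
          rw [map_add, map_mul, map_mul, dF_map, WittVector.map_teichmuller, gH, gC, gX, map_natCast,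
            show g (MvPolynomial.C w) = j w from RingHom.congr_fun gC w]
          exact e
        have e2 := congrArg (fun v => v.coeff n) e'
        simp only [WittVector.map_coeff] at e2
        rw [SetLike.mem_coe, RingHom.mem_ker, dr, map_sub, e2, sub_self]
      exact fun a ha => this ha
    refine ⟨Ideal.Quotient.lift J g hg, ?_, ?_, ?_⟩
    · rw [← RingHom.comp_assoc]
      exact gC
    · exact gX
    · intro n; change g _ = _; simp [g]
  have hD : Nontrivial D := by
    obtain ⟨ψ, -⟩ := univ L₀ j₀ x₀ h₀ e₀
    exact ψ.domain_nontrivial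
  have hcD : CharP D p := by
    have h0 : ((p : ℕ) : D) = 0 := by
      have := congrArg (π.comp MvPolynomial.C) (CharP.cast_eq_zero E p)
      rwa [map_natCast, map_zero] at this
    exact (CharP.charP_iff_prime_eq_zero Fact.out).2 h0
  let HD : WittVector p D := WittVector.map π (dH p E)
  have eD : WEq p f w (π.comp MvPolynomial.C) (π (MvPolynomial.X 0)) HD := by
    have := dF_map p f π
    rw [WEq, ← this]
    change _ + WittVector.teichmuller p (π (MvPolynomial.C w)) * WittVector.map π _ =
      WittVector.map π _ * _
    rw [← WittVector.map_teichmuller, ← map_mul, ← map_add,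
      ← map_natCast (WittVector.map π) p, ← map_mul]
    ext n
    rw [WittVector.map_coeff, WittVector.map_coeff, ← sub_eq_zero, ← map_sub]
    exact Ideal.Quotient.eq_zero_iff_mem.2 (Ideal.subset_span ⟨n, rfl⟩)
  have wD : WR ⊥ ((w :: xs).map (π.comp MvPolynomial.C)) := by
    rw [WR_iff]
    intro l₁' a' l₂' hl
    obtain ⟨l₁, m, hl1, rfl, hm⟩ := List.map_eq_append_iff.1 hl
    obtain ⟨a, l₂, rfl, rfl, rfl⟩ := List.map_eq_cons_iff.1 hm
    have h1 := WR_iff.1 hWR _ _ _ hl1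
    rw [bot_sup_eq] at h1
    have h2 := dr_nz p f w hf hf0 _ a h1 (by
      rcases l₁ with _ | ⟨b, l₁⟩
      · simp at hl1; simp [hl1.1]
      · simp at hl1
        rw [hl1.1]
        exact Ideal.mem_sup_left (Ideal.subset_span (by simp)))
    rw [bot_sup_eq]
    intro z hz
    obtain ⟨z, rfl⟩ := Ideal.Quotient.mk_surjective z
    have h3 := h2 z (by
      change π (MvPolynomial.C a) * π z ∈ _ at hz
      rw [← map_mul, ← Ideal.mem_comap, RingHom.coe_comp, ← List.map_map, ← Ideal.map_ofList, ← Ideal.map_ofList,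
        Ideal.comap_map_of_surjective _ Ideal.Quotient.mk_surjective, ← RingHom.ker_eq_comap_bot,
        Ideal.mk_ker] at hz
      convert hz)
    rw [RingHom.coe_comp, ← List.map_map, ← Ideal.map_ofList, ← Ideal.map_ofList]
    change π z ∈ _
    rw [← Ideal.mem_comap,
        Ideal.comap_map_of_surjective _ Ideal.Quotient.mk_surjective, ← RingHom.ker_eq_comap_bot,
        Ideal.mk_ker]
    exact h3
  refine ⟨PerfectClosure D p, inferInstance, inferInstance, inferInstance,
    (PerfectClosure.of D p).comp (π.comp MvPolynomial.C), PerfectClosure.of D p (π (MvPolynomial.X 0)),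
    WittVector.map (PerfectClosure.of D p) HD, eD.map p _, ?_, ?_, ?_⟩
  · have := wD.perfectClosure p
    rwa [List.map_map] at this
  · intro L _ _ _ j x h e
    obtain ⟨ψ, h1, h2, h3⟩ := univ L j x h e
    have key : ∀ y, PerfectClosure.lift D p L ψ (PerfectClosure.of D p y) = ψ y := fun y =>
      RingHom.congr_fun ((PerfectClosure.lift D p L).symm_apply_apply ψ) y
    refine ⟨PerfectClosure.lift D p L ψ, ?_, ?_, ?_⟩
    · rw [← h1]; ext y; exact key _
    · rw [key, h2]
    · ext n
      rw [WittVector.map_coeff, WittVector.map_coeff, key, WittVector.map_coeff, ← h3]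
      rfl
  · intro S h1 h2 h3 h4
    have h5 : ∀ y, PerfectClosure.of D p y ∈ S := by
      intro y
      obtain ⟨y, rfl⟩ := Ideal.Quotient.mk_surjective y
      induction y using MvPolynomial.induction_on with
      | C a => exact h1 a
      | add a b ha hb => rw [map_add, map_add]; exact S.add_mem ha hb
      | mul_X a n ha =>
        rw [map_mul, map_mul]
        refine S.mul_mem ha ?_
        rcases n with _ | n
        · exact h2
        · have := h3 n
          simpa [HD, dH] using this
    rw [eq_top_iff]
    rintro z -
    obtain ⟨N, y, hy⟩ := pc_exists p z
    have : z ^ p ^ N ∈ S := hy ▸ h5 y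
    clear hy
    induction N with
    | zero => simpa using this
    | succ N ih => exact ih (h4 _ (by rwa [← pow_mul, ← pow_succ]))
end
end

section
section
variable (p : ℕ) [Fact p.Prime]

theorem witt_coeff_aux {L : Type*} [CommRing L] [CharP L p] (K h : WittVector p L) (w : L) (n : ℕ) :
    (K + WittVector.teichmuller p w * WittVector.tail n h).coeff n =
      K.coeff n + w ^ p ^ n * h.coeff n := by
  have tl : ∀ x : WittVector p L, ∃ y : WittVector p L, y.coeff 0 = x.coeff n ∧
      WittVector.tail n x = WittVector.verschiebung^[n] y := by
    intro x
    refine ⟨(WittVector.tail n x).shift n, ?_, WittVector.eq_iterate_verschiebung ?_⟩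
    · rw [WittVector.shift_coeff]; simp [WittVector.tail, WittVector.select, WittVector.coeff_mk]
    · intro i hi
      simp [WittVector.tail, WittVector.select, WittVector.coeff_mk, hi]
  obtain ⟨k, hk, hK⟩ := tl K
  obtain ⟨y, hy, hh⟩ := tl h
  obtain ⟨z, hz, hzz⟩ : ∃ z : WittVector p L, z.coeff 0 = w ^ p ^ n * h.coeff n ∧
      WittVector.teichmuller p w * WittVector.tail n h = WittVector.verschiebung^[n] z := by
    refine ⟨y * WittVector.frobenius^[n] (WittVector.teichmuller p w), ?_, ?_⟩
    · rw [WittVector.mul_coeff_zero, hy, WittVector.iterate_frobenius_coeff,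
        WittVector.teichmuller_coeff_zero, mul_comm]
    · rw [hh, mul_comm, WittVector.iterate_verschiebung_mul_left]
  have key : K + WittVector.teichmuller p w * WittVector.tail n h =
      WittVector.init n K + WittVector.verschiebung^[n] (k + z) := by
    conv_lhs => rw [← WittVector.init_add_tail K n]
    rw [hK, hzz, add_assoc, iterate_map_add]
  rw [key, WittVector.coeff_add_of_disjoint]
  · have := WittVector.iterate_verschiebung_coeff (k + z) n 0
    rw [zero_add] at this
    rw [this, WittVector.add_coeff_zero, hk, hz]
    simp [WittVector.init, WittVector.select, WittVector.coeff_mk]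
  · intro m
    by_cases hm : m < n
    · exact Or.inr (WittVector.iterate_verschiebung_coeff_eq_zero _ hm)
    · left; simp [WittVector.init, WittVector.select, WittVector.coeff_mk, hm]

theorem WEq.coeff_mem {E L : Type*} [CommRing E] [CommRing L] [CharP L p]
    {f : Polynomial (WittVector p E)} {w : E}
    {j : E →+* L} {x : L} {h : WittVector p L} (e : WEq p f w j x h) (S : Subring L)
    (h1 : ∀ a, j a ∈ S) (h2 : x ∈ S) (h3 : ∀ b, j w * b ∈ S → b ∈ S) (n : ℕ) : h.coeff n ∈ S := by
  induction n using Nat.strong_induction_on with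
  | _ n ih =>
  have hw : ∀ v : WittVector p L, v ∈ (WittVector.map (p := p) S.subtype).range ↔ ∀ n, v.coeff n ∈ S := by
    intro v
    constructor
    · rintro ⟨v, rfl⟩ n; simp
    · intro hv; exact ⟨WittVector.mk p fun n => ⟨_, hv n⟩, by ext; simp⟩
  have hK : f.eval₂ (WittVector.map j) (WittVector.teichmuller p x) +
      WittVector.teichmuller p (j w) * WittVector.init n h ∈ (WittVector.map (p := p) S.subtype).range := by
    refine add_mem ?_ (mul_mem ?_ ?_)
    · rw [Polynomial.eval₂_eq_sum_range]
      refine sum_mem fun i _ => mul_mem ?_ (pow_mem ?_ _)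
      · rw [hw]; intro n; rw [WittVector.map_coeff]; exact h1 _
      · exact ⟨WittVector.teichmuller p ⟨x, h2⟩, by rw [WittVector.map_teichmuller]; rfl⟩
    · exact ⟨WittVector.teichmuller p ⟨_, h1 w⟩, by rw [WittVector.map_teichmuller]; rfl⟩
    · rw [hw]; intro m
      by_cases hm : m < n
      · simpa [WittVector.init, WittVector.select, WittVector.coeff_mk, hm] using ih m hm
      · simp [WittVector.init, WittVector.select, WittVector.coeff_mk, hm]
  have e2 := witt_coeff_aux p (f.eval₂ (WittVector.map j) (WittVector.teichmuller p x) +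
      WittVector.teichmuller p (j w) * WittVector.init n h) h (j w) n
  rw [add_assoc, ← mul_add, WittVector.init_add_tail, show _ = _ from e] at e2
  have h5 : (h * (p : WittVector p L)).coeff n ∈ S := by
    rcases n with _ | n
    · rw [WittVector.mul_charP_coeff_zero]; exact zero_mem _
    · rw [WittVector.mul_charP_coeff_succ]; exact pow_mem (ih _ (Nat.lt_succ_self n)) _
  have h6 : (j w) ^ p ^ n * h.coeff n ∈ S := by
    rw [← sub_eq_iff_eq_add'] at e2
    rw [← e2]; exact sub_mem h5 ((hw _).1 hK n)
  clear e2 h5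
  generalize p ^ n = k at h6
  induction k with
  | zero => simpa using h6
  | succ k ihk => exact ihk (h3 _ (by rwa [← mul_assoc, ← pow_succ']))
end
end

section
section
variable (p : ℕ) [Fact p.Prime]

noncomputable def rt {P : Type*} [CommRing P] [CharP P p] [PerfectRing P p] (k : ℕ) : P →+* P :=
  ((iterateFrobeniusEquiv P p k).symm : P →+* P)

variable {P : Type*} [CommRing P] [CharP P p] [PerfectRing P p]

theorem rt_pow (k : ℕ) (z : P) : rt p k z ^ p ^ k = z :=
  (iterateFrobeniusEquiv P p k).apply_symm_apply z

theorem pow_inj (k : ℕ) {y z : P} (h : y ^ p ^ k = z ^ p ^ k) : y = z :=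
  (iterateFrobeniusEquiv P p k).injective h

theorem rt_add_pow (k m : ℕ) (z : P) : rt p (k + m) z ^ p ^ m = rt p k z := by
  apply pow_inj p k
  rw [← pow_mul, ← pow_add, add_comm m k, rt_pow, rt_pow]

theorem map_rt {L : Type*} [CommRing L] [CharP L p] [PerfectRing L p] (g : P →+* L) (k : ℕ) (z : P) :
    g (rt p k z) = rt p k (g z) := by
  apply pow_inj p k
  rw [rt_pow, ← map_pow, rt_pow]

theorem away_charP {X : P} (hX : X ≠ 0) : CharP (Localization.Away X) p := by
  have : Nontrivial (Localization.Away X) := by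
    by_contra h
    rw [not_nontrivial_iff_subsingleton] at h
    have h1 : algebraMap P (Localization.Away X) 1 = algebraMap P (Localization.Away X) 0 :=
      Subsingleton.elim _ _
    obtain ⟨⟨_, m, rfl⟩, hc⟩ := (IsLocalization.eq_iff_exists (Submonoid.powers X) _).1 h1
    simp only [mul_one, mul_zero] at hc
    apply hX
    apply pow_inj p m
    rw [zero_pow (pow_ne_zero _ (Fact.out : p.Prime).ne_zero)]
    have : m ≤ p ^ m := (Nat.lt_pow_self (Fact.out : p.Prime).one_lt).le
    rw [← Nat.add_sub_cancel' this, pow_add, hc, zero_mul]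
  refine (CharP.charP_iff_prime_eq_zero Fact.out).2 ?_
  rw [← map_natCast (algebraMap P _), CharP.cast_eq_zero, map_zero]

theorem away_eq {X : P} {a b : P} (h : algebraMap P (Localization.Away X) a = algebraMap P _ b) (k : ℕ) :
    rt p k X * a = rt p k X * b := by
  obtain ⟨⟨_, m, rfl⟩, hc⟩ := (IsLocalization.eq_iff_exists (Submonoid.powers X) _).1 h
  simp only at hc
  apply pow_inj p (k + m)
  rw [mul_pow, mul_pow, pow_add, pow_mul, rt_pow, pow_mul, pow_mul]
  have : m ≤ p ^ m := (Nat.lt_pow_self (Fact.out : p.Prime).one_lt).le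
  rw [← Nat.add_sub_cancel' this]
  generalize p ^ m - m = s
  have hc2 : X ^ m * a ^ p ^ k = X ^ m * b ^ p ^ k := by
    have e := congrArg (· ^ p ^ k) hc
    simp only [mul_pow] at e
    rcases m with _ | m
    · simpa using e
    ·
      have : X ^ (m+1) * (a - b) = 0 := by rw [mul_sub, hc, sub_self]
      rw [← sub_eq_zero, ← mul_sub, ← sub_pow_char_pow]
      have h2 : 1 ≤ p ^ k := Nat.one_le_pow _ _ (Fact.out : p.Prime).pos
      obtain ⟨c, hc⟩ := Nat.exists_eq_add_of_le h2
      rw [hc, pow_add (a - b), pow_one, ← mul_assoc, this, zero_mul]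
  have hm : ∀ i ≥ 1, X ^ m * (a ^ p ^ k) ^ i = X ^ m * (b ^ p ^ k) ^ i := by
    intro i hi
    induction i, hi using Nat.le_induction with
    | base => simpa using hc2
    | succ i hi ih =>
      rw [pow_succ, ← mul_assoc, ih, pow_succ]
      linear_combination (b ^ p ^ k) ^ i * hc2
  rw [pow_add X]
  by_cases h0 : m + s = 0
  · rw [h0]; have : m = 0 := by omega
    subst this; simp
  · linear_combination X ^ s * hm (m + s) (by omega)

theorem away_perfect {X : P} [CharP (Localization.Away X) p] : PerfectRing (Localization.Away X) p := by
  have hp : p ≠ 0 := (Fact.out : p.Prime).ne_zero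
  have hX : IsUnit (algebraMap P (Localization.Away X) X) := IsLocalization.Away.algebraMap_isUnit X
  refine ⟨⟨?_, ?_⟩⟩
  · change Function.Injective (frobenius (Localization.Away X) p)
    rw [injective_iff_map_eq_zero]
    intro z hz
    obtain ⟨n, a, ha⟩ := IsLocalization.Away.surj X z
    rw [frobenius_def] at hz
    have h1 : algebraMap P (Localization.Away X) (a ^ p) = algebraMap P _ 0 := by
      rw [map_pow, ← ha, mul_pow, hz, zero_mul, map_zero]
    have h2 := away_eq p h1 0
    have h3 : (X * a) ^ p ^ 1 = 0 ^ p ^ 1 := by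
      have h4 : rt p 0 X = X := by simpa using rt_pow p 0 X
      rw [h4] at h2
      rw [pow_one, mul_pow, zero_pow hp]
      obtain ⟨q, hq⟩ := Nat.exists_eq_succ_of_ne_zero hp
      rw [mul_zero] at h2
      have : X ^ p = X ^ q * X := by rw [hq, Nat.succ_eq_add_one, pow_succ]
      rw [this, mul_assoc, h2, mul_zero]
    have h5 := pow_inj p 1 h3
    have h6 := congrArg (algebraMap P (Localization.Away X)) h5
    rw [map_mul, ← ha, map_zero] at h6
    have h7 := hX.mul_right_eq_zero.1 h6
    exact (hX.pow n).mul_left_eq_zero.1 h7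
  · intro z
    obtain ⟨n, a, ha⟩ := IsLocalization.Away.surj X z
    obtain ⟨y, hy⟩ := hX.exists_left_inv
    refine ⟨y ^ n * algebraMap P _ (rt p 1 (a * X ^ ((p - 1) * n))), ?_⟩
    change _ ^ p = z
    rw [mul_pow, ← map_pow]
    have := rt_pow p 1 (a * X ^ ((p - 1) * n))
    rw [pow_one] at this
    rw [this, map_mul, ← ha, map_pow, ← pow_mul]
    have h1 : n + (p - 1) * n = n * p := by
      obtain ⟨q, hq⟩ := Nat.exists_eq_succ_of_ne_zero hp
      rw [hq]; simp; ring
    calc y ^ (n * p) * (z * algebraMap P _ X ^ n * algebraMap P _ X ^ ((p-1)*n))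
        = z * (y * algebraMap P _ X) ^ (n * p) := by rw [mul_assoc, ← pow_add, h1, mul_pow]; ring
      _ = z := by rw [hy, one_pow, mul_one]
end
end

section
section
open Polynomial
variable (p : ℕ) [Fact p.Prime]

noncomputable def PnS {P A : Type*} [CommRing P] [CommRing A] [CharP A p] [PerfectRing A p] (i : P →+* A) (u : A) : Subring A :=
  ⨆ k : ℕ, (eval₂RingHom i (rt p k u)).range

variable {P A : Type*} [CommRing P] [CommRing A] [CharP A p] [PerfectRing A p] (i : P →+* A) (u : A)

theorem PnS_mono {k l : ℕ} (h : k ≤ l) :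
    (eval₂RingHom i (rt p k u)).range ≤ (eval₂RingHom i (rt p l u)).range := by
  rintro _ ⟨g, rfl⟩
  refine ⟨expand P (p ^ (l - k)) g, ?_⟩
  obtain ⟨m, rfl⟩ := Nat.exists_eq_add_of_le h
  simp only [coe_eval₂RingHom, Nat.add_sub_cancel_left]
  rw [Polynomial.expand_eq_comp_X_pow, eval₂_comp]
  simp [rt_add_pow]

theorem mem_PnS {z : A} : z ∈ PnS p i u ↔ ∃ k, ∃ g : P[X], z = eval₂ i (rt p k u) g := by
  unfold PnS
  rw [Subring.mem_iSup_of_directed]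
  · simp only [RingHom.mem_range, coe_eval₂RingHom]
    constructor
    · rintro ⟨k, g, h⟩; exact ⟨k, g, h.symm⟩
    · rintro ⟨k, g, h⟩; exact ⟨k, g, h.symm⟩
  · exact (monotone_nat_of_le_succ fun n => PnS_mono p i u (Nat.le_succ n)).directed_le

theorem mem_PnS_ge (a : ℕ) {z : A} (h : z ∈ PnS p i u) : ∃ k ≥ a, ∃ g : P[X], z = eval₂ i (rt p k u) g := by
  obtain ⟨k, g, rfl⟩ := (mem_PnS p i u).1 h
  obtain ⟨g', hg⟩ := PnS_mono p i u (le_max_left k a) ⟨g, rfl⟩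
  exact ⟨_, le_max_right k a, g', hg.symm⟩

theorem rt_mem_PnS [CharP P p] [PerfectRing P p] {z : A} (h : z ∈ PnS p i u) : rt p 1 z ∈ PnS p i u := by
  obtain ⟨k, g, rfl⟩ := (mem_PnS p i u).1 h
  refine (mem_PnS p i u).2 ⟨k + 1, g.map (rt p 1), ?_⟩
  rw [hom_eval₂, eval₂_map]
  have h1 : (rt p 1).comp i = i.comp (rt p 1) := by
    ext z; simp [map_rt]
  rw [h1]
  congr 1
  apply pow_inj p 1
  rw [rt_pow, rt_add_pow]

theorem PnS_charP [Nontrivial A] : CharP (PnS p i u) p := by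
  refine (CharP.charP_iff_prime_eq_zero Fact.out).2 ?_
  apply Subtype.ext
  simp

theorem PnS_perfect [CharP P p] [PerfectRing P p] [CharP (PnS p i u) p] : PerfectRing (PnS p i u) p := by
  refine ⟨⟨?_, ?_⟩⟩
  · intro y z h
    apply Subtype.ext
    apply pow_inj p 1
    have := congrArg Subtype.val h
    simpa using this
  · intro z
    refine ⟨⟨_, rt_mem_PnS p i u z.2⟩, ?_⟩
    apply Subtype.ext
    have := rt_pow p 1 z.1
    simpa using this

theorem i_mem_PnS (z : P) : i z ∈ PnS p i u := (mem_PnS p i u).2 ⟨0, C z, by simp⟩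
theorem u_mem_PnS : u ∈ PnS p i u := (mem_PnS p i u).2 ⟨0, X, by simpa using (rt_pow p 0 u).symm⟩

variable [CharP P p] [PerfectRing P p] {a : ℕ} {ϖ x : P}

theorem PnS_key (hu : i x * u = i ϖ ^ p ^ a) (k : ℕ) : i (rt p k x) * rt p k u = i (rt p k (ϖ ^ p ^ a)) := by
  rw [map_rt, map_rt, map_pow, ← hu, map_mul]

theorem PnS_keyN (hu : i x * u = i ϖ ^ p ^ a) (m : ℕ) : i (rt p a x) * rt p (a + m) u ^ p ^ m = i ϖ := by
  rw [rt_add_pow, PnS_key p i u hu]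
  congr 1
  apply pow_inj p a
  rw [rt_pow]

theorem PnS_R1 (hu : i x * u = i ϖ ^ p ^ a) {z : A} (hz : z ∈ PnS p i u) :
    ∃ b : P, ∃ z' ∈ PnS p i u, i (rt p a x) * z = i b + i ϖ * z' := by
  obtain ⟨k, hk, g, rfl⟩ := mem_PnS_ge p i u a hz
  obtain ⟨m, rfl⟩ := Nat.exists_eq_add_of_le hk
  induction g using Polynomial.induction_on' with
  | add f g hf hg =>
    obtain ⟨b, z, hz, e⟩ := hf ((mem_PnS p i u).2 ⟨_, f, rfl⟩)
    obtain ⟨b', z', hz', e'⟩ := hg ((mem_PnS p i u).2 ⟨_, g, rfl⟩)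
    refine ⟨b + b', z + z', add_mem hz hz', ?_⟩
    rw [eval₂_add, mul_add, e, e', map_add]; ring
  | monomial j c =>
    rw [eval₂_monomial]
    by_cases h : p ^ m ≤ j
    · obtain ⟨s, rfl⟩ := Nat.exists_eq_add_of_le h
      refine ⟨0, i c * rt p (a + m) u ^ s, (mem_PnS p i u).2 ⟨a + m, monomial s c, by rw [eval₂_monomial]⟩, ?_⟩
      rw [← PnS_keyN p i u hu m, pow_add, map_zero]; ring
    · obtain ⟨s, hs⟩ := Nat.exists_eq_add_of_lt (not_le.1 h)
      refine ⟨c * (rt p (a + m) x) ^ (s + 1) * (rt p (a+m) (ϖ ^ p ^ a)) ^ j, 0, zero_mem _, ?_⟩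
      rw [← rt_add_pow p a m x, hs, map_mul, map_mul, map_pow, map_pow, map_pow, ← PnS_key p i u hu]
      ring

theorem PnS_R2 (hu : i x * u = i ϖ ^ p ^ a) {z : A} (hz : z ∈ PnS p i u) {y : P} (hy : i y = i ϖ * z)
   (k : ℕ) : ∃ c, i (rt p k x * rt p a x) * z = i c := by
  obtain ⟨k0, hk, g, hg⟩ := mem_PnS_ge p i u a hz
  obtain ⟨m, rfl⟩ := Nat.exists_eq_add_of_le hk
  set v := rt p (a + m) u with hv
  set w := i (rt p a x) * z with hw
  have hvw : v ^ p ^ m * w = i y := by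
    rw [hy, ← PnS_keyN p i u hu m]; ring
  let D := p ^ m + g.natDegree
  have hstab : ∀ h : P[X], h.natDegree ≤ D → ∃ h' : P[X], h'.natDegree ≤ D ∧ w * eval₂ i v h = eval₂ i v h' := by
    suffices ∀ j ≤ D, ∃ h' : P[X], h'.natDegree ≤ D ∧ w * v ^ j = eval₂ i v h' by
      intro h hh
      choose! q hq1 hq2 using this
      refine ⟨∑ j ∈ Finset.range (D + 1), C (h.coeff j) * q j, ?_, ?_⟩
      · apply natDegree_sum_le_of_forall_le
        intro j hj
        rw [Finset.mem_range] at hj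
        exact (natDegree_C_mul_le _ _).trans (hq1 j (by omega))
      · rw [eval₂_eq_sum_range' i (Nat.lt_succ_of_le hh), eval₂_finsetSum, Finset.mul_sum]
        refine Finset.sum_congr rfl fun j hj => ?_
        rw [Finset.mem_range] at hj
        rw [eval₂_mul, eval₂_C, ← hq2 j (by omega)]; ring
    intro j hj
    by_cases h : p ^ m ≤ j
    · obtain ⟨s, rfl⟩ := Nat.exists_eq_add_of_le h
      refine ⟨C y * X ^ s, (natDegree_C_mul_X_pow_le _ _).trans (by omega), ?_⟩
      rw [eval₂_mul, eval₂_C, eval₂_pow, eval₂_X, ← hvw, pow_add]; ring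
    · refine ⟨C (rt p a x) * (g * X ^ j), ?_, ?_⟩
      · refine (natDegree_C_mul_le _ _).trans ?_
        refine natDegree_mul_le.trans ?_
        have := natDegree_X_pow_le (R := P) j
        omega
      · rw [hw, hg, eval₂_mul, eval₂_mul, eval₂_C, eval₂_pow, eval₂_X]; ring
  have hpow : ∀ j : ℕ, ∃ h' : P[X], h'.natDegree ≤ D ∧ w ^ j = eval₂ i v h' := by
    intro j
    induction j with
    | zero => exact ⟨1, by simp, by simp⟩
    | succ j ih =>
      obtain ⟨h, h1, h2⟩ := ih
      obtain ⟨h', h3, h4⟩ := hstab h h1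
      exact ⟨h', h3, by rw [pow_succ', h2, h4]⟩
  have hXv : ∃ e : P, i x * v = i e := by
    have h1 : 1 ≤ p ^ (a + m) := Nat.one_le_pow _ _ (Fact.out : p.Prime).pos
    obtain ⟨s, hs⟩ := Nat.exists_eq_add_of_le' h1
    refine ⟨rt p (a+m) x ^ s * rt p (a+m) (ϖ ^ p ^ a), ?_⟩
    nth_rewrite 1 [← rt_pow p (a+m) x]
    rw [hs, map_mul, ← PnS_key p i u hu, pow_succ, map_mul]; ring
  obtain ⟨e, he⟩ := hXv
  have hD : ∀ j : ℕ, ∃ c : P, i x ^ D * w ^ j = i c := by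
    intro j
    obtain ⟨h, h1, h2⟩ := hpow j
    refine ⟨∑ l ∈ Finset.range (D + 1), x ^ (D - l) * e ^ l * h.coeff l, ?_⟩
    rw [h2, eval₂_eq_sum_range' i (Nat.lt_succ_of_le h1), map_sum, Finset.mul_sum]
    refine Finset.sum_congr rfl fun l hl => ?_
    rw [Finset.mem_range] at hl
    obtain ⟨s, hs⟩ := Nat.exists_eq_add_of_le (Nat.le_of_lt_succ hl)
    rw [map_mul, map_mul, map_pow, map_pow, ← he, hs, Nat.add_sub_cancel_left]; ring
  obtain ⟨c, hc⟩ := hD (p ^ (k + D))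
  obtain ⟨s, hs⟩ := Nat.exists_eq_add_of_le ((Nat.lt_pow_self (Fact.out : p.Prime).one_lt).le : D ≤ p ^ D)
  refine ⟨rt p (k + D) (c) * rt p (k+D) x ^ s, ?_⟩
  have h1 : i (rt p (k + D) x) ^ D * w = i (rt p (k + D) c) := by
    apply pow_inj p (k + D)
    rw [← map_pow i (rt p (k + D) c), rt_pow, ← hc, mul_pow, pow_right_comm, ← map_pow i (rt p (k + D) x),
      rt_pow]
  rw [map_mul, map_mul, ← h1, map_pow, ← rt_add_pow p k D x, hs, map_pow]; rw [hw]; ring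
end
end

section
section
open Polynomial

theorem exists_Pn.{u} (p : ℕ) [Fact p.Prime] {P : Type u} [CommRing P] [CharP P p] [PerfectRing P p]
    (ϖ x : P) (hϖ : ∀ z, ϖ * z = 0 → z = 0) (hx : x ≠ 0) (a : ℕ) :
    ∃ (Q : Type u) (_ : CommRing Q) (_ : CharP Q p) (_ : PerfectRing Q p) (i : P →+* Q) (u : Q),
      i x * u = i ϖ ^ p ^ a ∧ (∀ z, i ϖ * z = 0 → z = 0) ∧
      (∀ z, ∃ b z', i (rt p a x) * z = i b + i ϖ * z') ∧
      (∀ y z, i y = i ϖ * z → ∀ k, ∃ c, rt p k x ^ 2 * rt p a x * y = ϖ * c) ∧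
      (∀ (L : Type u) [CommRing L] [CharP L p] [PerfectRing L p] (j : P →+* L) (uL : L),
        j x * uL = j ϖ ^ p ^ a → (∀ z, j ϖ * z = 0 → z = 0) → ∃ ψ : Q →+* L, ψ.comp i = j) := by
  have := away_charP p hx
  have := away_perfect p (X := x)
  have : Nontrivial (Localization.Away x) := CharP.nontrivial_of_char_ne_one (v := p) (Fact.out : p.Prime).ne_one
  let A := Localization.Away x
  let i0 : P →+* A := algebraMap P A
  obtain ⟨y, hy⟩ := (IsLocalization.Away.algebraMap_isUnit (S := A) x).exists_right_inv
  obtain ⟨u, hu⟩ : ∃ u, i0 x * u = i0 ϖ ^ p ^ a := ⟨y * i0 ϖ ^ p ^ a, by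
    rw [← mul_assoc]
    change algebraMap P A x * y * _ = _
    rw [hy, one_mul]⟩
  have := PnS_charP p i0 u
  have := PnS_perfect p i0 u
  have hNZ : ∀ z : A, i0 ϖ * z = 0 → z = 0 := by
    intro z hz
    obtain ⟨n, b, hb⟩ := IsLocalization.Away.surj x z
    have h1 : algebraMap P A (ϖ * b) = algebraMap P A 0 := by
      rw [map_mul, ← hb, map_zero, ← mul_assoc]
      change i0 ϖ * z * _ = 0
      rw [hz, zero_mul]
    have h2 := away_eq p h1 0
    have h3 : rt p 0 x * b = 0 := by
      apply hϖ; rw [mul_zero] at h2; rw [← h2]; ring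
    have h4 := congrArg (algebraMap P A) h3
    have h5 : rt p 0 x = x := by simpa using rt_pow p 0 x
    have hX : IsUnit (algebraMap P A x) := IsLocalization.Away.algebraMap_isUnit x
    rw [map_mul, h5, map_zero, ← hb] at h4
    exact (hX.pow n).mul_left_eq_zero.1 (hX.mul_right_eq_zero.1 h4)
  refine ⟨PnS p i0 u, inferInstance, inferInstance, inferInstance, i0.codRestrict _ (i_mem_PnS p i0 u),
    ⟨u, u_mem_PnS p i0 u⟩, Subtype.ext hu, ?_, ?_, ?_, ?_⟩
  · intro z hz
    exact Subtype.ext (hNZ _ (congrArg Subtype.val hz))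
  · intro z
    obtain ⟨b, z', hz', e⟩ := PnS_R1 p i0 u hu z.2
    exact ⟨b, ⟨z', hz'⟩, Subtype.ext e⟩
  · intro y z h k
    obtain ⟨c, hc⟩ := PnS_R2 p i0 u hu z.2 (congrArg Subtype.val h) k
    refine ⟨rt p k x * c, ?_⟩
    have h1 : i0 (rt p k x * rt p a x * y) = i0 (ϖ * c) := by
      have h' : i0 y = i0 ϖ * z := congrArg Subtype.val h
      rw [map_mul i0 ϖ, ← hc, map_mul, h']; ring
    have h2 := away_eq p h1 k
    linear_combination h2
  · intro L _ _ _ j uL huL hjϖ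
    have : Nontrivial L := CharP.nontrivial_of_char_ne_one (v := p) (Fact.out : p.Prime).ne_one
    have hpw : ∀ n z, j ϖ ^ n * z = 0 → z = 0 := by
      intro n
      induction n with
      | zero => intro z hz; simpa using hz
      | succ n ih => intro z hz; exact hjϖ _ (ih _ (by rw [← hz]; ring))
    have hjx : ∀ z, j x * z = 0 → z = 0 := by
      intro z hz
      apply hpw (p ^ a)
      rw [← huL, mul_right_comm, hz, zero_mul]
    have hjx0 : j x ≠ 0 := by
      intro h
      exact one_ne_zero (hjx 1 (by rw [h, zero_mul]))
    have := away_charP p hjx0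
    have := away_perfect p (X := j x)
    let M := Localization.Away (j x)
    let iL : L →+* M := algebraMap L M
    have hinj : Function.Injective iL := by
      refine IsLocalization.injective M (M := Submonoid.powers (j x)) ?_
      rw [Submonoid.powers_le, mem_nonZeroDivisors_iff_left]
      exact hjx
    let F : A →+* M := IsLocalization.map (M := Submonoid.powers x) (T := Submonoid.powers (j x)) M j (by
      rw [Submonoid.powers_le]; exact ⟨1, by simp⟩)
    have hF : ∀ z, F (i0 z) = iL (j z) := fun z => IsLocalization.map_eq _ z
    have hFu : F u = iL uL := by
      have h1 := congrArg F hu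
      rw [map_mul, map_pow, hF, hF, ← map_pow, ← huL, map_mul] at h1
      exact (IsLocalization.Away.algebraMap_isUnit (S := M) (j x)).mul_left_cancel h1
    have hr : ∀ z : PnS p i0 u, F z ∈ iL.range := by
      intro z
      obtain ⟨k, g, hz⟩ := (mem_PnS p i0 u).1 z.2
      refine ⟨eval₂ j (rt p k uL) g, ?_⟩
      rw [hz, hom_eval₂, hom_eval₂, map_rt, map_rt, hFu]
      congr 1
      ext z; exact (hF z).symm
    let e := RingEquiv.ofBijective iL.rangeRestrict
      ⟨fun a b h => hinj (congrArg Subtype.val h), iL.rangeRestrict_surjective⟩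
    refine ⟨(e.symm : iL.range →+* L).comp ((F.comp (PnS p i0 u).subtype).codRestrict iL.range hr), ?_⟩
    ext z
    simp only [RingHom.comp_apply, RingHom.coe_coe]
    rw [RingEquiv.symm_apply_eq]
    apply Subtype.ext
    exact hF z
end
end

section
theorem integr_pow_aux {S : Type*} [CommRing S] (p : S) (M m : ℕ) (y : S) (μ : ℕ → S)
    (h : y ^ m + ∑ i ∈ Finset.range m, μ i * p ^ (M * (m - i)) * y ^ i = 0) (j : ℕ) :
    ∃ s, p ^ (M * m) * y ^ j = p ^ (M * j) * s := by
    induction j using Nat.strong_induction_on with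
    | _ j ih =>
      by_cases hj : j < m
      · obtain ⟨r, rfl⟩ := Nat.exists_eq_add_of_le hj.le
        exact ⟨p ^ (M * r) * y ^ j, by rw [← mul_assoc, ← pow_add]; ring⟩
      · obtain ⟨l, rfl⟩ := Nat.exists_eq_add_of_le (not_lt.1 hj)
        have h1 : ∀ i, ∃ s, i < m → p ^ (M * m) * y ^ (i + l) = p ^ (M * (i + l)) * s := by
          intro i
          by_cases hi : i < m
          · obtain ⟨s, hs⟩ := ih (i + l) (by omega)
            exact ⟨s, fun _ => hs⟩
          · exact ⟨0, fun h => absurd h hi⟩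
        choose s hs using h1
        refine ⟨- ∑ i ∈ Finset.range m, μ i * s i, ?_⟩
        have e1 : y ^ m = - ∑ i ∈ Finset.range m, μ i * p ^ (M * (m - i)) * y ^ i := by
          linear_combination h
        rw [pow_add, e1, mul_neg, neg_mul, Finset.sum_mul, mul_neg, Finset.mul_sum, Finset.mul_sum]
        congr 1
        refine Finset.sum_congr rfl fun i hi => ?_
        rw [Finset.mem_range] at hi
        have e2 : M * (m + l) = M * (m - i) + M * (i + l) := by
          rw [← mul_add]; congr 1; omega
        have := hs i hi
        rw [e2, pow_add]
        linear_combination (μ i * p ^ (M * (m - i))) * this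

section
open WittVector
variable (p : ℕ) [hpF : Fact p.Prime] {P : Type*} [CommRing P]

abbrev SS (ϖ : P) : Type _ := WittVector p P ⧸ Ideal.span {(p : WittVector p P) - teichmuller p ϖ}

noncomputable abbrev smk (ϖ : P) : WittVector p P →+* SS p ϖ := Ideal.Quotient.mk _

noncomputable def sred [CharP P p] (ϖ : P) : SS p ϖ →+* P ⧸ Ideal.span {ϖ} :=
  Ideal.Quotient.lift _ ((Ideal.Quotient.mk (Ideal.span {ϖ})).comp (constantCoeff)) (by
    intro a ha
    obtain ⟨c, rfl⟩ := Ideal.mem_span_singleton'.1 ha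
    rw [RingHom.comp_apply, Ideal.Quotient.eq_zero_iff_mem, map_mul, map_sub, map_natCast,
      CharP.cast_eq_zero, zero_sub]
    have : (constantCoeff (teichmuller p ϖ) : P) = ϖ := teichmuller_coeff_zero p ϖ
    rw [this]
    exact Ideal.mul_mem_left _ _ (neg_mem (Ideal.mem_span_singleton_self ϖ)))

theorem sred_smk [CharP P p] (ϖ : P) (w : WittVector p P) :
    sred p ϖ (smk p ϖ w) = Ideal.Quotient.mk (Ideal.span {ϖ}) (w.coeff 0) := rfl

theorem smk_teich (ϖ : P) : smk p ϖ (teichmuller p ϖ) = p := by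
  rw [← map_natCast (smk p ϖ), eq_comm, Ideal.Quotient.eq]
  exact Ideal.mem_span_singleton_self _

variable [CharP P p] [PerfectRing P p]

theorem witt_div_p {w : WittVector p P} (h : w.coeff 0 = 0) : ∃ w', w = p * w' := by
  have := (mem_span_p_iff_coeff_zero_eq_zero w).2 h
  obtain ⟨c, hc⟩ := Ideal.mem_span_singleton'.1 this
  exact ⟨c, by rw [← hc, mul_comm]⟩

theorem witt_p_cancel {w : WittVector p P} (h : p * w = 0) : w = 0 := by
  apply eq_zero_of_p_mul_eq_zero w
  simpa [mul_comm] using h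

theorem sred_eq_zero (ϖ : P) (s : SS p ϖ) (h : sred p ϖ s = 0) : ∃ s', s = p * s' := by
  obtain ⟨w, rfl⟩ := Ideal.Quotient.mk_surjective s
  have h1 : Ideal.Quotient.mk (Ideal.span {ϖ}) (w.coeff 0) = 0 := h
  rw [Ideal.Quotient.eq_zero_iff_mem] at h1
  obtain ⟨c, hc⟩ := Ideal.mem_span_singleton'.1 h1
  obtain ⟨w', hw'⟩ := witt_div_p p (w := w - teichmuller p ϖ * teichmuller p c) (by
    have : ∀ v : WittVector p P, v.coeff 0 = constantCoeff v := fun _ => rfl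
    rw [this, map_sub, map_mul, ← this, ← this, ← this, teichmuller_coeff_zero, teichmuller_coeff_zero, ← hc]
    ring)
  refine ⟨smk p ϖ (teichmuller p c + w'), ?_⟩
  have h2 : smk p ϖ w = smk p ϖ (teichmuller p ϖ * teichmuller p c + p * w') := by
    rw [← hw']; congr 1; ring
  change smk p ϖ w = _
  rw [h2, map_add, map_mul, map_mul, smk_teich, map_natCast, map_add]; ring

theorem SS_tf (ϖ : P) (hϖ : ∀ z, ϖ * z = 0 → z = 0) (s : SS p ϖ) (h : p * s = 0) : s = 0 := by
  obtain ⟨w, rfl⟩ := Ideal.Quotient.mk_surjective s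
  change smk p ϖ w = 0
  have h1 : smk p ϖ (p * w) = 0 := by rw [map_mul, map_natCast]; exact h
  rw [Ideal.Quotient.eq_zero_iff_mem] at h1
  obtain ⟨c, hc⟩ := Ideal.mem_span_singleton'.1 h1
  have h2 : c.coeff 0 = 0 := by
    apply hϖ
    have : ∀ v : WittVector p P, v.coeff 0 = constantCoeff v := fun _ => rfl
    have h3 := congrArg (constantCoeff (p := p) (R := P)) hc
    simp only [map_mul, map_sub, map_natCast, CharP.cast_eq_zero, zero_mul] at h3
    rw [← this, ← this, teichmuller_coeff_zero] at h3
    linear_combination -h3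
  obtain ⟨c', rfl⟩ := witt_div_p p h2
  have h4 : w = c' * (p - teichmuller p ϖ) := by
    rw [← sub_eq_zero]
    apply witt_p_cancel p
    rw [mul_sub, ← hc]; ring
  rw [Ideal.Quotient.eq_zero_iff_mem, h4]
  exact Ideal.mul_mem_left _ _ (Ideal.mem_span_singleton_self _)

noncomputable def spi (ϖ : P) (k : ℕ) : SS p ϖ := smk p ϖ (teichmuller p (rt p k ϖ))

theorem spi_pow (ϖ : P) (k : ℕ) : spi p ϖ k ^ p ^ k = p := by
  rw [spi, ← map_pow, ← map_pow, rt_pow, smk_teich]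

theorem SS_root1 (ϖ : P) (y : SS p ϖ) (h : ∃ s, y ^ p = p * s) : ∃ s, y = spi p ϖ 1 * s := by
  have hp1 := (Fact.out : p.Prime).one_lt
  obtain ⟨s, hs⟩ := h
  obtain ⟨w, rfl⟩ := Ideal.Quotient.mk_surjective y
  have h1 : sred p ϖ (smk p ϖ w ^ p) = 0 := by
    rw [show smk p ϖ w ^ p = p * s from hs, map_mul, map_natCast]
    have : ((p : ℕ) : P ⧸ Ideal.span {ϖ}) = 0 := by
      rw [← map_natCast (Ideal.Quotient.mk _), CharP.cast_eq_zero, map_zero]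
    rw [this, zero_mul]
  rw [map_pow, sred_smk, ← map_pow, Ideal.Quotient.eq_zero_iff_mem] at h1
  obtain ⟨c, hc⟩ := Ideal.mem_span_singleton'.1 h1
  have h2 : w.coeff 0 = rt p 1 ϖ * rt p 1 c := by
    apply pow_inj p 1
    rw [mul_pow, rt_pow, rt_pow, pow_one, ← hc, mul_comm]
  have h3 : sred p ϖ (smk p ϖ w - spi p ϖ 1 * smk p ϖ (teichmuller p (rt p 1 c))) = 0 := by
    rw [map_sub, map_mul, spi, sred_smk, sred_smk, sred_smk, teichmuller_coeff_zero, teichmuller_coeff_zero,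
      h2, map_mul, sub_self]
  obtain ⟨s', hs'⟩ := sred_eq_zero p ϖ _ h3
  obtain ⟨q, hq⟩ := Nat.exists_eq_add_of_lt hp1
  refine ⟨smk p ϖ (teichmuller p (rt p 1 c)) + spi p ϖ 1 ^ (p - 1) * s', ?_⟩
  have h4 : (p : SS p ϖ) = spi p ϖ 1 * spi p ϖ 1 ^ (p - 1) := by
    rw [← pow_succ', Nat.sub_add_cancel hp1.le]
    have := spi_pow p ϖ 1
    rw [pow_one] at this
    exact this.symm
  rw [sub_eq_iff_eq_add, h4] at hs'
  change smk p ϖ w = _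
  rw [hs']; ring

theorem SS_tfpow (ϖ : P) (hϖ : ∀ z, ϖ * z = 0 → z = 0) (n : ℕ) {s t : SS p ϖ} (h : p ^ n * s = p ^ n * t) : s = t := by
  induction n with
  | zero => simpa using h
  | succ n ih =>
    apply ih
    rw [← sub_eq_zero]
    apply SS_tf p ϖ hϖ
    rw [mul_sub, sub_eq_zero, ← mul_assoc, ← mul_assoc, ← pow_succ', h]

theorem SS_root (ϖ : P) (hϖ : ∀ z, ϖ * z = 0 → z = 0) (y : SS p ϖ) (h : ∃ s, y ^ p = p ^ p * s) : ∃ s, y = p * s := by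
  have key : ∀ i ≤ p, ∃ y', y = spi p ϖ 1 ^ i * y' ∧ ∃ s, y' ^ p = p ^ (p - i) * s := by
    intro i
    induction i with
    | zero => intro _; exact ⟨y, by simp, h⟩
    | succ i ih =>
      intro hi
      obtain ⟨y', h1, s, h2⟩ := ih (by omega)
      have e1 : p - i = (p - (i+1)) + 1 := by omega
      obtain ⟨y'', h3⟩ := SS_root1 p ϖ y' ⟨p ^ (p - (i + 1)) * s, by rw [h2, e1]; ring⟩
      refine ⟨y'', by rw [h1, h3]; ring, s, ?_⟩
      have h4 := spi_pow p ϖ 1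
      rw [pow_one] at h4
      apply SS_tfpow p ϖ hϖ 1
      rw [pow_one, ← mul_assoc, ← pow_succ', ← e1, ← h2, h3, mul_pow, h4]
  obtain ⟨y', h1, -⟩ := key p le_rfl
  have h4 := spi_pow p ϖ 1
  rw [pow_one] at h4
  exact ⟨y', by rw [h1, h4]⟩

theorem SS_rootM (ϖ : P) (hϖ : ∀ z, ϖ * z = 0 → z = 0) (M k : ℕ) (y : SS p ϖ)
    (h : ∃ s, y ^ p ^ k = p ^ (M * p ^ k) * s) : ∃ s, y = p ^ M * s := by
  have hp1 := (Fact.out : p.Prime).one_lt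
  have one : ∀ (M : ℕ) (y : SS p ϖ), (∃ s, y ^ p = p ^ (M * p) * s) → ∃ s, y = p ^ M * s := by
    intro M
    induction M with
    | zero => intro y _; exact ⟨y, by simp⟩
    | succ M ih =>
      rintro y ⟨s, hs⟩
      obtain ⟨y', rfl⟩ := SS_root p ϖ hϖ y ⟨p ^ (M * p) * s, by rw [hs, ← mul_assoc, ← pow_add]; ring⟩
      obtain ⟨s', rfl⟩ := ih y' ⟨s, by
        apply SS_tfpow p ϖ hϖ p
        rw [← mul_pow, hs, ← mul_assoc, ← pow_add]; ring⟩
      exact ⟨s', by ring⟩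
  induction k generalizing M y with
  | zero => simpa using h
  | succ k ih =>
    apply ih
    apply one
    obtain ⟨s, hs⟩ := h
    exact ⟨s, by rw [← pow_mul, ← pow_succ, hs, pow_succ, mul_assoc]⟩

theorem SS_integral (ϖ : P) (hϖ : ∀ z, ϖ * z = 0 → z = 0) (M m : ℕ) (y : SS p ϖ) (μ : ℕ → SS p ϖ)
    (h : y ^ m + ∑ i ∈ Finset.range m, μ i * p ^ (M * (m - i)) * y ^ i = 0) (k : ℕ) :
    ∃ s, spi p ϖ k * y = p ^ M * s := by
  have hp1 := (Fact.out : p.Prime).one_lt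
  have key := integr_pow_aux (p : SS p ϖ) M m y μ h
  apply SS_rootM p ϖ hϖ M (k + M * m)
  obtain ⟨s, hs⟩ := key (p ^ (k + M * m))
  obtain ⟨r, hr⟩ := Nat.exists_eq_add_of_le (Nat.lt_pow_self hp1 : M * m < p ^ (M * m)).le
  refine ⟨p ^ r * s, ?_⟩
  rw [mul_pow, pow_add p k, pow_mul, spi_pow, hr, pow_add]
  rw [← hr, ← pow_add]
  linear_combination (p : SS p ϖ) ^ r * hs
end
end

section
section
open WittVector
variable (p : ℕ) [hpF : Fact p.Prime] {O : Type*} [CommRing O] [hpu : Fact (¬ IsUnit (p : O))]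

noncomputable def cf (k : ℕ) : PreTilt O p →+* O ⧸ Ideal.span {(p : O)} := PreTilt.coeff k

theorem cf_pow (k : ℕ) (e : PreTilt O p) : cf p (k + 1) e ^ p = cf p k e := PreTilt.coeff_pow_p e k

theorem cf_succ_pow (k : ℕ) (e : PreTilt O p) : cf p (k + 1) (e ^ p) = cf p k e := by
  rw [map_pow]; exact cf_pow p k e

theorem cf_add_pow (n k : ℕ) (e : PreTilt O p) : cf p (n + k) (e ^ p ^ k) = cf p n e := by
  induction k with
  | zero => simp
  | succ k ih => rw [pow_succ, pow_mul, ← add_assoc, cf_succ_pow, ih]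

theorem cf_rt (n k : ℕ) (e : PreTilt O p) : cf p n (rt p k e) = cf p (n + k) e := by
  rw [← cf_add_pow p n k, rt_pow]

theorem cf_ext {e e' : PreTilt O p} (h : ∀ k, cf p k e = cf p k e') : e = e' := Perfection.ext h

noncomputable def tlb (s : ℕ → O ⧸ Ideal.span {(p : O)}) (hs : ∀ n, s (n + 1) ^ p = s n) : PreTilt O p := ⟨s, hs⟩

noncomputable def tl (s : ℕ → O) (hs : ∀ n, s (n + 1) ^ p = s n) : PreTilt O p :=
  tlb p (fun n => Ideal.Quotient.mk _ (s n)) (fun n => by rw [← map_pow, hs])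

theorem cf_tl (s : ℕ → O) (hs : ∀ n, s (n + 1) ^ p = s n) (k : ℕ) :
    cf p k (tl p s hs) = Ideal.Quotient.mk _ (s k) := rfl

theorem cf_surj (hF : ∀ o : O, ∃ o' c, o = o' ^ p + p * c) (k : ℕ) :
    Function.Surjective (cf p k (O := O)) := by
  apply Perfection.coeff_surjective
  intro z
  obtain ⟨o, rfl⟩ := Ideal.Quotient.mk_surjective z
  obtain ⟨o', c, rfl⟩ := hF o
  refine ⟨Ideal.Quotient.mk _ o', ?_⟩
  rw [frobenius_def, ← map_pow, Ideal.Quotient.eq]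
  rw [Ideal.mem_span_singleton']
  exact ⟨-c, by ring⟩

variable [IsAdicComplete (Ideal.span {(p : O)}) O]

theorem sub_pow_mem {a b : O} (n : ℕ) (h : a - b ∈ Ideal.span {(p : O)}) :
    a ^ p ^ n - b ^ p ^ n ∈ Ideal.span {(p : O)} ^ (n + 1) := by
  rw [Ideal.span_singleton_pow]
  rw [Ideal.mem_span_singleton] at h ⊢
  exact dvd_sub_pow_of_dvd_sub h n

theorem eq_of_forall_mem {a b : O} (h : ∀ n, a - b ∈ Ideal.span {(p : O)} ^ n) : a = b := by
  rw [IsHausdorff.eq_iff_smodEq (I := Ideal.span {(p : O)})]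
  intro n
  rw [SModEq.sub_mem, smul_eq_mul, Ideal.mul_top]
  exact h n

theorem eq_of_compat {s t : ℕ → O} (hs : ∀ n, s (n + 1) ^ p = s n) (ht : ∀ n, t (n + 1) ^ p = t n)
    (h : ∀ n, s n - t n ∈ Ideal.span {(p : O)}) (k : ℕ) : s k = t k := by
  have hp : ∀ (s : ℕ → O), (∀ n, s (n + 1) ^ p = s n) → ∀ n, s (k + n) ^ p ^ n = s k := by
    intro s hs n
    induction n with
    | zero => simp
    | succ n ih => rw [pow_succ', pow_mul, ← add_assoc, hs, ih]
  apply eq_of_forall_mem p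
  intro n
  rw [← hp s hs n, ← hp t ht n]
  exact Ideal.pow_le_pow_right (Nat.le_succ n) (sub_pow_mem p n (h _))

noncomputable def sh (k : ℕ) (e : PreTilt O p) : O := (rt p k e).untilt

theorem sh_mul (k : ℕ) (e e' : PreTilt O p) : sh p k (e * e') = sh p k e * sh p k e' := by
  rw [sh, map_mul, map_mul]; rfl

theorem sh_pow (k : ℕ) (e : PreTilt O p) : sh p (k + 1) e ^ p = sh p k e := by
  have := rt_add_pow p k 1 e
  rw [pow_one] at this
  rw [sh, ← map_pow, this]; rfl

theorem mk_sh (k : ℕ) (e : PreTilt O p) : Ideal.Quotient.mk _ (sh p k e) = cf p k e := by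
  have := PreTilt.mk_untilt_eq_coeff_zero (rt p k e)
  have h2 := cf_rt p 0 k e
  rw [zero_add] at h2
  rw [← h2]; exact this

theorem sh_zero (k : ℕ) : sh p k (0 : PreTilt O p) = 0 := by
  refine eq_of_compat p (s := fun k => sh p k (0 : PreTilt O p)) (t := fun _ => 0) (fun n => sh_pow p n _) (fun n => ?_) (fun n => ?_) k
  · exact zero_pow (Fact.out : p.Prime).ne_zero
  · rw [← Ideal.Quotient.eq, mk_sh, map_zero, map_zero]

theorem sh_tl (s : ℕ → O) (hs : ∀ n, s (n + 1) ^ p = s n) (k : ℕ) : sh p k (tl p s hs) = s k := by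
  refine eq_of_compat p (s := fun k => sh p k (tl p s hs)) (fun n => sh_pow p n _) hs (fun n => ?_) k
  rw [← Ideal.Quotient.eq, mk_sh, cf_tl]

noncomputable def th : WittVector p (PreTilt O p) →+* O := fontaineTheta O p

theorem rt_zero' {P : Type*} [CommRing P] [CharP P p] [PerfectRing P p] (e : P) : rt p 0 e = e := by
  simpa using rt_pow p 0 e

theorem th_teich (e : PreTilt O p) : th p (teichmuller p e) = sh p 0 e := by
  rw [sh, rt_zero']; exact fontaineTheta_teichmuller e

theorem mk_th (w : WittVector p (PreTilt O p)) : Ideal.Quotient.mk _ (th p w) = cf p 0 (w.coeff 0) :=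
  mk_fontaineTheta w

theorem th_surj (hF : ∀ o : O, ∃ o' c, o = o' ^ p + p * c) : Function.Surjective (th p (O := O)) := by
  apply surjective_fontaineTheta
  intro z
  obtain ⟨o, rfl⟩ := Ideal.Quotient.mk_surjective z
  obtain ⟨o', c, rfl⟩ := hF o
  refine ⟨Ideal.Quotient.mk _ o', ?_⟩
  rw [frobenius_def, ← map_pow, Ideal.Quotient.eq]
  rw [Ideal.mem_span_singleton']
  exact ⟨-c, by ring⟩

section withpi

theorem pi_powpow (π : ℕ → O) (hπ : ∀ n, π (n + 1) ^ p = π n) (n : ℕ) : π n ^ p ^ n = π 0 := by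
  induction n with
  | zero => simp
  | succ n ih => rw [pow_succ', pow_mul, hπ, ih]

theorem pi_nz (tf : ∀ o : O, (p : O) * o = 0 → o = 0) (π : ℕ → O) (hπ0 : π 0 = (p : O)) (hπ : ∀ n, π (n + 1) ^ p = π n) (n : ℕ) (o : O) (h : π n * o = 0) : o = 0 := by
  apply tf
  rw [← hπ0, ← pi_powpow p π hπ n]
  obtain ⟨m, hm⟩ := Nat.exists_eq_succ_of_ne_zero (pow_ne_zero n (Fact.out : p.Prime).ne_zero)
  rw [hm, pow_succ, mul_assoc, h, mul_zero]

theorem tl_nz (tf : ∀ o : O, (p : O) * o = 0 → o = 0) (π : ℕ → O) (hπ0 : π 0 = (p : O)) (hπ : ∀ n, π (n + 1) ^ p = π n) (e : PreTilt O p) (h : tl p π hπ * e = 0) : e = 0 := by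
  apply cf_ext p
  intro k
  rw [map_zero, ← mk_sh]
  have : sh p k e = 0 := by
    apply pi_nz p tf π hπ0 hπ k
    rw [← sh_tl p π hπ k, ← sh_mul, h, sh_zero]
  rw [this, map_zero]

theorem cf_zero_ker (tf : ∀ o : O, (p : O) * o = 0 → o = 0) (π : ℕ → O) (hπ0 : π 0 = (p : O)) (hπ : ∀ n, π (n + 1) ^ p = π n) (rc : ∀ n (o : O), (∃ c, o ^ p ^ n = p * c) → ∃ c, o = π n * c) (e : PreTilt O p) (h : cf p 0 e = 0) :
    ∃ e', e = tl p π hπ * e' := by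
  have h0 : ∃ c, sh p 0 e = p * c := by
    rw [← mk_sh, Ideal.Quotient.eq_zero_iff_mem] at h
    obtain ⟨c, hc⟩ := Ideal.mem_span_singleton'.1 h
    exact ⟨c, by rw [← hc, mul_comm]⟩
  have h1 : ∀ n, sh p n e ^ p ^ n = sh p 0 e := by
    intro n
    induction n with
    | zero => simp
    | succ n ih => rw [pow_succ', pow_mul, sh_pow, ih]
  have h2 : ∀ n, ∃ c, sh p n e = π n * c := fun n => rc n _ (by rw [h1]; exact h0)
  choose c hc using h2
  have hcc : ∀ n, c (n + 1) ^ p = c n := by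
    intro n
    rw [← sub_eq_zero]
    apply pi_nz p tf π hπ0 hπ n
    rw [mul_sub, ← hc, ← hπ, ← mul_pow, ← hc, sh_pow, sub_self]
  refine ⟨tl p c hcc, ?_⟩
  apply cf_ext p
  intro k
  rw [map_mul, cf_tl, cf_tl, ← map_mul, ← hc, mk_sh]

theorem th_pi (π : ℕ → O) (hπ0 : π 0 = (p : O)) (hπ : ∀ n, π (n + 1) ^ p = π n) : th p (teichmuller p (tl p π hπ)) = p := by rw [th_teich, sh_tl, hπ0]

theorem th_ker (tf : ∀ o : O, (p : O) * o = 0 → o = 0) (π : ℕ → O) (hπ0 : π 0 = (p : O)) (hπ : ∀ n, π (n + 1) ^ p = π n) (rc : ∀ n (o : O), (∃ c, o ^ p ^ n = p * c) → ∃ c, o = π n * c)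
    (w : WittVector p (PreTilt O p)) (h : th p w = 0) :
    w ∈ Ideal.span {(p : WittVector p (PreTilt O p)) - teichmuller p (tl p π hπ)} := by
  set ξ := (p : WittVector p (PreTilt O p)) - teichmuller p (tl p π hπ) with hξ
  have hthξ : th p ξ = 0 := by rw [hξ, map_sub, map_natCast, th_pi p π hπ0 hπ, sub_self]
  have step : ∀ w : WittVector p (PreTilt O p), th p w = 0 → ∃ a w', th p w' = 0 ∧ w = ξ * a + (p : WittVector p (PreTilt O p)) * w' := by
    intro w hw
    have h1 : cf p 0 (w.coeff 0) = 0 := by rw [← mk_th, hw, map_zero]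
    obtain ⟨e', he⟩ := cf_zero_ker p tf π hπ0 hπ rc _ h1
    obtain ⟨w', hw'⟩ := witt_div_p p (w := w + ξ * teichmuller p e') (by
      have : ∀ v : WittVector p (PreTilt O p), v.coeff 0 = constantCoeff v := fun _ => rfl
      rw [this, map_add, map_mul, hξ, map_sub, map_natCast, CharP.cast_eq_zero, ← this, ← this, ← this, teichmuller_coeff_zero,
        teichmuller_coeff_zero, he]
      ring)
    refine ⟨- teichmuller p e', w', ?_, by rw [← hw']; ring⟩
    apply tf
    rw [← map_natCast (th p), ← map_mul, ← hw', map_add, map_mul, hw, hthξ]; ring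
  choose! a nx hnx hw using step
  let seq : ℕ → WittVector p (PreTilt O p) := fun n => nx^[n] w
  have hseq : ∀ n, th p (seq n) = 0 := by
    intro n
    induction n with
    | zero => exact h
    | succ n ih =>
      have : seq (n + 1) = nx (seq n) := Function.iterate_succ_apply' _ _ _
      rw [this]; exact hnx _ ih
  have hsum : ∀ n, w = ξ * (∑ i ∈ Finset.range n, (p : WittVector p (PreTilt O p)) ^ i * a (seq i)) + p ^ n * seq n := by
    intro n
    induction n with
    | zero => simp [seq]
    | succ n ih =>
      have e1 : seq (n + 1) = nx (seq n) := Function.iterate_succ_apply' _ _ _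
      rw [Finset.sum_range_succ]
      have e2 := hw (seq n) (hseq n)
      rw [← e1] at e2
      linear_combination ih + (p : WittVector p (PreTilt O p)) ^ n * e2
  have hcomp : IsAdicComplete (Ideal.span {(p : WittVector p (PreTilt O p))}) (WittVector p (PreTilt O p)) := inferInstance
  obtain ⟨L, hL⟩ := hcomp.prec' (fun n => ∑ i ∈ Finset.range n, (p : WittVector p (PreTilt O p)) ^ i * a (seq i)) (by
    intro m n hmn
    rw [SModEq.sub_mem, smul_eq_mul, Ideal.mul_top, Ideal.span_singleton_pow, ← neg_mem_iff, neg_sub]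
    rw [← Finset.sum_range_add_sum_Ico _ hmn, add_sub_cancel_left]
    apply Ideal.sum_mem
    intro i hi
    rw [Finset.mem_Ico] at hi
    rw [Ideal.mem_span_singleton]
    exact (pow_dvd_pow _ hi.1).mul_right _)
  have : w = L * ξ := by
    rw [IsHausdorff.eq_iff_smodEq (I := Ideal.span {(p : WittVector p (PreTilt O p))})]
    intro n
    have h3 := hL n
    rw [SModEq.sub_mem, smul_eq_mul, Ideal.mul_top, Ideal.span_singleton_pow] at h3 ⊢
    rw [Ideal.mem_span_singleton] at h3 ⊢
    obtain ⟨b, hb⟩ := h3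
    have h4 := hsum n
    refine ⟨seq n + ξ * b, ?_⟩
    rw [mul_add, mul_left_comm, ← hb]
    linear_combination h4
  rw [this]
  exact Ideal.mul_mem_left _ _ (Ideal.mem_span_singleton_self _)
end withpi
end
end

section
section
open WittVector

structure PB (p : ℕ) {B : Type*} [CommRing B] (π : ℕ → B) : Prop where
  nu : ¬ IsUnit (p : B)
  tf : ∀ o : B, (p : B) * o = 0 → o = 0
  π0 : π 0 = (p : B)
  πs : ∀ n, π (n + 1) ^ p = π n
  rc : ∀ n (o : B), (∃ c, o ^ p ^ n = p * c) → ∃ c, o = π n * c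
  fr : ∀ o : B, ∃ o' c, o = o' ^ p + p * c

variable (p : ℕ) (B : Type*) [CommRing B]

abbrev Cp : Type _ := AdicCompletion (Ideal.span {(p : B)}) B

noncomputable abbrev cι : B →+* Cp p B := algebraMap B (Cp p B)

theorem Cp_map_span : (Ideal.span {(p : B)}).map (algebraMap B (Cp p B)) = Ideal.span {(p : Cp p B)} := by
  rw [Ideal.map_span, Set.image_singleton, map_natCast]

instance Cp_complete : IsAdicComplete (Ideal.span {(p : Cp p B)}) (Cp p B) := by
  rw [← Cp_map_span]
  exact AdicCompletion.isAdicComplete_self _ ⟨{(p : B)}, by simp⟩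

variable {B}

theorem evalA_factor (I : Ideal B) {m n : ℕ} (h : m ≤ n) (o : AdicCompletion I B) :
    AdicCompletion.evalₐ I m o = Ideal.Quotient.factorPow I h (AdicCompletion.evalₐ I n o) := by
  induction o using AdicCompletion.induction_on with
  | _ f =>
    rw [AdicCompletion.evalₐ_mk, AdicCompletion.evalₐ_mk]
    change _ = Ideal.Quotient.mk (I ^ m) (f.val n)
    have h1 := f.2 h
    rw [SModEq.sub_mem, smul_eq_mul, Ideal.mul_top] at h1
    exact Ideal.Quotient.eq.2 h1

theorem Cp_ex (o : Cp p B) : ∃ b c, o = cι p B b + p * c := by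
  obtain ⟨b, hb⟩ := Ideal.Quotient.mk_surjective (AdicCompletion.evalOneₐ (Ideal.span {(p : B)}) o)
  have h1 : o - cι p B b ∈ RingHom.ker (AdicCompletion.evalOneₐ (Ideal.span {(p : B)})).toRingHom := by
    rw [RingHom.mem_ker]
    change AdicCompletion.evalOneₐ (Ideal.span {(p : B)}) _ = 0
    rw [map_sub, AlgHom.commutes, ← hb]
    exact sub_self _
  rw [AdicCompletion.ker_evalOneₐ_eq_map _ ⟨{(p : B)}, by simp⟩, Cp_map_span] at h1
  obtain ⟨c, hc⟩ := Ideal.mem_span_singleton'.1 h1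
  exact ⟨b, c, by rw [mul_comm, hc]; ring⟩

theorem Cp_div (n : ℕ) (b : B) (o : Cp p B) (h : cι p B b = p ^ n * o) : ∃ c, b = p ^ n * c := by
  have h1 := congrArg (AdicCompletion.evalₐ (Ideal.span {(p : B)}) n) h
  rw [AlgHom.commutes, map_mul, map_pow, map_natCast] at h1
  have h2 : (p : B ⧸ Ideal.span {(p : B)} ^ n) ^ n = 0 := by
    rw [← map_natCast (Ideal.Quotient.mk _), ← map_pow, Ideal.Quotient.eq_zero_iff_mem]
    exact Ideal.pow_mem_pow (Ideal.mem_span_singleton_self _) n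
  rw [h2, zero_mul, Ideal.Quotient.algebraMap_eq, Ideal.Quotient.eq_zero_iff_mem, Ideal.span_singleton_pow] at h1
  obtain ⟨c, hc⟩ := Ideal.mem_span_singleton'.1 h1
  exact ⟨c, by rw [mul_comm, hc]⟩

theorem Cp_div1 (b : B) (o : Cp p B) (h : cι p B b = p * o) : ∃ c, b = p * c := by
  have := Cp_div p 1 b o (by rw [pow_one]; exact h)
  simpa using this

theorem Cp_tf (tf : ∀ o : B, (p : B) * o = 0 → o = 0) (o : Cp p B) (h : (p : Cp p B) * o = 0) : o = 0 := by
  apply AdicCompletion.ext_evalₐ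
  intro n
  obtain ⟨b, hb⟩ := Ideal.Quotient.mk_surjective (AdicCompletion.evalₐ (Ideal.span {(p : B)}) (n + 1) o)
  have h1 := congrArg (AdicCompletion.evalₐ (Ideal.span {(p : B)}) (n + 1)) h
  rw [map_mul, map_natCast, ← hb, map_zero, ← map_natCast (Ideal.Quotient.mk _), ← map_mul, Ideal.Quotient.eq_zero_iff_mem,
    Ideal.span_singleton_pow] at h1
  obtain ⟨c, hc⟩ := Ideal.mem_span_singleton'.1 h1
  have h2 : b = p ^ n * c := by
    rw [← sub_eq_zero]
    apply tf
    rw [mul_sub, ← hc]; ring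
  have h3 : AdicCompletion.evalₐ (Ideal.span {(p : B)}) n o =
      Ideal.Quotient.factorPow (Ideal.span {(p : B)}) (Nat.le_succ n) (AdicCompletion.evalₐ (Ideal.span {(p : B)}) (n + 1) o) := by
    exact evalA_factor _ _ _
  rw [h3, ← hb, map_zero]
  change Ideal.Quotient.mk _ b = 0
  rw [Ideal.Quotient.eq_zero_iff_mem, Ideal.span_singleton_pow, h2]
  exact Ideal.mul_mem_right _ _ (Ideal.mem_span_singleton_self _)

theorem Cp_PB [Fact p.Prime] {π : ℕ → B} (h : PB p π) : PB p (fun n => cι p B (π n)) := by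
  refine ⟨?_, Cp_tf p h.tf, ?_, ?_, ?_, ?_⟩
  · rintro hu
    obtain ⟨v, hv⟩ := hu.exists_right_inv
    obtain ⟨c, hc⟩ := Cp_div1 p 1 v (by rw [map_one, hv])
    exact h.nu (IsUnit.of_mul_eq_one c hc.symm)
  · simp only [h.π0, map_natCast]
  · intro n; simp only [← map_pow, h.πs]
  · rintro n o ⟨c, hc⟩
    obtain ⟨b, e, rfl⟩ := Cp_ex p o
    have h1 : ∃ f, cι p B (b ^ p ^ n) = p * f := by
      have : (p : Cp p B) ∣ cι p B b ^ p ^ n - (cι p B b + p * e) ^ p ^ n := by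
        refine Dvd.dvd.trans ?_ (sub_dvd_pow_sub_pow _ _ _)
        exact ⟨-e, by ring⟩
      obtain ⟨f, hf⟩ := this
      exact ⟨f + c, by rw [map_pow, mul_add, ← hf, ← hc]; ring⟩
    obtain ⟨f, hf⟩ := h1
    obtain ⟨c', hc'⟩ := h.rc n b (Cp_div1 p _ f hf)
    have h2 : (p : Cp p B) = cι p B (π n) * cι p B (π n) ^ (p ^ n - 1) := by
      rw [← pow_succ', Nat.sub_add_cancel (Nat.one_le_pow _ _ (Fact.out : p.Prime).pos), ← map_pow]
      have : ∀ n, π n ^ p ^ n = (p : B) := by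
        intro n
        induction n with
        | zero => simp [h.π0]
        | succ n ih => rw [pow_succ', pow_mul, h.πs, ih]
      rw [this, map_natCast]
    refine ⟨cι p B c' + cι p B (π n) ^ (p ^ n - 1) * e, ?_⟩
    rw [hc', map_mul, mul_add, ← mul_assoc, ← h2]
  · intro o
    obtain ⟨b, e, rfl⟩ := Cp_ex p o
    obtain ⟨o', c, hb⟩ := h.fr b
    refine ⟨cι p B o', cι p B c + e, ?_⟩
    rw [hb, map_add, map_pow, map_mul, map_natCast]; ring

theorem Cp_lift {O : Type*} [CommRing O] [IsAdicComplete (Ideal.span {(p : O)}) O] (φ : B →+* O) :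
    ∃ Φ : Cp p B →+* O, ∀ b, Φ (cι p B b) = φ b := by
  have hle : ∀ n, Ideal.span {(p : B)} ^ n ≤ (Ideal.span {(p : O)} ^ n).comap φ := by
    intro n
    rw [Ideal.span_singleton_pow, Ideal.span_singleton_pow, Ideal.span_singleton_le_iff_mem, Ideal.mem_comap,
      map_pow, map_natCast]
    exact Ideal.mem_span_singleton_self _
  let f : ∀ n, Cp p B →+* O ⧸ Ideal.span {(p : O)} ^ n := fun n =>
    (Ideal.quotientMap (Ideal.span {(p : O)} ^ n) φ (hle n)).comp
      (AdicCompletion.evalₐ (Ideal.span {(p : B)}) n : Cp p B →+* B ⧸ Ideal.span {(p : B)} ^ n)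
  have hf : ∀ {m n : ℕ} (h : m ≤ n), (Ideal.Quotient.factorPow (Ideal.span {(p : O)}) h).comp (f n) = f m := by
    intro m n h
    ext o
    have h3 : AdicCompletion.evalₐ (Ideal.span {(p : B)}) m o =
      Ideal.Quotient.factorPow (Ideal.span {(p : B)}) h (AdicCompletion.evalₐ (Ideal.span {(p : B)}) n o) := by
      exact evalA_factor _ _ _
    obtain ⟨b, hb⟩ := Ideal.Quotient.mk_surjective (AdicCompletion.evalₐ (Ideal.span {(p : B)}) n o)
    simp only [f, RingHom.comp_apply, RingHom.coe_coe]
    rw [h3, ← hb]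
    rfl
  refine ⟨IsAdicComplete.liftRingHom (Ideal.span {(p : O)}) f hf, ?_⟩
  intro b
  rw [IsHausdorff.eq_iff_smodEq (I := Ideal.span {(p : O)})]
  intro n
  rw [SModEq.sub_mem, smul_eq_mul, Ideal.mul_top, ← Ideal.Quotient.eq, IsAdicComplete.mk_liftRingHom]
  simp only [f, RingHom.comp_apply, RingHom.coe_coe, AlgHom.commutes]
  rfl
end

section
open WittVector
variable (p : ℕ) [Fact p.Prime] {O O' : Type*} [CommRing O] [CommRing O'] [Fact (¬ IsUnit (p : O))]
 [Fact (¬ IsUnit (p : O'))] 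

noncomputable def tmap (Φ : O →+* O') : PreTilt O p →+* PreTilt O' p :=
  Perfection.map p (Ideal.quotientMap (Ideal.span {(p : O')}) Φ (by
    rw [Ideal.span_singleton_le_iff_mem, Ideal.mem_comap, map_natCast]
    exact Ideal.mem_span_singleton_self _))

theorem cf_tmap (Φ : O →+* O') (k : ℕ) (e : PreTilt O p) (o : O) (h : cf p k e = Ideal.Quotient.mk _ o) :
    cf p k (tmap p Φ e) = Ideal.Quotient.mk _ (Φ o) := by
  have : cf p k (tmap p Φ e) = (Ideal.quotientMap (Ideal.span {(p : O')}) Φ (by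
    rw [Ideal.span_singleton_le_iff_mem, Ideal.mem_comap, map_natCast]
    exact Ideal.mem_span_singleton_self _)) (cf p k e) := rfl
  rw [this, h]; rfl

variable [IsAdicComplete (Ideal.span {(p : O)}) O]  [IsAdicComplete (Ideal.span {(p : O')}) O']

theorem sh_tmap (Φ : O →+* O') (e : PreTilt O p) (k : ℕ) : sh p k (tmap p Φ e) = Φ (sh p k e) := by
  refine eq_of_compat p (s := fun k => sh p k (tmap p Φ e)) (t := fun k => Φ (sh p k e))
    (fun n => sh_pow p n _) (fun n => by rw [← map_pow, sh_pow]) (fun n => ?_) k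
  rw [← Ideal.Quotient.eq, mk_sh, cf_tmap p Φ n e _ (mk_sh p n e).symm]

theorem th_tmap (Φ : O →+* O') (w : WittVector p (PreTilt O p)) :
    th p (WittVector.map (tmap p Φ) w) = Φ (th p w) := by
  apply eq_of_forall_mem p
  intro n
  rw [← Ideal.Quotient.eq]
  have : ((Ideal.Quotient.mk (Ideal.span {(p : O')} ^ n)).comp ((th p).comp (WittVector.map (tmap p Φ)))) =
     (Ideal.Quotient.mk (Ideal.span {(p : O')} ^ n)).comp (Φ.comp (th p)) := by
    apply eq_of_apply_teichmuller_eq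
    · refine ⟨n, ?_⟩
      rw [← map_natCast (Ideal.Quotient.mk _), ← map_pow, Ideal.Quotient.eq_zero_iff_mem]
      exact Ideal.pow_mem_pow (Ideal.mem_span_singleton_self _) n
    · intro e
      simp only [RingHom.comp_apply]
      rw [map_teichmuller, th_teich, th_teich, sh_tmap]
  exact RingHom.congr_fun this w
end
end

section
section
open Polynomial

theorem lift_lemma {Ω : Type*} [Field Ω] [IsAlgClosed Ω] (A : Subring Ω) (K : Subfield Ω)
    (hAK : ∀ a ∈ A, a ∈ K) (hcl : ∀ z ∈ K, IsIntegral A z → z ∈ A)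
    (F : A[X]) (hF : F.Monic) (hsep : ∀ ρ : Ω, aeval ρ F = 0 → aeval ρ (derivative F) ≠ 0)
    (θ : Ω) (hθ : aeval θ F = 0) {ι : Type*} [Fintype ι] (t : ι → Ω) (a : ι → A)
    (ht : ∀ j, IsIntegral A (t j)) (htK : ∀ j, ∃ u : K[X], aeval θ u = t j)
    (hsum : ∑ j, (a j : Ω) * t j = 0) :
    ∃ c : ι → A[X], (∀ j, aeval θ (c j) = aeval θ (derivative F) * t j) ∧
      F ∣ ∑ j, C (a j) * c j ∧
      ∀ j, ∃ (m : ℕ) (μ : ℕ → A), F ∣ (c j) ^ m + ∑ i ∈ Finset.range m, C (μ i) * (derivative F) ^ (m - i) * (c j) ^ i := by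
  classical
  choose u hu using htK
  let iA : A →+* Ω := algebraMap A Ω
  have iAinj : Function.Injective iA := Subtype.val_injective
  let AK : A →+* K := { toFun := fun a => ⟨a, hAK a a.2⟩, map_one' := rfl, map_mul' := fun _ _ => rfl, map_zero' := rfl, map_add' := fun _ _ => rfl }
  have hAKc : (algebraMap K Ω).comp AK = iA := rfl
  let FK := F.map AK
  let FΩ := F.map iA
  have hFK : FK.Monic := hF.map _
  have hFΩ : FΩ.Monic := hF.map _
  have hFKΩ : FK.map (algebraMap K Ω) = FΩ := by rw [Polynomial.map_map, hAKc]
  have evF : ∀ ρ, FΩ.eval ρ = aeval ρ F := fun ρ => by rw [eval_map]; rfl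
  have evF' : ∀ ρ, (derivative FΩ).eval ρ = aeval ρ (derivative F) := fun ρ => by
    rw [derivative_map, eval_map]; rfl
  set Rt := FΩ.roots.toFinset with hRt
  have memRt : ∀ ρ, ρ ∈ Rt ↔ aeval ρ F = 0 := fun ρ => by
    rw [hRt, Multiset.mem_toFinset, mem_roots hFΩ.ne_zero, IsRoot, evF]
  have hnod : FΩ = Lagrange.nodal Rt (fun ρ => ρ) := by
    have h1 := (IsAlgClosed.splits FΩ).eq_prod_roots_of_monic hFΩ
    have h2 : FΩ.roots.Nodup := by
      apply nodup_roots
      rw [Separable]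
      refine isCoprime_of_irreducible_dvd (fun h => hFΩ.ne_zero h.1) ?_
      intro q hq h1 h2
      obtain ⟨ρ, hρ⟩ := IsAlgClosed.exists_root q (Polynomial.degree_pos_of_irreducible hq).ne'
      have e1 : FΩ.eval ρ = 0 := eval_eq_zero_of_dvd_of_eval_eq_zero h1 hρ
      have e2 : (derivative FΩ).eval ρ = 0 := eval_eq_zero_of_dvd_of_eval_eq_zero h2 hρ
      rw [evF] at e1; rw [evF'] at e2
      exact hsep ρ e1 e2
    rw [Lagrange.nodal_eq, hRt]
    conv_lhs => rw [h1]
    simp only [Finset.prod, Multiset.toFinset_val, h2.dedup]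
  have hdegF : FΩ.degree = Rt.card := by rw [hnod, Lagrange.degree_nodal]
  have dvdF : ∀ q : A[X], (∀ ρ ∈ Rt, aeval ρ q = 0) → F ∣ q := by
    intro q hq
    rw [← map_dvd_map iA iAinj hF]
    change FΩ ∣ _
    rw [hnod, Lagrange.nodal_eq]
    refine Finset.prod_dvd_of_coprime ?_ ?_
    · intro i hi j hj hij
      exact isCoprime_X_sub_C_of_isUnit_sub (sub_ne_zero.2 hij).isUnit
    · intro ρ hρ
      rw [dvd_iff_isRoot, IsRoot, eval_map]
      exact hq ρ hρ
  have hθK : IsIntegral K θ := ⟨FK, hFK, by rw [eval₂_eq_eval_map, hFKΩ, evF, hθ]⟩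
  set h := minpoly K θ with hh
  have hhF : h ∣ FK := minpoly.dvd K θ (by rw [aeval_def, eval₂_eq_eval_map, hFKΩ, evF, hθ])
  obtain ⟨h2, hh2⟩ := hhF
  have sepK : ∀ ρ : Ω, aeval ρ FK = 0 → aeval ρ (derivative FK) ≠ 0 := by
    intro ρ h1
    rw [aeval_def, eval₂_eq_eval_map, hFKΩ, evF] at h1
    rw [aeval_def, eval₂_eq_eval_map, ← derivative_map, hFKΩ, evF']
    exact hsep ρ h1
  have hcop : IsCoprime h h2 := by
    have hFK0 : FK ≠ 0 := hFK.ne_zero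
    refine isCoprime_of_irreducible_dvd (fun h' => hFK0 (by rw [hh2, h'.1, zero_mul])) ?_
    intro q hq h1 h3
    obtain ⟨ρ, hρ⟩ := IsAlgClosed.exists_aeval_eq_zero Ω q (Polynomial.degree_pos_of_irreducible hq).ne'
    obtain ⟨v1, hv1⟩ : q ∣ h := h1
    obtain ⟨v2, hv2⟩ := h3
    refine sepK ρ (by rw [hh2, hv1]; simp [hρ]) ?_
    rw [hh2, hv1, hv2]
    simp [hρ]
  obtain ⟨ea, eb, heab⟩ := hcop
  let e : K[X] := eb * h2
  have e1 : ∀ ρ : Ω, aeval ρ h = 0 → aeval ρ e = 1 := by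
    intro ρ hρ
    have := congrArg (aeval ρ) heab
    simpa [hρ, e] using this
  have e0 : ∀ ρ ∈ Rt, aeval ρ h ≠ 0 → aeval ρ e = 0 := by
    intro ρ hρ h0
    rw [memRt, ← evF, ← hFKΩ, hh2, Polynomial.map_mul, eval_mul, eval_map, eval_map] at hρ
    rcases mul_eq_zero.1 hρ with h' | h'
    · exact absurd h' h0
    · simp only [e, map_mul]
      rw [show aeval ρ h2 = 0 from h', mul_zero]
  let τ : ι → Ω → Ω := fun j ρ => if aeval ρ h = 0 then aeval ρ (u j) else 0
  let cΩ : ι → Polynomial Ω := fun j => ∑ ρ ∈ Rt, C (τ j ρ) * Lagrange.nodal (Rt.erase ρ) (fun ρ => ρ)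
  let cK : ι → K[X] := fun j => (derivative FK * (u j * e)) %ₘ FK
  have evc : ∀ j, ∀ ρ ∈ Rt, (cΩ j).eval ρ = aeval ρ (derivative F) * τ j ρ := by
    intro j ρ hρ
    simp only [cΩ]
    rw [eval_finsetSum, Finset.sum_eq_single ρ, eval_mul, eval_C, ← Lagrange.eval_nodal_derivative_eval_node_eq (v := fun ρ : Ω => ρ) hρ,
      ← hnod, evF', mul_comm]
    · intro σ hσ hne
      rw [eval_mul, Lagrange.eval_nodal_at_node (v := fun ρ : Ω => ρ) (Finset.mem_erase.2 ⟨hne.symm, hρ⟩), mul_zero]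
    · exact fun h => absurd hρ h
  have evcK : ∀ j, ∀ ρ ∈ Rt, ((cK j).map (algebraMap K Ω)).eval ρ = aeval ρ (derivative F) * τ j ρ := by
    intro j ρ hρ
    simp only [cK]
    have hz : aeval ρ FK = 0 := by
      rw [aeval_def, eval₂_eq_eval_map, hFKΩ, evF]; exact (memRt ρ).1 hρ
    have := congrArg (aeval ρ) (modByMonic_add_div (derivative FK * (u j * e)) FK)
    rw [map_add, map_mul, hz, zero_mul, add_zero] at this
    rw [eval_map]
    change aeval ρ _ = _
    rw [this, map_mul, map_mul]
    congr 1
    · rw [aeval_def, eval₂_eq_eval_map, ← derivative_map, hFKΩ, evF']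
    · simp only [τ]
      split_ifs with h'
      · rw [e1 ρ h', mul_one]
      · rw [e0 ρ hρ h', mul_zero]
  have cKΩ : ∀ j, cΩ j = (cK j).map (algebraMap K Ω) := by
    intro j
    refine eq_of_degrees_lt_of_eval_finset_eq Rt ?_ ?_ ?_
    · rw [degree_lt_iff_coeff_zero]
      intro m hm
      simp only [cΩ]
      rw [finsetSum_coeff]
      refine Finset.sum_eq_zero fun ρ hρ => ?_
      rw [coeff_C_mul, coeff_eq_zero_of_natDegree_lt, mul_zero]
      rw [Lagrange.natDegree_nodal]
      exact lt_of_lt_of_le (Finset.card_erase_lt_of_mem hρ) (by exact_mod_cast hm)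
    · rw [degree_map, ← hdegF, ← hFKΩ, degree_map]
      exact degree_modByMonic_lt _ hFK
    · intro ρ hρ
      rw [evc j ρ hρ, evcK j ρ hρ]
  have heq : ∀ j, ∃ g : A[X], g.Monic ∧ g.coeff 0 = 0 ∧ ∀ ρ ∈ Rt, aeval (τ j ρ) g = 0 := by
    intro j
    obtain ⟨g, hg, hg0⟩ := ht j
    refine ⟨X * g, monic_X.mul hg, by simp, ?_⟩
    intro ρ hρ
    simp only [τ]
    split_ifs with h'
    · have hz : aeval θ ((g.map AK).comp (u j)) = 0 := by
        rw [aeval_comp, hu, aeval_def, eval₂_map, hAKc]; exact hg0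
      have := aeval_eq_zero_of_dvd_aeval_eq_zero (minpoly.dvd K θ hz) h'
      rw [aeval_comp, aeval_def, eval₂_map, hAKc] at this
      rw [map_mul, show aeval (aeval ρ (u j)) g = 0 from this, mul_zero]
    · simp
  have hroot : ∀ ρ ∈ Rt, IsIntegral A ρ := fun ρ hρ => ⟨F, hF, (memRt ρ).1 hρ⟩
  have hτ : ∀ j, ∀ ρ ∈ Rt, IsIntegral A (τ j ρ) := by
    intro j ρ hρ
    obtain ⟨g, hg, _, h0⟩ := heq j
    exact ⟨g, hg, h0 ρ hρ⟩
  have hlift : ∀ j, ∃ q : A[X], q.map iA = cΩ j := by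
    intro j
    rw [← mem_lifts, lifts_iff_coeff_lifts]
    intro n
    have hint : cΩ j ∈ lifts (algebraMap (integralClosure A Ω) Ω) := by
      refine Subsemiring.sum_mem _ fun ρ hρ => Subsemiring.mul_mem _ ?_ ?_
      · exact C'_mem_lifts ⟨⟨_, hτ j ρ hρ⟩, rfl⟩
      · rw [Lagrange.nodal_eq]
        refine Subsemiring.prod_mem _ fun σ hσ => ?_
        rw [sub_eq_add_neg, ← C_neg]
        exact Subsemiring.add_mem _ (X_mem_lifts _) (C'_mem_lifts ⟨⟨_, (hroot σ (Finset.mem_of_mem_erase hσ)).neg⟩, rfl⟩)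
    rw [lifts_iff_coeff_lifts] at hint
    obtain ⟨y, hy⟩ := hint n
    have hK : (cΩ j).coeff n ∈ K := by rw [cKΩ, coeff_map]; exact ((cK j).coeff n).2
    exact ⟨⟨_, hcl _ hK (hy ▸ y.2)⟩, rfl⟩
  choose c hc using hlift
  have evcA : ∀ j, ∀ ρ ∈ Rt, aeval ρ (c j) = aeval ρ (derivative F) * τ j ρ := by
    intro j ρ hρ
    rw [← evc j ρ hρ, ← hc, eval_map]; rfl
  have hθR : θ ∈ Rt := (memRt θ).2 hθ
  refine ⟨c, ?_, ?_, ?_⟩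
  · intro j
    rw [evcA j θ hθR]
    simp only [τ]
    rw [if_pos (minpoly.aeval K θ), hu]
  · apply dvdF
    intro ρ hρ
    rw [map_sum]
    have : ∀ j, aeval ρ (C (a j) * c j) = aeval ρ (derivative F) * ((a j : Ω) * τ j ρ) := by
      intro j
      rw [map_mul, evcA j ρ hρ, aeval_C]
      change (a j : Ω) * _ = _
      ring
    simp only [this]
    rw [← Finset.mul_sum]
    have : ∑ j, (a j : Ω) * τ j ρ = 0 := by
      simp only [τ]
      split_ifs with h'
      · have hz : aeval θ (∑ j, C (AK (a j)) * u j) = 0 := by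
          rw [map_sum, ← hsum]
          refine Finset.sum_congr rfl fun j _ => ?_
          rw [map_mul, aeval_C, hu]; rfl
        have := aeval_eq_zero_of_dvd_aeval_eq_zero (minpoly.dvd K θ hz) h'
        rw [map_sum] at this
        rw [← this]
        refine Finset.sum_congr rfl fun j _ => ?_
        rw [map_mul, aeval_C]; rfl
      · simp
    rw [this, mul_zero]
  · intro j
    obtain ⟨g, hg, _, h0⟩ := heq j
    refine ⟨g.natDegree, g.coeff, ?_⟩
    apply dvdF
    intro ρ hρ
    have h1 := h0 ρ hρ
    rw [hg.as_sum, map_add, map_pow, aeval_X, map_sum] at h1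
    rw [map_add, map_pow, map_sum, evcA j ρ hρ, ← mul_zero ((aeval ρ (derivative F)) ^ g.natDegree), ← h1, mul_add, mul_pow, Finset.mul_sum]
    congr 1
    refine Finset.sum_congr rfl fun i hi => ?_
    have hi' : i ≤ g.natDegree := (Finset.mem_range.1 hi).le
    simp only [map_mul, map_pow, evcA j ρ hρ, aeval_C, aeval_X]
    conv_rhs => rw [← Nat.sub_add_cancel hi', pow_add]
    ring
end
end

section
section
theorem WR_surj {E C : Type*} [CommRing E] [CommRing C] (g : E →+* C) (hg : Function.Surjective g) (l : List E) (I : Ideal E)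
    (hI : RingHom.ker g ≤ I) : WR I l ↔ WR (I.map g) (l.map g) := by
  induction l generalizing I with
  | nil => simp [WR]
  | cons a l ih =>
    have hc : ∀ z, g z ∈ I.map g ↔ z ∈ I := by
      intro z
      rw [← Ideal.mem_comap, Ideal.comap_map_of_surjective' g hg, sup_eq_left.2 hI]
    simp only [List.map_cons, WR]
    rw [ih (I ⊔ Ideal.span {a}) (hI.trans le_sup_left), Ideal.map_sup, Ideal.map_span, Set.image_singleton]
    refine and_congr_left fun _ => ⟨fun h z hz => ?_, fun h z hz => ?_⟩
    · obtain ⟨z, rfl⟩ := hg z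
      rw [← map_mul, hc] at hz
      rw [hc]; exact h z hz
    · rw [← hc]
      refine h _ ?_
      rw [← map_mul, hc]; exact hz

variable (p : ℕ) [Fact p.Prime] {B : Type*} [CommRing B]

theorem PB.fact {π : ℕ → B} (h : PB p π) : Fact (¬ IsUnit (p : Cp p B)) := ⟨(Cp_PB p h).nu⟩

noncomputable def br : B →+* Cp p B ⧸ Ideal.span {(p : Cp p B)} := (Ideal.Quotient.mk _).comp (cι p B)

theorem br_surj : Function.Surjective (br p (B := B)) := by
  intro z
  obtain ⟨o, rfl⟩ := Ideal.Quotient.mk_surjective z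
  obtain ⟨b, c, rfl⟩ := Cp_ex p o
  refine ⟨b, ?_⟩
  rw [br, RingHom.comp_apply, Ideal.Quotient.eq]
  exact Ideal.mem_span_singleton'.2 ⟨-c, by ring⟩

theorem br_eq_zero (b : B) : br p b = 0 ↔ ∃ c, b = p * c := by
  rw [br, RingHom.comp_apply, Ideal.Quotient.eq_zero_iff_mem]
  constructor
  · intro h
    obtain ⟨c, hc⟩ := Ideal.mem_span_singleton'.1 h
    exact Cp_div1 p b c (by rw [← hc, mul_comm])
  · rintro ⟨c, rfl⟩
    rw [map_mul, map_natCast]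
    exact Ideal.mul_mem_right _ _ (Ideal.mem_span_singleton_self _)

theorem br_eq (b c : B) : br p b = br p c ↔ ∃ e, b = c + p * e := by
  rw [← sub_eq_zero, ← map_sub, br_eq_zero]
  constructor
  · rintro ⟨e, he⟩; exact ⟨e, by rw [← he]; ring⟩
  · rintro ⟨e, he⟩; exact ⟨e, by rw [he]; ring⟩

theorem br_p : br p (p : B) = 0 := (br_eq_zero p _).2 ⟨1, by ring⟩

noncomputable def tb [Fact (¬ IsUnit (p : Cp p B))] (s : ℕ → B) (hs : ∀ n, s (n + 1) ^ p = s n) : PreTilt (Cp p B) p :=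
  tl p (fun n => cι p B (s n)) (fun n => by rw [← map_pow, hs])

theorem cf_tb [Fact (¬ IsUnit (p : Cp p B))] (s : ℕ → B) (hs : ∀ n, s (n + 1) ^ p = s n) (k : ℕ) :
    cf p k (tb p s hs) = br p (s k) := rfl

theorem th_tb [Fact (¬ IsUnit (p : Cp p B))] (s : ℕ → B) (hs : ∀ n, s (n + 1) ^ p = s n) :
    th p (WittVector.teichmuller p (tb p s hs)) = cι p B (s 0) := by
  rw [th_teich, tb, sh_tl]

theorem tb_nz {π : ℕ → B} (h : PB p π) [Fact (¬ IsUnit (p : Cp p B))] (e : PreTilt (Cp p B) p)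
    (he : tb p π h.πs * e = 0) : e = 0 := by
  have h' := Cp_PB p h
  exact tl_nz p h'.tf _ h'.π0 _ e he

theorem tb_ker {π : ℕ → B} (h : PB p π) [Fact (¬ IsUnit (p : Cp p B))] (e : PreTilt (Cp p B) p)
    (he : cf p 0 e = 0) : ∃ e', e = tb p π h.πs * e' := by
  have h' := Cp_PB p h
  exact cf_zero_ker p h'.tf _ h'.π0 _ h'.rc e he

theorem th_ker' {π : ℕ → B} (h : PB p π) [Fact (¬ IsUnit (p : Cp p B))] (w : WittVector p (PreTilt (Cp p B) p))
    (hw : th p w = 0) : ∃ v, w = v * ((p : WittVector p (PreTilt (Cp p B) p)) - WittVector.teichmuller p (tb p π h.πs)) := by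
  have h' := Cp_PB p h
  obtain ⟨v, hv⟩ := Ideal.mem_span_singleton'.1 (th_ker p h'.tf _ h'.π0 h'.πs h'.rc w hw)
  exact ⟨v, hv.symm⟩

theorem tilt_WR {π : ℕ → B} (h : PB p π) [Fact (¬ IsUnit (p : Cp p B))]
    (xs : List (PreTilt (Cp p B) p)) (ys : List B) (hxy : xs.map (cf p 0) = ys.map (br p))
    (hWR : WR ⊥ ((p : B) :: ys)) : WR ⊥ (tb p π h.πs :: xs) := by
  refine ⟨fun z hz => ?_, ?_⟩
  · rw [Ideal.mem_bot] at hz ⊢; exact tb_nz p h z hz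
  · have h1 := hWR.2
    rw [bot_sup_eq] at h1 ⊢
    have hs := cf_surj p (O := Cp p B) (Cp_PB p h).fr 0
    rw [WR_surj (cf p 0) hs]
    · rw [WR_surj (br p) (br_surj p)] at h1
      · rw [hxy]
        rw [Ideal.map_span, Set.image_singleton] at h1 ⊢
        rw [br_p] at h1
        rw [cf_tb, h.π0, br_p]; exact h1
      · intro z hz
        obtain ⟨c, rfl⟩ := (br_eq_zero p z).1 hz
        exact Ideal.mul_mem_right _ _ (Ideal.mem_span_singleton_self _)
    · intro z hz
      obtain ⟨c, rfl⟩ := tb_ker p h z hz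
      exact Ideal.mul_mem_right _ _ (Ideal.mem_span_singleton_self _)

noncomputable def GG [Fact (¬ IsUnit (p : Cp p B))] (T : Subring B) : Subring (PreTilt (Cp p B) p) where
  carrier := {b | ∀ k, ∃ t ∈ T, cf p k b = br p t}
  mul_mem' := by
    intro a b ha hb k
    obtain ⟨s, hs, h1⟩ := ha k
    obtain ⟨t, ht, h2⟩ := hb k
    exact ⟨s * t, T.mul_mem hs ht, by rw [map_mul, map_mul, h1, h2]⟩
  one_mem' := fun k => ⟨1, T.one_mem, by rw [map_one, map_one]⟩
  add_mem' := by
    intro a b ha hb k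
    obtain ⟨s, hs, h1⟩ := ha k
    obtain ⟨t, ht, h2⟩ := hb k
    exact ⟨s + t, T.add_mem hs ht, by rw [map_add, map_add, h1, h2]⟩
  zero_mem' := fun k => ⟨0, T.zero_mem, by rw [map_zero, map_zero]⟩
  neg_mem' := by
    intro a ha k
    obtain ⟨s, hs, h1⟩ := ha k
    exact ⟨-s, T.neg_mem hs, by rw [map_neg, map_neg, h1]⟩

theorem GG_root [Fact (¬ IsUnit (p : Cp p B))] (T : Subring B) (z : PreTilt (Cp p B) p) (h : z ^ p ∈ GG p T) : z ∈ GG p T := by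
  intro k
  obtain ⟨t, ht, h1⟩ := h (k + 1)
  exact ⟨t, ht, by rw [← h1, cf_succ_pow]⟩

theorem GG_div {π : ℕ → B} (h : PB p π) [Fact (¬ IsUnit (p : Cp p B))] (T : Subring B)
    (hT : ∀ k z, π k * z ∈ T → z ∈ T) (b : PreTilt (Cp p B) p)
    (hb : tb p π h.πs * b ∈ GG p T) : b ∈ GG p T := by
  intro k
  obtain ⟨t, ht, h1⟩ := hb (k + 1)
  obtain ⟨z, hz⟩ := br_surj p (cf p (k + 1) b)
  rw [map_mul, cf_tb, ← hz, ← map_mul, br_eq] at h1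
  obtain ⟨w, hw⟩ := h1
  have hpow : ∀ n, π n ^ p ^ n = (p : B) := by
    intro n
    induction n with
    | zero => simp [h.π0]
    | succ n ih => rw [pow_succ', pow_mul, h.πs, ih]
  have hp1 := (Fact.out : p.Prime).one_lt
  obtain ⟨q, hq⟩ : ∃ q, p ^ (k + 1) = q + 1 + 1 := by
    have : 2 ≤ p ^ (k + 1) := le_trans hp1 (Nat.le_self_pow (by omega) p)
    exact ⟨p ^ (k + 1) - 2, by omega⟩
  have hz' : z - π (k + 1) ^ (q + 1) * w ∈ T := by
    apply hT (k + 1)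
    have : π (k + 1) * (z - π (k + 1) ^ (q + 1) * w) = t := by
      rw [mul_sub, hw, ← mul_assoc, ← pow_succ', ← hq, hpow]; ring
    rw [this]; exact ht
  refine ⟨_, T.pow_mem hz' p, ?_⟩
  rw [← cf_pow, ← hz, map_pow, map_sub]
  have : (br p) (π (k + 1) ^ (q + 1) * w) ^ p = 0 := by
    rw [← map_pow, br_eq_zero]
    obtain ⟨p', hp'⟩ : ∃ p', p = p' + 2 := ⟨p - 2, by omega⟩
    have : (q + 1) * p = p ^ (k + 1) + ((q + 1) * p - p ^ (k + 1)) := by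
      have : p ^ (k + 1) ≤ (q + 1) * p := by rw [hq]; nlinarith
      omega
    refine ⟨π (k + 1) ^ ((q + 1) * p - p ^ (k + 1)) * w ^ p, ?_⟩
    rw [mul_pow, ← pow_mul, this, pow_add, hpow, mul_assoc]
    congr 3
    omega
  have hch : CharP (Cp p B ⧸ Ideal.span {(p : Cp p B)}) p := by
    have : Nontrivial (Cp p B ⧸ Ideal.span {(p : Cp p B)}) := by
      apply Ideal.Quotient.nontrivial_iff.2
      rw [Ne, Ideal.span_singleton_eq_top]
      exact Fact.out
    rw [CharP.charP_iff_prime_eq_zero Fact.out]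
    rw [← map_natCast (Ideal.Quotient.mk _), Ideal.Quotient.eq_zero_iff_mem]
    exact Ideal.mem_span_singleton_self _
  rw [sub_pow_char, this, sub_zero]
end
end

section
section
open Polynomial WittVector

theorem Dlem (p m : ℕ) (hp : 0 < p) {A S : Type*} [CommRing A] [CommRing S] (f s r : A[X]) (e : ℕ)
    (hsep : derivative f * s + f * r = X ^ e) (g : A →+* S) (z u : S) (M0 : ℕ)
    (hz : f.eval₂ g (z ^ p ^ m) = 0) (hu : z ^ p ^ m * u = p ^ M0) :
    ∃ D' M, (derivative (expand A (p ^ m) f)).eval₂ g z * D' = (p : S) ^ M := by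
  have h1 : (derivative f).eval₂ g (z ^ p ^ m) * s.eval₂ g (z ^ p ^ m) = (z ^ p ^ m) ^ e := by
    have := congrArg (eval₂ g (z ^ p ^ m)) hsep
    rw [eval₂_add, eval₂_mul, eval₂_mul, hz, zero_mul, add_zero, eval₂_X_pow] at this
    exact this
  have hq : 0 < p ^ m := pow_pos hp m
  have h2 : (derivative (expand A (p ^ m) f)).eval₂ g z = (derivative f).eval₂ g (z ^ p ^ m) * (p ^ m * z ^ (p ^ m - 1)) := by
    rw [derivative_expand, eval₂_mul, expand_eq_comp_X_pow, eval₂_comp, eval₂_X_pow, eval₂_mul, eval₂_X_pow]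
    congr 2
    rw [Nat.cast_pow, eval₂_pow, eval₂_natCast]
  refine ⟨s.eval₂ g (z ^ p ^ m) * z * u ^ (e + 1), m + M0 * (e + 1), ?_⟩
  rw [h2]
  calc _ = ((derivative f).eval₂ g (z ^ p ^ m) * s.eval₂ g (z ^ p ^ m)) * p ^ m * (z ^ (p ^ m - 1) * z) * u ^ (e + 1) := by ring
    _ = p ^ m * (z ^ p ^ m * u) ^ (e + 1) := by
      rw [h1, ← pow_succ, Nat.sub_add_cancel hq]; ring
    _ = _ := by rw [hu]; ring

def IntD {A : Type*} [CommRing A] (F c : A[X]) : Prop :=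
  ∃ (m : ℕ) (μ : ℕ → A), F ∣ c ^ m + ∑ i ∈ Finset.range m, C (μ i) * (derivative F) ^ (m - i) * c ^ i

theorem SS_div (p : ℕ) [Fact p.Prime] {P : Type*} [CommRing P] [CharP P p] [PerfectRing P p] (ϖ : P)
    (hϖ : ∀ z, ϖ * z = 0 → z = 0) {A : Type*} [CommRing A] (g : A →+* SS p ϖ) (F c : A[X]) (hc : IntD F c)
    (Z : SS p ϖ) (hZ : F.eval₂ g Z = 0) (D' : SS p ϖ) (M : ℕ) (hD : (derivative F).eval₂ g Z * D' = p ^ M) (N : ℕ) :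
    ∃ s, spi p ϖ N * c.eval₂ g Z = (derivative F).eval₂ g Z * s := by
  obtain ⟨m, μ, v, hv⟩ := hc
  have h1 := congrArg (eval₂ g Z) hv
  rw [eval₂_mul, hZ, zero_mul, eval₂_add, eval₂_pow, eval₂_finsetSum] at h1
  simp only [eval₂_mul, eval₂_pow, eval₂_C] at h1
  set D := (derivative F).eval₂ g Z
  set cc := c.eval₂ g Z
  obtain ⟨s, hs⟩ := SS_integral p ϖ hϖ M m (cc * D') (fun i => g (μ i)) (by
    have : D' ^ m * (cc ^ m + ∑ i ∈ Finset.range m, g (μ i) * D ^ (m - i) * cc ^ i) = 0 := by rw [h1, mul_zero]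
    rw [← this, mul_add, Finset.mul_sum, mul_pow, mul_comm (cc ^ m)]
    congr 1
    refine Finset.sum_congr rfl fun i hi => ?_
    rw [pow_mul, ← hD]
    have hi' : m = m - i + i := (Nat.sub_add_cancel (Finset.mem_range.1 hi).le).symm
    conv_rhs => rw [hi', pow_add, Nat.add_sub_cancel]
    ring) N
  refine ⟨s, SS_tfpow p ϖ hϖ M ?_⟩
  rw [← hD]
  calc _ = D * (spi p ϖ N * (cc * D')) := by ring
    _ = _ := by rw [hs, ← hD]; ring

theorem lift_theta (p : ℕ) [Fact p.Prime] {A : Type*} [CommRing A] {π : ℕ → A} (hA : PB p π)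
    [Fact (¬ IsUnit (p : Cp p A))] {Q : Type*} [CommRing Q] (i : PreTilt (Cp p A) p →+* Q) :
    ∃ ρ : Cp p A →+* SS p (i (tb p π hA.πs)), ∀ v, ρ (th p v) = smk p _ (WittVector.map i v) := by
  have hs := th_surj p (O := Cp p A) (Cp_PB p hA).fr
  refine ⟨RingHom.liftOfSurjective (th p) hs ⟨(smk p _).comp (WittVector.map i), ?_⟩, ?_⟩
  · intro v hv
    obtain ⟨y, rfl⟩ := th_ker' p hA v hv
    rw [RingHom.mem_ker, RingHom.comp_apply, map_mul, map_sub, map_natCast, map_teichmuller, map_mul, map_sub, smk_teich, map_natCast,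
      sub_self, mul_zero]
  · intro v
    exact RingHom.liftOfRightInverse_comp_apply _ _ _ _ v
end
end

section
section
open Polynomial WittVector

theorem rel_abs {S : Type*} [CommRing S] {r : ℕ} (D D' π a P cc cc0 s s0 : S) (y cj sj : Fin r → S)
    (hs : π * cc = D * s) (hs0 : π * cc0 = D * s0) (hsj : ∀ j, π * cj j = D * sj j)
    (h1 : a * cc - P * cc0 - ∑ j, y j * cj j = 0) : D * D' * (a * s) = D * D' * (P * s0 + ∑ j, y j * sj j) := by
  have h2 : π * ∑ j, y j * cj j = D * ∑ j, y j * sj j := by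
    rw [Finset.mul_sum, Finset.mul_sum]
    exact Finset.sum_congr rfl fun j _ => by linear_combination y j * hsj j
  linear_combination D' * (-a * hs + P * hs0 + h2 + π * h1)

theorem rel_SS (p : ℕ) [Fact p.Prime] {P : Type*} [CommRing P] [CharP P p] [PerfectRing P p] (ϖ : P)
    (hϖ : ∀ z, ϖ * z = 0 → z = 0) {A : Type*} [CommRing A] (g : A →+* SS p ϖ) (F c c0 : A[X]) (hc : IntD F c)
    (hc0 : IntD F c0) {r : ℕ} (cj : Fin r → A[X]) (hcj : ∀ j, IntD F (cj j)) (a : A) (y : Fin r → A)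
    (hF : F ∣ C a * c - C (p : A) * c0 - ∑ j, C (y j) * cj j)
    (Z : SS p ϖ) (hZ : F.eval₂ g Z = 0) (D' : SS p ϖ) (M : ℕ) (hD : (derivative F).eval₂ g Z * D' = p ^ M) (N : ℕ) :
    ∃ (s s0 : SS p ϖ) (sj : Fin r → SS p ϖ), spi p ϖ N * c.eval₂ g Z = (derivative F).eval₂ g Z * s ∧
      g a * s = p * s0 + ∑ j, g (y j) * sj j := by
  obtain ⟨s, hs⟩ := SS_div p ϖ hϖ g F c hc Z hZ D' M hD N
  obtain ⟨s0, hs0⟩ := SS_div p ϖ hϖ g F c0 hc0 Z hZ D' M hD N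
  choose sj hsj using fun j => SS_div p ϖ hϖ g F (cj j) (hcj j) Z hZ D' M hD N
  refine ⟨s, s0, sj, hs, ?_⟩
  obtain ⟨v, hv⟩ := hF
  have h1 := congrArg (eval₂ g Z) hv
  rw [eval₂_mul, hZ, zero_mul, eval₂_sub, eval₂_sub, eval₂_finsetSum] at h1
  simp only [eval₂_mul, eval₂_C, map_natCast, eval₂_natCast] at h1
  apply SS_tfpow p ϖ hϖ M
  rw [← hD]
  exact rel_abs _ _ _ _ _ _ _ _ _ _ _  _ hs hs0 hsj h1

theorem V_part (p : ℕ) [Fact p.Prime] {A : Type*} [CommRing A] {π : ℕ → A} (hA : PB p π)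
    [Fact (¬ IsUnit (p : Cp p A))] {Q : Type*} [CommRing Q] [CharP Q p] [PerfectRing Q p] (i : PreTilt (Cp p A) p →+* Q) (X : Q)
    (ρ : Cp p A →+* SS p (i (tb p π hA.πs))) (hρ : ∀ v, ρ (th p v) = smk p _ (WittVector.map i v))
    {V : Type*} [CommRing V] (χ : A →+* V) (hV : PB p (fun n => χ (π n)))
    [Fact (¬ IsUnit (p : Cp p V))] (τ : ℕ → V) (hτ : ∀ n, τ (n + 1) ^ p = τ n)
    (ΦV : Cp p A →+* Cp p V) (hΦ : ∀ a, ΦV (cι p A a) = cι p V (χ a))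
    (g : Q →+* PreTilt (Cp p V) p) (hg : g.comp i = tmap p ΦV) (hX : g X = tb p τ hτ) :
    ∃ σ : SS p (i (tb p π hA.πs)) →+* Cp p V, (∀ a, σ (ρ (cι p A a)) = cι p V (χ a)) ∧
      (∀ m, σ (smk p _ (teichmuller p (rt p m X))) = cι p V (τ m)) ∧ (∀ N, σ (spi p _ N) = cι p V (χ (π N))) ∧
      ∀ w, σ (smk p _ w) = th p (WittVector.map g w) := by
  have hgi : ∀ e, g (i e) = tmap p ΦV e := fun e => by rw [← hg]; rfl
  have hw : g (i (tb p π hA.πs)) = tb p (fun n => χ (π n)) hV.πs := by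
    rw [hgi]
    apply cf_ext p
    intro k
    rw [cf_tb, cf_tmap p ΦV k _ (cι p A (π k)) (cf_tb p π hA.πs k), hΦ]
    rfl
  have hrt : ∀ (s : ℕ → V) (hs : ∀ n, s (n + 1) ^ p = s n) m, th p (teichmuller p (rt p m (tb p s hs))) = cι p V (s m) := by
    intro s hs m
    rw [th_teich, sh, rt_zero']
    exact sh_tl p _ _ m
  let σ : SS p (i (tb p π hA.πs)) →+* Cp p V := Ideal.Quotient.lift _ ((th p).comp (WittVector.map g)) (by
    intro a ha
    obtain ⟨c, rfl⟩ := Ideal.mem_span_singleton'.1 ha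
    rw [RingHom.comp_apply, map_mul, map_sub, map_natCast, map_teichmuller, hw, map_mul, map_sub, map_natCast, th_tb,
      hV.π0, map_natCast, sub_self, mul_zero])
  have hσ : ∀ w, σ (smk p _ w) = th p (WittVector.map g w) := fun w => rfl
  refine ⟨σ, ?_, ?_, ?_, hσ⟩
  · intro a
    obtain ⟨v, hv⟩ := th_surj p (O := Cp p A) (Cp_PB p hA).fr (cι p A a)
    rw [← hv, hρ, hσ, ← RingHom.comp_apply (WittVector.map g), WittVector.map_comp', hg, th_tmap, hv, hΦ]
  · intro m
    rw [hσ, map_teichmuller, map_rt p g, hX, hrt]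
  · intro N
    rw [spi, hσ, map_teichmuller, map_rt p g, hw, hrt]
end
end

section
section
open Polynomial WittVector

theorem tmap_tb (p : ℕ) [Fact p.Prime] {A B : Type*} [CommRing A] [CommRing B] (φ : A →+* B)
    [Fact (¬ IsUnit (p : Cp p A))] [Fact (¬ IsUnit (p : Cp p B))]
    (Φ : Cp p A →+* Cp p B) (hΦ : ∀ a, Φ (cι p A a) = cι p B (φ a)) (s : ℕ → A) (hs : ∀ n, s (n + 1) ^ p = s n)
    (t : ℕ → B) (ht : ∀ n, t (n + 1) ^ p = t n) (hst : ∀ n, φ (s n) = t n) :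
    tmap p Φ (tb p s hs) = tb p t ht := by
  apply cf_ext p
  intro k
  rw [cf_tb, cf_tmap p Φ k _ (cι p A (s k)) (cf_tb p s hs k), hΦ, hst]
  rfl

theorem stage1.{u} (p : ℕ) [Fact p.Prime] {A B : Type u} [CommRing A] [CommRing B] (φ₀ : A →+* B) {π : ℕ → A}
    (hA : PB p π) (hB : PB p (fun n => φ₀ (π n)))
    [Fact (¬ IsUnit (p : Cp p A))] [Fact (¬ IsUnit (p : Cp p B))]
    (Φ : Cp p A →+* Cp p B) (hΦ : ∀ a, Φ (cι p A a) = cι p B (φ₀ a))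
    (θ : ℕ → B) (hθ : ∀ n, θ (n + 1) ^ p = θ n)
    (f : A[X]) (hf : f.Monic) (hf0 : 0 < f.natDegree) (hfθ : f.eval₂ φ₀ (θ 0) = 0)
    (T : Subring B) (hT1 : ∀ a, φ₀ a ∈ T) (hT2 : ∀ n, θ n ∈ T) (hT3 : ∀ k z, φ₀ (π k) * z ∈ T → z ∈ T)
    (xs : List (PreTilt (Cp p A) p)) (hxs : WR ⊥ (tb p π hA.πs :: xs)) :
    ∃ (P : Type u) (_ : CommRing P) (_ : CharP P p) (_ : PerfectRing P p) (ι : PreTilt (Cp p A) p →+* P) (X : P)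
      (H : WittVector p P) (f' : Polynomial (WittVector p (PreTilt (Cp p A) p))),
      f'.map (th p) = f.map (cι p A) ∧ WEq p f' (tb p π hA.πs) ι X H ∧ WR ⊥ ((tb p π hA.πs :: xs).map ι) ∧
      ∃ ψ : P →+* PreTilt (Cp p B) p, ψ.comp ι = tmap p Φ ∧ ψ X = tb p θ hθ ∧ ∀ z, ψ z ∈ GG p T := by
  have hsurj := th_surj p (O := Cp p A) (Cp_PB p hA).fr
  obtain ⟨f', hf', hdeg, hmon⟩ := lifts_and_natDegree_eq_and_monic (f := th p (O := Cp p A)) (p := f.map (cι p A))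
    ((lifts_iff_coeff_lifts _).2 (fun n => hsurj _)) (hf.map _)
  have hnt : Nontrivial (Cp p A) := by
    by_contra hc
    rw [not_nontrivial_iff_subsingleton] at hc
    exact (Fact.out : ¬ IsUnit (p : Cp p A)) (isUnit_of_subsingleton _)
  have hw : tmap p Φ (tb p π hA.πs) = tb p (fun n => φ₀ (π n)) hB.πs := tmap_tb p φ₀ Φ hΦ _ _ _ _ (fun _ => rfl)
  have hker : th p (f'.eval₂ (WittVector.map (tmap p Φ)) (teichmuller p (tb p θ hθ))) = 0 := by
    rw [hom_eval₂]
    have : (th p).comp (WittVector.map (tmap p Φ)) = Φ.comp (th p) := by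
      apply RingHom.ext; intro w; exact th_tmap p Φ w
    rw [this, ← eval₂_map, hf', eval₂_map, th_tb]
    have h2 : Φ.comp (cι p A) = (cι p B).comp φ₀ := RingHom.ext hΦ
    rw [h2, ← hom_eval₂, hfθ, map_zero]
  obtain ⟨h₀, hh₀⟩ := th_ker' p hB _ hker
  have e₀ : WEq p f' (tb p π hA.πs) (tmap p Φ) (tb p θ hθ) h₀ := by
    rw [WEq, hh₀, hw]; ring
  have hnt' : Nontrivial (PreTilt (Cp p B) p) := CharP.nontrivial_of_char_ne_one (v := p) (Fact.out : p.Prime).ne_one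
  obtain ⟨P, i1, i2, i3, ι, X, H, hP1, hP2, hP3, hP4⟩ := exists_P p f' (tb p π hA.πs) hmon
    (by rw [hdeg, hf.natDegree_map]; exact hf0) xs hxs e₀
  obtain ⟨ψ, hψ1, hψ2, hψ3⟩ := hP3 _ _ _ _ e₀
  refine ⟨P, i1, i2, i3, ι, X, H, f', hf', hP1, hP2, ψ, hψ1, hψ2, ?_⟩
  have hG1 : ∀ e, tmap p Φ e ∈ GG p T := by
    intro e k
    obtain ⟨a, ha⟩ := br_surj p (cf p k e)
    refine ⟨φ₀ a, hT1 a, ?_⟩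
    rw [cf_tmap p Φ k e (cι p A a) ha.symm, hΦ]; rfl
  have hG2 : tb p θ hθ ∈ GG p T := fun k => ⟨θ k, hT2 k, cf_tb p θ hθ k⟩
  have htop := hP4 ((GG p T).comap ψ) (fun a => by
      rw [Subring.mem_comap, ← RingHom.comp_apply, hψ1]; exact hG1 a) (by rw [Subring.mem_comap, hψ2]; exact hG2)
    (fun n => by
      rw [Subring.mem_comap, ← WittVector.map_coeff, hψ3]
      exact WEq.coeff_mem p e₀ (GG p T) hG1 hG2 (fun b hb => by
        rw [hw] at hb
        exact GG_div p hB T hT3 b hb) n)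
    (fun z hz => by
      rw [Subring.mem_comap, map_pow] at hz
      exact GG_root p T _ hz)
  intro z
  have : z ∈ (GG p T).comap ψ := by rw [htop]; trivial
  exact this
end
end

section
section
open Polynomial WittVector

theorem almost_main.{u} (p : ℕ) [Fact p.Prime] {A B : Type u} [CommRing A] [CommRing B] (φ₀ : A →+* B) {π : ℕ → A}
    (hA : PB p π) (hB : PB p (fun n => φ₀ (π n)))
    (θ : ℕ → B) (hθ : ∀ n, θ (n + 1) ^ p = θ n) (hθ0 : ∃ k, ∀ c, θ k ≠ p * c)
    (f : A[X]) (hf : f.Monic) (hf0 : 0 < f.natDegree) (hfθ : f.eval₂ φ₀ (θ 0) = 0)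
    (s₁ r₁ : A[X]) (e₁ : ℕ) (hsep : derivative f * s₁ + f * r₁ = X ^ e₁)
    (T : Subring B) (hT1 : ∀ a, φ₀ a ∈ T) (hT2 : ∀ n, θ n ∈ T) (hT3 : ∀ k z, φ₀ (π k) * z ∈ T → z ∈ T)
    {r : ℕ} (y : Fin r → ℕ → A) (hy : ∀ j n, y j (n + 1) ^ p = y j n) (a : ℕ → A) (ha : ∀ n, a (n + 1) ^ p = a n)
    (hWR : WR ⊥ ((p : A) :: (List.ofFn (fun j => y j 0) ++ [a 0])))
    (m : ℕ) (c c0 : A[X]) (cj : Fin r → A[X]) (hc : IntD (expand A (p ^ m) f) c) (hc0 : IntD (expand A (p ^ m) f) c0)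
    (hcj : ∀ j, IntD (expand A (p ^ m) f) (cj j))
    (hF : expand A (p ^ m) f ∣ C (a 0) * c - C (p : A) * c0 - ∑ j, C (y j 0) * cj j) (N n k : ℕ) :
    ∃ b ∈ T, ∃ b' : Fin r → B, (∀ j, b' j ∈ T) ∧
      (∃ b'', θ k ^ 2 * θ n * b = ∑ j, φ₀ (y j 0) * b' j + p * b'') ∧
      ∀ (V : Type u) [CommRing V] (φ : B →+* V), PB p (fun n => φ (φ₀ (π n))) →
        ∀ u : ℕ → V, (∀ n, u (n + 1) ^ p = u n) → (∀ l, φ (θ l) * u l = φ (φ₀ (π l)) ^ p ^ n) →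
        ∀ tV, φ ((derivative (expand A (p ^ m) f)).eval₂ φ₀ (θ m)) * tV = φ (c.eval₂ φ₀ (θ m)) →
          ∃ v, φ b = φ (θ n) * φ (φ₀ (π N)) * tV + p * v := by
  have fA := PB.fact p hA
  have fB := PB.fact p hB
  obtain ⟨Φ, hΦ⟩ := Cp_lift p ((cι p B).comp φ₀)
  have hΦ : ∀ a, Φ (cι p A a) = cι p B (φ₀ a) := hΦ
  set w := tb p π hA.πs with hw
  set ys : Fin r → PreTilt (Cp p A) p := fun j => tb p (y j) (hy j) with hys
  set aa := tb p a ha with haa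
  have hxs : WR ⊥ (w :: (List.ofFn ys ++ [aa])) := by
    refine tilt_WR p hA _ (List.ofFn (fun j => y j 0) ++ [a 0]) ?_ hWR
    simp only [List.map_append, List.map_ofFn, List.map_cons, List.map_nil]
    rfl
  obtain ⟨P, i1, i2, i3, ι, X, H, f', hf', hP1, hP2, ψ, hψ1, hψ2, hψ3⟩ :=
    stage1 p φ₀ hA hB Φ hΦ θ hθ f hf hf0 hfθ T hT1 hT2 hT3 _ hxs
  have hψι : ∀ e, ψ (ι e) = tmap p Φ e := fun e => by rw [← hψ1]; rfl
  have hX : X ≠ 0 := by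
    rintro rfl
    obtain ⟨k, hk⟩ := hθ0
    rw [map_zero] at hψ2
    have := congrArg (cf p k) hψ2
    rw [map_zero, cf_tb, eq_comm, br_eq_zero] at this
    obtain ⟨c, hc⟩ := this
    exact hk c hc
  have hιw : ∀ z, ι w * z = 0 → z = 0 := hP2.1
  obtain ⟨Q, j1, j2, j3, i, u, hu, hQ1, hR1, hR2, hQ⟩ := exists_Pn p (ι w) X hιw hX n
  obtain ⟨ρ, hρ⟩ := lift_theta p hA (i.comp ι)
  change Cp p A →+* SS p (i (ι w)) at ρ
  let Z : SS p (i (ι w)) := smk p _ (teichmuller p (rt p m (i X)))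
  have hZq : Z ^ p ^ m = smk p _ (teichmuller p (i X)) := by
    rw [← map_pow, ← map_pow, rt_pow]
  have hfZ : f.eval₂ (ρ.comp (cι p A)) (Z ^ p ^ m) = 0 := by
    have h1 := congrArg (smk p (i (ι w))) (hP1.map p i)
    rw [map_add, map_mul, map_mul, map_natCast] at h1
    have h2 : smk p (i (ι w)) (teichmuller p ((i.comp ι) w)) = p := smk_teich p _
    rw [h2, hom_eval₂] at h1
    have h3 : (smk p (i (ι w))).comp (WittVector.map (i.comp ι)) = ρ.comp (th p) := by
      apply RingHom.ext; intro v; exact (hρ v).symm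
    rw [h3, ← eval₂_map, hf', eval₂_map] at h1
    rw [hZq]
    linear_combination h1
  obtain ⟨D', M, hD⟩ := Dlem p m (Fact.out : p.Prime).pos f s₁ r₁ e₁ hsep (ρ.comp (cι p A)) Z
    (smk p _ (teichmuller p u)) (p ^ n) hfZ (by
      rw [hZq, ← map_mul, ← map_mul, hu, map_pow, map_pow, smk_teich])
  have hFZ : (expand A (p ^ m) f).eval₂ (ρ.comp (cι p A)) Z = 0 := by
    rw [expand_eq_comp_X_pow, eval₂_comp, eval₂_X_pow, hfZ]
  obtain ⟨s, s0, sj, hs, hrel⟩ := rel_SS p (i (ι w)) hQ1 (ρ.comp (cι p A)) (expand A (p ^ m) f) c c0 hc hc0 cj hcj (a 0)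
    (fun j => y j 0) hF Z hFZ D' M hD N
  have hsm : Function.Surjective (smk p (i (ι w))) := Ideal.Quotient.mk_surjective
  obtain ⟨ws, hws⟩ := hsm s
  choose wj hwj using fun j => hsm (sj j)
  have hred : ∀ (e : ℕ → A) (he : ∀ n, e (n + 1) ^ p = e n),
      sred p (i (ι w)) (ρ (cι p A (e 0))) = Ideal.Quotient.mk _ (i (ι (tb p e he))) := by
    intro e he
    rw [← th_tb p e he, hρ, map_teichmuller]
    erw [sred_smk]
  have hrel2 := congrArg (sred p (i (ι w))) hrel
  rw [map_mul, map_add, map_mul, map_natCast, map_sum] at hrel2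
  simp only [map_mul, RingHom.comp_apply] at hrel2
  rw [hred a ha, ← hws, sred_smk] at hrel2
  simp only [hred _ (hy _), ← hwj, sred_smk] at hrel2
  have hpQ : ((p : ℕ) : Q ⧸ Ideal.span {i (ι w)}) = 0 := by
    
    have h0 : (p : Q) = 0 := CharP.cast_eq_zero Q p
    rw [← map_natCast (Ideal.Quotient.mk _), h0, map_zero]
  rw [hpQ, zero_mul, zero_add] at hrel2
  obtain ⟨z₀, hz₀⟩ : ∃ z₀, i (ι aa) * ws.coeff 0 = ∑ j, i (ι (ys j)) * (wj j).coeff 0 + i (ι w) * z₀ := by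
    have : i (ι aa) * ws.coeff 0 - ∑ j, i (ι (ys j)) * (wj j).coeff 0 ∈ Ideal.span {i (ι w)} := by
      rw [← Ideal.Quotient.eq, map_mul, map_sum]
      simp only [map_mul]
      exact hrel2
    obtain ⟨z₀, hz₀⟩ := Ideal.mem_span_singleton'.1 this
    exact ⟨z₀, by linear_combination -hz₀⟩
  obtain ⟨b, z₁, hb⟩ := hR1 (ws.coeff 0)
  choose bj zj hbj using fun j => hR1 ((wj j).coeff 0)
  obtain ⟨cc, hcc⟩ := hR2 (ι aa * b - ∑ j, ι (ys j) * bj j) (i (rt p n X) * z₀ + ∑ j, i (ι (ys j)) * zj j - i (ι aa) * z₁) (by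
    rw [map_sub, map_mul, map_sum]
    have h1 : i (rt p n X) * ∑ j, i (ι (ys j)) * (wj j).coeff 0 = ∑ j, i (ι (ys j) * bj j) + i (ι w) * ∑ j, i (ι (ys j)) * zj j := by
      rw [Finset.mul_sum, Finset.mul_sum, ← Finset.sum_add_distrib]
      refine Finset.sum_congr rfl fun j _ => ?_
      rw [map_mul]
      linear_combination i (ι (ys j)) * hbj j
    linear_combination -i (ι aa) * hb + i (rt p n X) * hz₀ + h1) k
  set κ := rt p k X ^ 2 * rt p n X with hκ
  have hmem : κ * b ∈ Ideal.span {ι w} ⊔ Ideal.span (Set.range fun j => ι (ys j)) := by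
    have h1 := WR_iff.1 hP2 (ι w :: List.ofFn (fun j => ι (ys j))) (ι aa) [] (by
      simp only [List.map_cons, List.map_append, List.map_ofFn, List.map_nil, List.cons_append]; rfl)
    rw [bot_sup_eq, Ideal.ofList_cons] at h1
    have h2 : Ideal.ofList (List.ofFn (fun j => ι (ys j))) = Ideal.span (Set.range fun j => ι (ys j)) := by
      rw [Ideal.ofList]; congr 1; ext z; simp [List.mem_ofFn]
    rw [h2] at h1
    apply h1
    have h3 : ι aa * (κ * b) = ι w * cc + ∑ j, ι (ys j) * (κ * bj j) := by
      have : ∑ j, ι (ys j) * (κ * bj j) = κ * ∑ j, ι (ys j) * bj j := by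
        rw [Finset.mul_sum]; exact Finset.sum_congr rfl fun j _ => by ring
      rw [this]; linear_combination hcc
    rw [h3]
    refine Ideal.add_mem _ (Ideal.mem_sup_left (Ideal.mul_mem_right _ _ (Ideal.mem_span_singleton_self _)))
      (Ideal.mem_sup_right (Ideal.sum_mem _ fun j _ => Ideal.mul_mem_right _ _ (Ideal.subset_span ⟨j, rfl⟩)))
  obtain ⟨z₂, hz₂, z₃, hz₃, hz⟩ := Submodule.mem_sup.1 hmem
  obtain ⟨z₄, rfl⟩ := Ideal.mem_span_singleton'.1 hz₂
  obtain ⟨bj', rfl⟩ := Ideal.mem_span_range_iff_exists_fun.1 hz₃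
  obtain ⟨tb0, htb0, hb0⟩ := hψ3 b 0
  choose tbj htbj hbj0 using fun j => hψ3 (bj' j) 0
  have hcfr : ∀ l, cf p 0 (ψ (rt p l X)) = br p (θ l) := by
    intro l; rw [map_rt p ψ, hψ2, cf_rt, cf_tb, zero_add]
  have hcfy : ∀ (e : ℕ → A) (he : ∀ n, e (n + 1) ^ p = e n) l, cf p l (ψ (ι (tb p e he))) = br p (φ₀ (e l)) := by
    intro e he l
    rw [hψι, cf_tmap p Φ l _ (cι p A (e l)) (cf_tb p e he l), hΦ]; rfl
  refine ⟨tb0, htb0, tbj, htbj, ?_, ?_⟩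
  · rw [← br_eq, map_mul, map_mul, map_pow, ← hcfr, ← hcfr, ← hb0, map_sum]
    have h1 := congrArg (fun z => cf p 0 (ψ z)) hz
    simp only [map_add, map_mul, map_sum, hκ, map_pow] at h1
    rw [← h1, hcfy π hA.πs, hA.π0, map_natCast, br_p, mul_zero, zero_add]
    refine Finset.sum_congr rfl fun j _ => ?_
    rw [hcfy _ (hy j), hbj0, map_mul, mul_comm]
  · intro V _ φ hV uV huV huθ tV htV
    have fV := PB.fact p hV
    obtain ⟨Ψ, hΨ⟩ := Cp_lift p ((cι p V).comp φ)
    have hΨ : ∀ a, Ψ (cι p B a) = cι p V (φ a) := hΨ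
    have hτ : ∀ n, φ (θ (n + 1)) ^ p = φ (θ n) := fun n => by rw [← map_pow, hθ]
    have hgw : tmap p Ψ (ψ (ι w)) = tb p (fun n => φ (φ₀ (π n))) hV.πs := by
      rw [hψι, tmap_tb p φ₀ Φ hΦ π hA.πs _ hB.πs (fun _ => rfl), tmap_tb p φ Ψ hΨ _ _ _ hV.πs (fun _ => rfl)]
    have hgX : tmap p Ψ (ψ X) = tb p (fun n => φ (θ n)) hτ := by
      rw [hψ2, tmap_tb p φ Ψ hΨ _ _ _ hτ (fun _ => rfl)]
    obtain ⟨g, hg⟩ := hQ (PreTilt (Cp p V) p) ((tmap p Ψ).comp ψ) (tb p uV huV) (by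
      rw [RingHom.comp_apply, RingHom.comp_apply, hgw, hgX]
      apply cf_ext p
      intro l
      rw [map_mul, map_pow, cf_tb, cf_tb, cf_tb, ← map_mul, ← map_pow, huθ]) (by
      intro z hz
      rw [RingHom.comp_apply, hgw] at hz
      exact tb_nz p hV z hz)
    have hgi : ∀ e, g (i e) = tmap p Ψ (ψ e) := fun e => by
      rw [← RingHom.comp_apply, hg]; rfl
    obtain ⟨σ, hσ1, hσ2, hσ3, hσ4⟩ := V_part p hA (i.comp ι) (i X) ρ hρ (φ.comp φ₀) hV (fun n => φ (θ n)) hτ (Ψ.comp Φ)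
      (fun a => by rw [RingHom.comp_apply, hΦ, hΨ]; rfl) g (by
        apply RingHom.ext
        intro e
        rw [RingHom.comp_apply, RingHom.comp_apply, hgi, hψι]
        apply cf_ext p
        intro l
        obtain ⟨o, ho⟩ := Ideal.Quotient.mk_surjective (cf p l e)
        rw [cf_tmap p _ l e o ho.symm, cf_tmap p _ l _ _ (cf_tmap p _ l e o ho.symm)]; rfl) (by rw [hgi, hgX])
    have hσ2' : σ Z = cι p V (φ (θ m)) := hσ2 m
    have hσ3' : σ (spi p (i (ι w)) N) = cι p V (φ (φ₀ (π N))) := hσ3 N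
    have hσ4' : ∀ w', σ (smk p (i (ι w)) w') = th p (WittVector.map g w') := hσ4
    have hev : ∀ G : A[X], σ (G.eval₂ (ρ.comp (cι p A)) Z) = cι p V (φ (G.eval₂ φ₀ (θ m))) := by
      intro G
      rw [hom_eval₂, hom_eval₂, hom_eval₂, hσ2']
      congr 1
      apply RingHom.ext
      intro a
      exact hσ1 a
    have h1 := congrArg σ hs
    rw [map_mul, map_mul, hev, hev, hσ3', ← htV] at h1
    have h2 := congrArg σ hD
    rw [map_mul, hev, map_pow, map_natCast] at h2
    have tfp : ∀ (M : ℕ) (o : Cp p V), (p : Cp p V) ^ M * o = 0 → o = 0 := by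
      intro M
      induction M with
      | zero => intro o ho; simpa using ho
      | succ M ih => intro o ho; exact ih _ ((Cp_PB p hV).tf _ (by rw [← mul_assoc, ← pow_succ', ho]))
    have h3 : σ s = cι p V (φ (φ₀ (π N)) * tV) := by
      rw [← sub_eq_zero]
      apply tfp M
      rw [← h2, map_mul]
      rw [map_mul] at h1
      linear_combination -σ D' * h1
    have h4 : cf p 0 (g (ws.coeff 0)) = br p (φ (φ₀ (π N)) * tV) := by
      rw [← WittVector.map_coeff, ← mk_th, ← hσ4', hws, h3]; rfl
    have h5 := congrArg (fun z => cf p 0 (g z)) hb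
    simp only [map_mul, map_add, h4, hgi] at h5
    rw [hgw, cf_tb, hV.π0, br_p, zero_mul, add_zero, cf_tmap p Ψ 0 (ψ b) (cι p B tb0) hb0, map_rt p ψ, map_rt p (tmap p Ψ), hgX,
      cf_rt, cf_tb, hΨ] at h5
    rw [← br_eq, map_mul, map_mul]
    rw [zero_add] at h5
    change _ = br p (φ tb0) at h5
    rw [← h5]
    ring
end
end

section
section
open Polynomial

theorem seq_pow {M : Type*} [Monoid M] (p : ℕ) (s : ℕ → M) (hs : ∀ n, s (n + 1) ^ p = s n) (n k : ℕ) : s (n + k) ^ p ^ k = s n := by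
  induction k with
  | zero => simp
  | succ k ih => rw [pow_succ', pow_mul, ← add_assoc, hs, ih]

theorem seq_pow0 {M : Type*} [Monoid M] (p : ℕ) (s : ℕ → M) (hs : ∀ n, s (n + 1) ^ p = s n) (k : ℕ) : s k ^ p ^ k = s 0 := by
  have := seq_pow p s hs 0 k
  rwa [zero_add] at this

theorem PB_mk (p : ℕ) [Fact p.Prime] {Ω : Type*} [Field Ω] [CharZero Ω] (B : Subring Ω) (K : Subfield Ω) (hBK : ∀ b ∈ B, b ∈ K)
    (π : ℕ → B) (h0 : π 0 = (p : B)) (hs : ∀ n, π (n + 1) ^ p = π n) (hinv : (p : Ω)⁻¹ ∉ B)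
    (hcl : ∀ z ∈ K, ∀ n, 0 < n → z ^ n ∈ B → z ∈ B) (hfr : ∀ o : B, ∃ o' c : B, o = o' ^ p + p * c) : PB p π := by
  have hp0 : (p : Ω) ≠ 0 := Nat.cast_ne_zero.2 (Fact.out : p.Prime).ne_zero
  have hp : 0 < p := (Fact.out : p.Prime).pos
  refine ⟨?_, ?_, h0, hs, ?_, hfr⟩
  · intro hu
    obtain ⟨v, hv⟩ := hu.exists_right_inv
    have h1 := congrArg (fun z : B => (z : Ω)) hv
    simp only [Subring.coe_mul, Subring.coe_natCast, Subring.coe_one] at h1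
    apply hinv
    rw [inv_eq_of_mul_eq_one_right h1]
    exact v.2
  · intro o ho
    have h1 := congrArg (fun z : B => (z : Ω)) ho
    simp only [Subring.coe_mul, Subring.coe_natCast, Subring.coe_zero] at h1
    exact Subtype.ext ((mul_eq_zero.1 h1).resolve_left hp0)
  · rintro n o ⟨c, hc⟩
    have h1 := congrArg (fun z : B => (z : Ω)) hc
    simp only [Subring.coe_mul, Subring.coe_natCast, Subring.coe_pow] at h1
    have h2 : (π n : Ω) ^ p ^ n = p := by
      have := seq_pow0 p π hs n
      have := congrArg (fun z : B => (z : Ω)) (this.trans h0)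
      simpa using this
    have h3 : (π n : Ω) ≠ 0 := by
      intro h; rw [h, zero_pow (pow_pos hp n).ne'] at h2; exact hp0 h2.symm
    refine ⟨⟨(o : Ω) / π n, hcl _ (K.div_mem (hBK _ o.2) (hBK _ (π n).2)) (p ^ n) (pow_pos hp n) ?_⟩, ?_⟩
    · rw [div_pow, h2, h1, mul_div_cancel_left₀ _ hp0]; exact c.2
    · apply Subtype.ext
      simp only [Subring.coe_mul]
      field_simp

structure FD (p : ℕ) {Ω : Type*} [Field Ω] (A Rp : Subring Ω) (K : Subfield Ω) (π θ : ℕ → Ω) (f s₁ r₁ : Polynomial A) (e₁ : ℕ) : Prop where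
  AR : A ≤ Rp
  AK : ∀ a ∈ A, a ∈ K
  cl : ∀ z ∈ K, IsIntegral A z → z ∈ A
  fr : ∀ o : A, ∃ o' c : A, o = o' ^ p + p * c
  Rcl : ∀ z, IsIntegral Rp z → z ∈ Rp
  Rint : ∀ z ∈ Rp, IsIntegral A z
  inv : (p : Ω)⁻¹ ∉ Rp
  πA : ∀ n, π n ∈ A
  π0 : π 0 = p
  πs : ∀ n, π (n + 1) ^ p = π n
  θs : ∀ n, θ (n + 1) ^ p = θ n
  mon : f.Monic
  root : aeval (θ 0) f = 0
  c0 : f.coeff 0 ≠ 0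
  sep : derivative f * s₁ + f * r₁ = X ^ e₁
  θ0 : ∃ k, ∀ c ∈ Rp, θ k ≠ p * c

namespace FD
variable {p : ℕ} [Fact p.Prime] {Ω : Type*} [Field Ω] {A Rp : Subring Ω} {K : Subfield Ω} {π θ : ℕ → Ω} {f s₁ r₁ : Polynomial A} {e₁ : ℕ}

theorem pow_mem (h : FD p A Rp K π θ f s₁ r₁ e₁) (z : Ω) (n : ℕ) (hn : 0 < n) (hz : z ^ n ∈ Rp) : z ∈ Rp :=
  h.Rcl z (IsIntegral.of_pow hn (isIntegral_algebraMap (R := Rp) (x := ⟨_, hz⟩)))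

theorem θR (h : FD p A Rp K π θ f s₁ r₁ e₁) (n : ℕ) : θ n ∈ Rp := by
  have hp : 0 < p := (Fact.out : p.Prime).pos
  apply h.pow_mem _ (p ^ n) (pow_pos hp n)
  rw [seq_pow0 p θ h.θs]
  apply h.Rcl
  refine ⟨f.map (Subring.inclusion h.AR), h.mon.map _, ?_⟩
  rw [eval₂_map]
  exact h.root

theorem PBA [CharZero Ω] (h : FD p A Rp K π θ f s₁ r₁ e₁) : PB p (fun n => (⟨π n, h.πA n⟩ : A)) :=
  PB_mk p A K h.AK _ (Subtype.ext h.π0) (fun n => Subtype.ext (h.πs n)) (fun hh => h.inv (h.AR hh))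
    (fun z hz n hn hzn => h.cl z hz (IsIntegral.of_pow hn (isIntegral_algebraMap (R := A) (x := ⟨_, hzn⟩)))) h.fr

theorem PBB [CharZero Ω] [IsAlgClosed Ω] (h : FD p A Rp K π θ f s₁ r₁ e₁) (B : Subring Ω) (hB : Rp ≤ B)
    (hcl : ∀ z : Ω, ∀ n, 0 < n → z ^ n ∈ B → z ∈ B) (hinv : (p : Ω)⁻¹ ∉ B) : PB p (fun n => (⟨π n, hB (h.AR (h.πA n))⟩ : B)) :=
  PB_mk p B ⊤ (fun _ _ => trivial) _ (Subtype.ext h.π0) (fun n => Subtype.ext (h.πs n)) hinv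
    (fun z _ n hn hzn => hcl z n hn hzn) (fun o => by
      obtain ⟨z, hz⟩ := IsAlgClosed.exists_pow_nat_eq (o : Ω) (Fact.out : p.Prime).pos
      exact ⟨⟨z, hcl z p (Fact.out : p.Prime).pos (by rw [hz]; exact o.2)⟩, 0, Subtype.ext (by simp [hz])⟩)

theorem root_ne (h : FD p A Rp K π θ f s₁ r₁ e₁) (z : Ω) (hz : aeval z f = 0) : z ≠ 0 := by
  rintro rfl
  apply h.c0
  rw [← coeff_zero_eq_aeval_zero'] at hz
  exact Subtype.ext hz

theorem sepF [CharZero Ω] (h : FD p A Rp K π θ f s₁ r₁ e₁) (m : ℕ) (ρ : Ω) (hρ : aeval ρ (expand A (p ^ m) f) = 0) :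
    aeval ρ (derivative (expand A (p ^ m) f)) ≠ 0 := by
  rw [expand_aeval] at hρ
  have h1 := h.root_ne _ hρ
  obtain ⟨D', M, hD⟩ := Dlem p m (Fact.out : p.Prime).pos f s₁ r₁ e₁ h.sep (algebraMap A Ω) ρ (ρ ^ p ^ m)⁻¹ 0 hρ (by
    rw [mul_inv_cancel₀ h1, pow_zero])
  intro h2
  rw [aeval_def] at h2
  rw [h2, zero_mul] at hD
  exact pow_ne_zero M (Nat.cast_ne_zero.2 (Fact.out : p.Prime).ne_zero) hD.symm

theorem up (h : FD p A Rp K π θ f s₁ r₁ e₁) {m l : ℕ} (hml : m ≤ l) {z : Ω} (hz : ∃ u : Polynomial K, aeval (θ m) u = z) :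
    ∃ u : Polynomial K, aeval (θ l) u = z := by
  obtain ⟨u, hu⟩ := hz
  obtain ⟨k, rfl⟩ := Nat.exists_eq_add_of_le hml
  exact ⟨expand K (p ^ k) u, by rw [expand_aeval, seq_pow p θ h.θs, hu]⟩
end FD
end
end

section
section
open Polynomial

theorem FD.main.{u} {p : ℕ} [Fact p.Prime] {Ω : Type u} [Field Ω] [CharZero Ω] [IsAlgClosed Ω] {A Rp : Subring Ω} {K : Subfield Ω} {π θ : ℕ → Ω}
    {f s₁ r₁ : Polynomial A} {e₁ : ℕ} (h : FD p A Rp K π θ f s₁ r₁ e₁) (T : Subring Ω)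
    (hT : ∀ z, z ∈ T ↔ z ∈ Rp ∧ ∃ m, ∃ u : Polynomial K, aeval (θ m) u = z)
    {r : ℕ} (y : Fin r → ℕ → A) (hy : ∀ j n, y j (n + 1) ^ p = y j n) (a : ℕ → A) (ha : ∀ n, a (n + 1) ^ p = a n)
    (hWR : WR ⊥ ((p : A) :: (List.ofFn (fun j => y j 0) ++ [a 0])))
    (t t0 : Ω) (tj : Fin r → Ω) (ht : t ∈ T) (ht0 : t0 ∈ T) (htj : ∀ j, tj j ∈ T)
    (hrel : (a 0 : Ω) * t = p * t0 + ∑ j, (y j 0 : Ω) * tj j) (n₀ : ℕ) :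
    ∃ s0 ∈ T, ∃ sj : Fin r → Ω, (∀ j, sj j ∈ T) ∧ π n₀ * θ n₀ * t = p * s0 + ∑ j, (y j 0 : Ω) * sj j := by
  have hp0 : (p : Ω) ≠ 0 := Nat.cast_ne_zero.2 (Fact.out : p.Prime).ne_zero
  have hp : 0 < p := (Fact.out : p.Prime).pos
  have hKT : ∀ k ∈ K, k ∈ Rp → k ∈ T := fun k hk hkR => (hT k).2 ⟨hkR, 0, C ⟨k, hk⟩, by simp; rfl⟩
  have hAT : ∀ a ∈ A, a ∈ T := fun k hk => hKT k (h.AK k hk) (h.AR hk)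
  have hθT : ∀ n, θ n ∈ T := fun n => (hT _).2 ⟨h.θR n, n, X, by simp⟩
  obtain ⟨m, hm⟩ : ∃ m, ∀ i : Option (Option (Fin r)), ∃ u : Polynomial K,
      aeval (θ m) u = (i.elim t (fun i => i.elim t0 tj) : Ω) := by
    have : ∀ i : Option (Option (Fin r)), ∃ m, ∃ u : Polynomial K, aeval (θ m) u = (i.elim t (fun i => i.elim t0 tj) : Ω) := by
      rintro (_ | _ | j)
      · exact ((hT _).1 ht).2
      · exact ((hT _).1 ht0).2
      · exact ((hT _).1 (htj j)).2
    choose m hm using this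
    exact ⟨Finset.univ.sup m, fun i => h.up (Finset.le_sup (Finset.mem_univ i)) (hm i)⟩
  set F := expand A (p ^ m) f with hF
  have hFmon : F.Monic := h.mon.expand (pow_pos hp m)
  have hFθ : aeval (θ m) F = 0 := by
    rw [hF, expand_aeval, seq_pow0 p θ h.θs]; exact h.root
  obtain ⟨c, hc1, hc2, hc3⟩ := lift_lemma A K h.AK h.cl F hFmon (h.sepF m) (θ m) hFθ
    (fun i : Option (Option (Fin r)) => i.elim t (fun i => i.elim t0 tj))
    (fun i => i.elim (a 0) (fun i => i.elim (-(p : A)) (fun j => -(y j 0))))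
    (by
      rintro (_ | _ | j)
      · exact h.Rint _ ((hT _).1 ht).1
      · exact h.Rint _ ((hT _).1 ht0).1
      · exact h.Rint _ ((hT _).1 (htj j)).1) hm
    (by
      simp only [Fintype.sum_option, Option.elim_none, Option.elim_some, hrel]
      simp
      ring)
  have hPA := h.PBA
  have hPR := h.PBB Rp le_rfl h.pow_mem h.inv
  obtain ⟨b, hbT, b', hb'T, ⟨b'', hb''⟩, hV⟩ := almost_main p (Subring.inclusion h.AR) hPA hPR (fun n => ⟨θ n, h.θR n⟩)
    (fun n => Subtype.ext (h.θs n)) (by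
      obtain ⟨k, hk⟩ := h.θ0
      refine ⟨k, fun c hc => hk c c.2 ?_⟩
      simpa using congrArg (fun z : Rp => (z : Ω)) hc)
    f h.mon (by
      by_contra h0
      have h1 : f = 1 := h.mon.natDegree_eq_zero.1 (by omega)
      have := h.root
      rw [h1, map_one] at this
      exact one_ne_zero this) (by
      apply Subtype.ext
      have := hom_eval₂ f (Subring.inclusion h.AR) Rp.subtype ⟨θ 0, h.θR 0⟩
      exact this.trans h.root) s₁ r₁ e₁ h.sep (T.comap Rp.subtype)
    (fun a => hAT a a.2) hθT (fun k z hz => by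
      have hz : π k * (z : Ω) ∈ T := hz
      change (z : Ω) ∈ T
      obtain ⟨_, m, u, hu⟩ := (hT _).1 hz
      refine (hT _).2 ⟨z.2, m, C ⟨π k, h.AK _ (h.πA k)⟩⁻¹ * u, ?_⟩
      have hπ : π k ≠ 0 := by
        intro hh
        have := seq_pow0 p π h.πs k
        rw [hh, zero_pow (pow_pos hp k).ne', h.π0] at this
        exact hp0 this.symm
      rw [map_mul, hu, aeval_C]
      change (π k)⁻¹ * (π k * z) = z
      field_simp) y hy a ha hWR m (c none) (c (some none)) (fun j => c (some (some j))) (hc3 _) (hc3 _) (fun j => hc3 _)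
    (by
      convert hc2 using 1
      have e1 : ∑ x, C (-(y x 0)) * c (some (some x)) = -∑ x, C (y x 0) * c (some (some x)) := by
        rw [← Finset.sum_neg_distrib]; exact Finset.sum_congr rfl fun j _ => by rw [C_neg]; ring
      simp only [Fintype.sum_option, Option.elim_none, Option.elim_some]
      rw [e1, C_neg]
      ring) n₀ (n₀ + 3) (n₀ + 3)
  set n := n₀ + 3 with hn
  have hα : θ 0 ≠ 0 := h.root_ne _ h.root
  have hθ0 : ∀ l, θ l ≠ 0 := by
    intro l hl
    have := seq_pow0 p θ h.θs l
    rw [hl, zero_pow (pow_pos hp l).ne'] at this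
    exact hα this.symm
  have hδ : θ n * (θ n * π n₀ * t - b) / p ∈ Rp := by
    by_contra hnot
    have : IsIntegrallyClosedIn Rp Ω := Subring.isIntegrallyClosedIn_iff.2 h.Rcl
    obtain ⟨V, hRV, hVn⟩ := Subring.exists_le_valuationSubring_of_isIntegrallyClosedIn hnot
    apply hVn
    have hRV' : ∀ z ∈ Rp, z ∈ V := fun z hz => hRV hz
    have hθV : ∀ l, θ l ∈ V := fun l => hRV' _ (h.θR l)
    have hπV : ∀ l, π l ∈ V := fun l => hRV' _ (h.AR (h.πA l))
    have htV : t ∈ V := hRV' _ ((hT _).1 ht).1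
    have hVcl : ∀ z : Ω, ∀ n, 0 < n → z ^ n ∈ V → z ∈ V := by
      intro z n hn hz
      rcases V.mem_or_inv_mem z with h1 | h1
      · exact h1
      · obtain ⟨l, rfl⟩ := Nat.exists_eq_succ_of_ne_zero hn.ne'
        by_cases hz0 : z = 0
        · rw [hz0]; exact V.zero_mem
        have : z = z ^ (l + 1) * (z⁻¹) ^ l := by rw [inv_pow, pow_succ']; field_simp
        rw [this]
        exact V.mul_mem _ _ hz (V.pow_mem h1 _)
    have hin : θ n * (θ n * π n₀ * t - b) ∈ V :=
      V.mul_mem _ _ (hθV n) (V.sub_mem (V.mul_mem _ _ (V.mul_mem _ _ (hθV n) (hπV n₀)) htV) (hRV' _ b.2))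
    by_cases hpV : (p : Ω)⁻¹ ∈ V
    · rw [div_eq_mul_inv]; exact V.mul_mem _ _ hin hpV
    rcases V.mem_or_inv_mem ((p : Ω) ^ p ^ n / θ 0) with hg | hg
    · have hPV := h.PBB V.toSubring hRV hVcl hpV
      have hu : ∀ l, (π l) ^ p ^ n / θ l ∈ V := by
        intro l
        apply hVcl _ (p ^ l) (pow_pos hp l)
        rw [div_pow, seq_pow0 p θ h.θs, ← pow_mul, mul_comm, pow_mul, seq_pow0 p π h.πs, h.π0]
        exact hg
      obtain ⟨v, hv⟩ := hV V.toSubring (Subring.inclusion hRV) hPV (fun l => ⟨_, hu l⟩) (fun l => Subtype.ext (by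
        change (π (l + 1) ^ p ^ n / θ (l + 1)) ^ p = _
        rw [div_pow, h.θs, ← pow_mul, mul_comm, pow_mul, h.πs])) (fun l => Subtype.ext (by
        change θ l * (π l ^ p ^ n / θ l) = π l ^ p ^ n
        have := hθ0 l
        field_simp)) ⟨t, htV⟩ (Subtype.ext (by
          change Rp.subtype _ * t = Rp.subtype _
          rw [hom_eval₂, hom_eval₂]
          exact (hc1 none).symm))
      have hv' : (b : Ω) = θ n * π n₀ * t + p * v := by simpa using congrArg (fun z : V.toSubring => (z : Ω)) hv
      have : θ n * (θ n * π n₀ * t - b) / p = -(θ n * v) := by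
        rw [hv']; field_simp; ring
      rw [this]
      exact V.neg_mem _ (V.mul_mem _ _ (hθV n) v.2)
    · have h1 : θ n / p ∈ V := by
        apply hVcl _ (p ^ n) (pow_pos hp n)
        rw [div_pow, seq_pow0 p θ h.θs]
        rwa [inv_div] at hg
      rw [mul_div_right_comm]
      exact V.mul_mem _ _ h1 (V.sub_mem (V.mul_mem _ _ (V.mul_mem _ _ (hθV n) (hπV n₀)) htV) (hRV' _ b.2))
  obtain ⟨δ, hδR, hδe⟩ : ∃ δ ∈ Rp, θ n * (θ n * π n₀ * t - b) = p * δ := ⟨_, hδ, by field_simp⟩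
  have hb2 : θ n ^ 2 * θ n * b = ∑ j, (y j 0 : Ω) * b' j + p * b'' := by
    have := congrArg Rp.subtype hb''
    rw [map_add, map_sum] at this
    simpa using this
  have h8 : 5 ≤ p ^ 3 := by
    have := (Fact.out : p.Prime).two_le
    calc 5 ≤ 2 ^ 3 := by norm_num
      _ ≤ _ := Nat.pow_le_pow_left this 3
  obtain ⟨l, hl⟩ := Nat.exists_eq_add_of_le h8
  have hθn : θ n₀ = θ n ^ l * θ n ^ 5 := by
    rw [← pow_add, add_comm, ← hl, hn, seq_pow p θ h.θs]
  have hfin : π n₀ * θ n₀ * t = p * (θ n ^ l * (θ n * b'' + θ n ^ 3 * δ)) + ∑ j, (y j 0 : Ω) * (θ n ^ l * θ n * b' j) := by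
    have h9 : ∑ j, (y j 0 : Ω) * (θ n ^ l * θ n * b' j) = θ n ^ l * θ n * ∑ j, (y j 0 : Ω) * b' j := by
      rw [Finset.mul_sum]; exact Finset.sum_congr rfl fun j _ => by ring
    rw [h9, hθn]
    linear_combination θ n ^ l * θ n * hb2 + θ n ^ l * θ n ^ 3 * hδe
  have hsjT : ∀ j, θ n ^ l * θ n * b' j ∈ T := fun j => T.mul_mem (T.mul_mem (T.pow_mem (hθT n) _) (hθT n)) (hb'T j)
  refine ⟨_, ?_, fun j => θ n ^ l * θ n * b' j, hsjT, hfin⟩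
  set S0 := θ n ^ l * (θ n * b'' + θ n ^ 3 * δ) with hS0
  have hpS : (p : Ω) * S0 ∈ T := by
    have : (p : Ω) * S0 = π n₀ * θ n₀ * t - ∑ j, (y j 0 : Ω) * (θ n ^ l * θ n * b' j) := by rw [hfin]; ring
    rw [this]
    exact T.sub_mem (T.mul_mem (T.mul_mem (hAT _ (h.πA _)) (hθT _)) ht)
      (T.sum_mem fun j _ => T.mul_mem (hAT _ (y j 0).2) (hsjT j))
  obtain ⟨_, m', u, hu⟩ := (hT _).1 hpS
  refine (hT _).2 ⟨?_, m', C (p : K)⁻¹ * u, ?_⟩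
  · exact Rp.mul_mem (Rp.pow_mem (h.θR n) _) (Rp.add_mem (Rp.mul_mem (h.θR n) b''.2) (Rp.mul_mem (Rp.pow_mem (h.θR n) _) hδR))
  · rw [map_mul, hu, aeval_C]
    change ((p : K)⁻¹ : Ω) * _ = _
    rw [← mul_assoc]
    simp [hp0]
end
end

section
def CIC (B : Type*) [CommRing B] : Prop :=
  ∀ a b c : B, b ≠ 0 → c ≠ 0 → (∀ n : ℕ, b ^ n ∣ c * a ^ n) → b ∣ a

section R1
variable {B : Type*} [CommRing B]

theorem krull_dvd [IsNoetherianRing B] [IsLocalRing B] {t a b : B} (ht : t ∈ IsLocalRing.maximalIdeal B)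
    (h : ∀ n : ℕ, ∃ r s, a = b * r + t ^ n * s) : b ∣ a := by
  have h1 := Ideal.iInf_pow_smul_eq_bot_of_isLocalRing (M := B ⧸ Ideal.span {b}) (IsLocalRing.maximalIdeal B) (Ideal.IsPrime.ne_top inferInstance)
  have h2 : (Ideal.Quotient.mk (Ideal.span {b}) a) ∈ (⨅ i : ℕ, IsLocalRing.maximalIdeal B ^ i • (⊤ : Submodule B (B ⧸ Ideal.span {b}))) := by
    rw [Submodule.mem_iInf]
    intro n
    obtain ⟨r, s, hrs⟩ := h n
    have : Ideal.Quotient.mk (Ideal.span {b}) a = t ^ n • (Ideal.Quotient.mk (Ideal.span {b}) s) := by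
      rw [← Ideal.Quotient.mk_eq_mk, ← Ideal.Quotient.mk_eq_mk, ← Submodule.Quotient.mk_smul, Submodule.Quotient.eq, Ideal.mem_span_singleton]
      exact ⟨r, by rw [hrs, smul_eq_mul]; ring⟩
    rw [this]
    exact Submodule.smul_mem_smul (Ideal.pow_mem_pow ht n) trivial
  rw [h1, Submodule.mem_bot, Ideal.Quotient.eq_zero_iff_mem, Ideal.mem_span_singleton] at h2
  exact h2

theorem krull_fac [IsDomain B] [IsNoetherianRing B] [IsLocalRing B] {t a : B} (ht : t ∈ IsLocalRing.maximalIdeal B) (ha : a ≠ 0) :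
    ∃ (k : ℕ) (a' : B), a = t ^ k * a' ∧ ¬ t ∣ a' := by
  classical
  have h : ∃ n : ℕ, ¬ t ^ n ∣ a := by
    by_contra! h
    exact ha (zero_dvd_iff.1 (krull_dvd (b := 0) ht (fun n => (by obtain ⟨s, hs⟩ := h n; exact ⟨0, s, by rw [hs]; ring⟩))))
  obtain ⟨k, hk⟩ : ∃ k, Nat.find h = k + 1 := Nat.exists_eq_succ_of_ne_zero (by
    intro h0; have := Nat.find_spec h; rw [h0] at this; simp at this)
  have h1 := Nat.find_spec h
  rw [hk] at h1
  obtain ⟨a', rfl⟩ : t ^ k ∣ a := not_not.1 (Nat.find_min h (by omega))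
  exact ⟨k, a', rfl, fun ⟨s, hs⟩ => h1 ⟨s, by rw [hs]; ring⟩⟩

theorem pr_cancel [IsDomain B] {t b e : B} (ht : Prime t) (hb : ¬ t ∣ b) (n k : ℕ) (h : b ^ n ∣ t ^ k * e) : b ^ n ∣ e := by
  obtain ⟨z, hz⟩ := h
  have : t ^ k ∣ z := ht.pow_dvd_of_dvd_mul_left k (fun h => hb (ht.dvd_of_dvd_pow h)) ⟨e, hz.symm⟩
  obtain ⟨w, rfl⟩ := this
  exact ⟨w, mul_left_cancel₀ (pow_ne_zero k ht.ne_zero) (by rw [hz]; ring)⟩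

theorem CIC_step [IsDomain B] [IsNoetherianRing B] [IsLocalRing B] {t : B} (ht : t ∈ IsLocalRing.maximalIdeal B) (htp : Prime t)
    (hq : CIC (B ⧸ Ideal.span {t})) : CIC B := by
  have key : ∀ a b c : B, ¬ t ∣ b → ¬ t ∣ c → (∀ n : ℕ, b ^ n ∣ c * a ^ n) → b ∣ a := by
    intro a b c hb hc h
    have h1 : ∀ a, (∀ n : ℕ, b ^ n ∣ c * a ^ n) → ∃ r a₁, a = b * r + t * a₁ ∧ (∀ n : ℕ, b ^ n ∣ c * a₁ ^ n) := by
      intro a h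
      have := hq (Ideal.Quotient.mk _ a) (Ideal.Quotient.mk _ b) (Ideal.Quotient.mk _ c)
        (by rwa [Ne, Ideal.Quotient.eq_zero_iff_mem, Ideal.mem_span_singleton]) (by rwa [Ne, Ideal.Quotient.eq_zero_iff_mem, Ideal.mem_span_singleton])
        (fun n => by rw [← map_pow, ← map_pow, ← map_mul]; exact map_dvd _ (h n))
      obtain ⟨r, hr⟩ := this
      obtain ⟨r, rfl⟩ := Ideal.Quotient.mk_surjective r
      rw [← map_mul, Ideal.Quotient.eq, Ideal.mem_span_singleton] at hr
      obtain ⟨a₁, ha₁⟩ := hr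
      refine ⟨r, a₁, by rw [← ha₁]; ring, fun n => pr_cancel htp hb n n ?_⟩
      have : t ^ n * (c * a₁ ^ n) = c * (a + - (b * r)) ^ n := by
        rw [← sub_eq_add_neg, ha₁, mul_pow]; ring
      rw [this, add_pow, Finset.mul_sum]
      refine Finset.dvd_sum fun i hi => ?_
      have hi : i ≤ n := Nat.lt_succ_iff.1 (Finset.mem_range.1 hi)
      have e : c * (a ^ i * (-(b * r)) ^ (n - i) * (n.choose i)) = (c * a ^ i) * b ^ (n - i) * ((-r) ^ (n - i) * (n.choose i)) := by
        rw [show -(b * r) = b * (-r) by ring, mul_pow]; ring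
      rw [e]
      refine Dvd.dvd.mul_right ?_ _
      calc b ^ n = b ^ i * b ^ (n - i) := by rw [← pow_add]; congr 1; omega
        _ ∣ _ := mul_dvd_mul_right (h i) _
    refine krull_dvd ht fun n => ?_
    have : ∃ r s, a = b * r + t ^ n * s ∧ (∀ n : ℕ, b ^ n ∣ c * s ^ n) := by
      induction n with
      | zero => exact ⟨0, a, by simp, h⟩
      | succ n ih =>
        obtain ⟨r, s, h2, h3⟩ := ih
        obtain ⟨r', s', h4, h5⟩ := h1 s h3
        exact ⟨r + t ^ n * r', s', by rw [h2, h4]; ring, h5⟩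
    obtain ⟨r, s, h2, -⟩ := this
    exact ⟨r, s, h2⟩
  intro a b c hb hc h
  by_cases ha : a = 0
  · rw [ha]; exact dvd_zero _
  obtain ⟨i, a', rfl, ha'⟩ := krull_fac ht ha
  obtain ⟨j, b', rfl, hb'⟩ := krull_fac ht hb
  obtain ⟨k, c', rfl, hc'⟩ := krull_fac ht hc
  have e : ∀ n, t ^ k * c' * (t ^ i * a') ^ n = t ^ (k + i * n) * (c' * a' ^ n) := by intro n; rw [mul_pow, ← pow_mul, pow_add]; ring
  have hij : j ≤ i := by
    by_contra hh
    have h1 := h (k + 1)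
    rw [e] at h1
    have h2 : t ^ (k + i * (k + 1) + 1) ∣ t ^ (k + i * (k+1)) * (c' * a' ^ (k+1)) := by
      refine dvd_trans (pow_dvd_pow t (n := j * (k + 1)) ?_) (dvd_trans ?_ h1)
      · nlinarith
      · rw [mul_pow, ← pow_mul]; exact dvd_mul_right _ _
    rw [pow_succ, mul_dvd_mul_iff_left (pow_ne_zero _ htp.ne_zero)] at h2
    rcases htp.dvd_or_dvd h2 with h3 | h3
    · exact hc' h3
    · exact ha' (htp.dvd_of_dvd_pow h3)
  refine mul_dvd_mul (pow_dvd_pow t hij) (key a' b' c' hb' hc' fun n => pr_cancel htp hb' n (k + i * n) ?_)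
  rw [← e]
  exact dvd_trans (by rw [mul_pow]; exact dvd_mul_left _ _) (h n)

theorem dim_le_length [IsNoetherianRing B] [IsLocalRing B] (l : List B) (hl : Ideal.ofList l = IsLocalRing.maximalIdeal B) :
    ringKrullDim B ≤ (l.length : ℕ) := by
  classical
  refine (ringKrullDim_le_spanFinrank_maximalIdeal (R := B)).trans ?_
  rw [← hl]
  refine Nat.cast_le.2 ?_
  have h : {x | x ∈ l} = (l.toFinset : Set B) := by ext; simp
  refine (Submodule.spanFinrank_span_le_ncard_of_finite (by rw [h]; exact Finset.finite_toSet _)).trans ?_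
  rw [h, Set.ncard_coe_finset]
  exact List.toFinset_card_le l
end R1
end

section
section R2
open IsLocalRing

theorem ofList_map_max {B : Type*} [CommRing B] [IsLocalRing B] (I : Ideal B) [IsLocalRing (B ⧸ I)] (l : List B)
    (hl : I ⊔ Ideal.ofList l = maximalIdeal B) : Ideal.ofList (l.map (Ideal.Quotient.mk I)) = maximalIdeal (B ⧸ I) := by
  have h1 : (maximalIdeal B).map (Ideal.Quotient.mk I) = Ideal.ofList (l.map (Ideal.Quotient.mk I)) := by
    rw [← hl, Ideal.map_sup, Ideal.map_quotient_self, bot_sup_eq, Ideal.map_ofList]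
  rw [← h1]
  have h2 : IsLocalHom (Ideal.Quotient.mk I) := IsLocalHom.of_surjective _ Ideal.Quotient.mk_surjective
  apply le_antisymm
  · exact ((local_hom_TFAE (Ideal.Quotient.mk I)).out 0 2).1 h2
  · intro z hz
    obtain ⟨z, rfl⟩ := Ideal.Quotient.mk_surjective z
    exact Ideal.mem_map_of_mem _ (by
      rw [mem_maximalIdeal] at hz ⊢
      exact fun hu => hz (hu.map _))

theorem exists_prime_dim {B : Type*} [CommRing B] (n : ℕ) (h : (n : WithBot ℕ∞) ≤ ringKrullDim B) :
    ∃ Q : Ideal B, Q.IsPrime ∧ (n : WithBot ℕ∞) ≤ ringKrullDim (B ⧸ Q) := by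
  obtain ⟨c, hc⟩ := Order.le_krullDim_iff.1 h
  refine ⟨c.head.asIdeal, c.head.2, ?_⟩
  rw [ringKrullDim_quotient]
  refine Order.le_krullDim_iff.2 ⟨⟨c.length, fun i => ⟨c i, ?_⟩, fun i => ?_⟩, hc⟩
  · have : c.head ≤ c i := c.head_le i
    exact this
  · exact c.step i

theorem Reg (l : List ℕ) : ∀ (B : Type*) [CommRing B] [IsNoetherianRing B] [IsLocalRing B] (y : List B), y.length = l.length →
    Ideal.ofList y = maximalIdeal B → (y.length : WithBot ℕ∞) ≤ ringKrullDim B → IsDomain B ∧ WR ⊥ y ∧ CIC B := by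
  induction l with
  | nil =>
    intro B _ _ _ y hy hm hd
    obtain rfl := List.length_eq_zero_iff.1 hy
    have hm : maximalIdeal B = ⊥ := by rw [← hm]; simp
    have hF : IsField B := isField_iff_maximalIdeal_eq.2 hm
    refine ⟨hF.isDomain, trivial, fun a b c hb _ _ => ?_⟩
    obtain ⟨b', hb'⟩ := hF.mul_inv_cancel hb
    exact ⟨b' * a, by rw [← mul_assoc, hb', one_mul]⟩
  | cons n l ih =>
    intro B _ _ _ y hy hm hd
    obtain _ | ⟨t, y⟩ := y
    · simp at hy
    have hy : y.length = l.length := by simpa using hy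
    have ht : t ∈ maximalIdeal B := by rw [← hm]; exact Ideal.subset_span (by simp)
    have hm' : Ideal.span {t} ⊔ Ideal.ofList y = maximalIdeal B := by rw [← Ideal.ofList_cons]; exact hm
    have hyj : ∀ J : Ideal B, J ≤ maximalIdeal B → Nontrivial (B ⧸ J) := fun J hJ =>
      Ideal.Quotient.nontrivial_iff.2 (fun h => (Ideal.IsPrime.ne_top (I := maximalIdeal B) inferInstance) (top_le_iff.1 (h ▸ hJ)))
    have hloc : ∀ J : Ideal B, J ≤ maximalIdeal B → IsLocalRing (B ⧸ J) := fun J hJ =>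
      have := hyj J hJ
      IsLocalRing.of_surjective' (Ideal.Quotient.mk J) Ideal.Quotient.mk_surjective
    have hJt : Ideal.span {t} ≤ maximalIdeal B := by rwa [Ideal.span_singleton_le_iff_mem]
    have hL := hloc _ hJt
    have hmq := ofList_map_max (Ideal.span {t}) y hm'
    have hdrop : ∀ (C : Type _) [CommRing C] [IsNoetherianRing C] [IsLocalRing C] (s : C), s ∈ maximalIdeal C →
        ringKrullDim C ≤ ringKrullDim (C ⧸ Ideal.span {s}) + 1 := by
      intro C _ _ _ s hs
      have := ringKrullDim_le_ringKrullDim_quotient_add_encard (R := C) {s} (by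
        rw [Set.singleton_subset_iff]
        exact (IsLocalRing.ringJacobson_eq_maximalIdeal C).symm ▸ hs)
      simpa using this
    have hcancel : ∀ (m : ℕ) (z : WithBot ℕ∞), ((m + 1 : ℕ) : WithBot ℕ∞) ≤ z + 1 → (m : WithBot ℕ∞) ≤ z := by
      intro m z h
      induction z using WithBot.recBotCoe with
      | bot => rw [WithBot.bot_add] at h; exact absurd (le_bot_iff.1 h) (WithBot.natCast_ne_bot _)
      | coe e =>
        induction e using ENat.recTopCoe with
        | top => exact le_top
        | coe e => norm_cast at h ⊢; omega
    have hdq : (y.length : WithBot ℕ∞) ≤ ringKrullDim (B ⧸ Ideal.span {t}) := hcancel _ _ (hd.trans (hdrop B t ht))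
    obtain ⟨hD, hW, hC⟩ := ih (B ⧸ Ideal.span {t}) (y.map (Ideal.Quotient.mk _)) (by simpa using hy) hmq (by simpa using hdq)
    have htP : (Ideal.span {t}).IsPrime := (Ideal.Quotient.isDomain_iff_prime _).1 hD
    obtain ⟨Q, hQ, hQd⟩ := exists_prime_dim (y.length + 1) hd
    have hQm : Q ≤ maximalIdeal B := le_maximalIdeal hQ.ne_top
    have htQ : t ∉ Q := by
      intro htQ
      have := hloc Q hQm
      have h2 := dim_le_length (B := B ⧸ Q) (y.map (Ideal.Quotient.mk _)) (ofList_map_max Q y (by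
        apply le_antisymm
        · exact sup_le hQm (le_sup_right.trans hm'.le)
        · rw [← hm']; exact sup_le_sup_right (by rwa [Ideal.span_singleton_le_iff_mem]) _))
      have h3 := hQd.trans h2
      rw [List.length_map, Nat.cast_le] at h3
      omega
    have hQt : Q ≤ Ideal.span {t} := by
      intro q hq
      by_contra hqt
      have hle := sup_le hJt ((Ideal.span_singleton_le_iff_mem (I := maximalIdeal B)).2 (hQm hq))
      have h1 := ringKrullDim_quotient_succ_le_of_nonZeroDivisor (R := B ⧸ Ideal.span {t}) (r := Ideal.Quotient.mk _ q)
        (mem_nonZeroDivisors_of_ne_zero (by rwa [Ne, Ideal.Quotient.eq_zero_iff_mem]))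
      have h2 := dim_le_length _ hmq
      have := hloc Q hQm
      have h3 := hdrop (B ⧸ Q) (Ideal.Quotient.mk _ t) (by
        rw [mem_maximalIdeal, mem_nonunits_iff]
        intro hu
        obtain ⟨v, hv⟩ := hu.exists_right_inv
        obtain ⟨v, rfl⟩ := Ideal.Quotient.mk_surjective v
        rw [← map_mul, ← map_one (Ideal.Quotient.mk Q), Ideal.Quotient.eq] at hv
        have h4 := (maximalIdeal B).sub_mem ((maximalIdeal B).mul_mem_right v ht) (hQm hv)
        rw [sub_sub_cancel] at h4
        exact (Ideal.ne_top_iff_one _).1 (Ideal.IsPrime.ne_top inferInstance) h4)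
      have h4 := hcancel _ _ (hQd.trans h3)
      have h5 : ringKrullDim ((B ⧸ Q) ⧸ Ideal.span {Ideal.Quotient.mk Q t}) ≤
          ringKrullDim ((B ⧸ Ideal.span {t}) ⧸ Ideal.span {Ideal.Quotient.mk (Ideal.span {t}) q}) := by
        have hh1 : ∀ a ∈ Ideal.span {t}, ((Ideal.Quotient.mk (Ideal.span {Ideal.Quotient.mk Q t})).comp (Ideal.Quotient.mk Q)) a = 0 := by
          intro a ha
          obtain ⟨s, rfl⟩ := Ideal.mem_span_singleton.1 ha
          rw [RingHom.comp_apply, map_mul, Ideal.Quotient.eq_zero_iff_mem]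
          exact Ideal.mul_mem_right _ _ (Ideal.mem_span_singleton_self _)
        refine ringKrullDim_le_of_surjective (Ideal.Quotient.lift _ (Ideal.Quotient.lift _ ((Ideal.Quotient.mk _).comp (Ideal.Quotient.mk Q)) hh1) ?_) ?_
        · intro a ha
          obtain ⟨s, rfl⟩ := Ideal.mem_span_singleton.1 ha
          rw [map_mul, Ideal.Quotient.lift_mk, RingHom.comp_apply, Ideal.Quotient.eq_zero_iff_mem.2 hq, map_zero, zero_mul]
        · exact Ideal.Quotient.lift_surjective_of_surjective _ _ (Ideal.Quotient.lift_surjective_of_surjective _ _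
            (Ideal.Quotient.mk_surjective.comp Ideal.Quotient.mk_surjective))
      have h6 : ((y.length + 1 : ℕ) : WithBot ℕ∞) ≤ (y.length : ℕ) := by
        have h7 : ((y.length + 1 : ℕ) : WithBot ℕ∞) ≤ ringKrullDim ((B ⧸ Ideal.span {t}) ⧸ Ideal.span {Ideal.Quotient.mk (Ideal.span {t}) q}) + 1 := by
          push_cast
          exact add_le_add_left (h4.trans h5) 1
        have := (h7.trans h1).trans h2
        rwa [List.length_map] at this
      rw [Nat.cast_le] at h6
      omega
    have hQ0 : Q = ⊥ := by
      refine Submodule.eq_bot_of_le_smul_of_le_jacobson_bot (maximalIdeal B) Q (IsNoetherian.noetherian Q) ?_ ?_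
      · intro q hq
        obtain ⟨s, rfl⟩ := Ideal.mem_span_singleton.1 (hQt hq)
        exact Submodule.smul_mem_smul ht ((hQ.mem_or_mem hq).resolve_left htQ)
      · exact (IsLocalRing.jacobson_eq_maximalIdeal ⊥ bot_ne_top).ge
    subst hQ0
    have hBD : IsDomain B := IsDomain.of_bot_isPrime B
    have ht0 : t ≠ 0 := fun h => htQ (by rw [h]; exact Ideal.zero_mem _)
    refine ⟨hBD, ⟨?_, ?_⟩, CIC_step ht ((Ideal.span_singleton_prime ht0).1 htP) hC⟩
    · intro z hz
      exact Ideal.mem_bot.2 ((mul_eq_zero.1 (Ideal.mem_bot.1 hz)).resolve_left ht0)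
    · rw [WR_surj (Ideal.Quotient.mk (Ideal.span {t})) Ideal.Quotient.mk_surjective _ _ (by rw [Ideal.mk_ker]; exact le_sup_right)]
      rw [bot_sup_eq, Ideal.map_quotient_self]
      exact hW
end R2
end

section
section S1
open IsLocalRing

theorem adic_p {R : Type*} [CommRing R] [IsNoetherianRing R] [IsLocalRing R] [IsAdicComplete (maximalIdeal R) R] (q : R) (hq : q ∈ maximalIdeal R) :
    IsAdicComplete (Ideal.span {q}) R := by
  have hle : ∀ n, Ideal.span {q} ^ n ≤ maximalIdeal R ^ n := fun n => Ideal.pow_right_mono (by rwa [Ideal.span_singleton_le_iff_mem]) n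
  have h1 : IsHausdorff (Ideal.span {q}) R := IsHausdorff.of_isLocalRing _ _ (fun h =>
    (Ideal.IsPrime.ne_top (I := maximalIdeal R) inferInstance) (top_le_iff.1 (by rw [← h]; simpa using hle 1)))
  refine { haus' := h1.haus', prec' := ?_ }
  intro f hf
  simp only [smul_eq_mul, Ideal.mul_top, SModEq.sub_mem] at hf ⊢
  obtain ⟨L, hL⟩ := IsPrecomplete.prec' (I := maximalIdeal R) (M := R) f (fun {m n} hmn => by
    rw [SModEq.sub_mem, smul_eq_mul, Ideal.mul_top]; exact hle m (hf hmn))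
  simp only [smul_eq_mul, Ideal.mul_top, SModEq.sub_mem] at hL
  refine ⟨L, fun n => ?_⟩
  have h3 : IsHausdorff (maximalIdeal R) (R ⧸ Ideal.span {q} ^ n) := inferInstance
  have h4 := h3.haus' (Ideal.Quotient.mk _ (f n - L)) (fun j => by
    rw [SModEq.zero]
    have : Ideal.Quotient.mk (Ideal.span {q} ^ n) (f n - L) = (f (n + j) - L) • (1 : R ⧸ Ideal.span {q} ^ n) := by
      rw [Algebra.smul_def, mul_one, Ideal.Quotient.algebraMap_eq, Ideal.Quotient.eq]
      have := hf (Nat.le_add_right n j)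
      rwa [sub_sub_sub_cancel_right]
    rw [this]
    exact Submodule.smul_mem_smul (Ideal.pow_le_pow_right (Nat.le_add_left j n) (hL _)) trivial)
  rwa [Ideal.Quotient.eq_zero_iff_mem] at h4

theorem psLift {R W : Type*} [CommRing R] [CommRing W] (I : Ideal R) [IsAdicComplete I R] (w : W →+* R) {d : ℕ} (x : Fin d → R) (hx : ∀ i, x i ∈ I) :
    ∃ φ : MvPowerSeries (Fin d) W →+* R, (∀ a, φ (MvPowerSeries.C a) = w a) ∧ ∀ i, φ (MvPowerSeries.X i) = x i := by
  let _ : UniformSpace W := ⊥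
  have : DiscreteTopology W := ⟨rfl⟩
  let _ : TopologicalSpace R := I.adicTopology
  have hadic : IsAdic I := rfl
  have : IsTopologicalRing R := I.adic_basis.toRing_subgroups_basis.toRingFilterBasis.isTopologicalRing
  let _ : UniformSpace R := IsTopologicalAddGroup.rightUniformSpace R
  have : IsUniformAddGroup R := isUniformAddGroup_of_addCommGroup
  obtain ⟨_, _⟩ := (IsAdic.isAdicComplete_iff hadic).1 inferInstance
  have : IsLinearTopology R R := by
    apply IsLinearTopology.mk_of_hasBasis R hadic.hasBasis_nhds_zero
  have hc : Continuous w := continuous_of_discreteTopology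
  have he : MvPowerSeries.HasEval x := by
    refine ⟨fun i => ?_, ?_⟩
    · rw [IsTopologicallyNilpotent, hadic.hasBasis_nhds_zero.tendsto_right_iff]
      intro n _
      filter_upwards [Filter.eventually_ge_atTop n] with m hm
      exact Ideal.pow_le_pow_right hm (Ideal.pow_mem_pow (hx i) m)
    · rw [Filter.cofinite_eq_bot]; exact Filter.tendsto_bot
  refine ⟨MvPowerSeries.eval₂Hom hc he, fun a => ?_, fun i => ?_⟩
  · rw [MvPowerSeries.coe_eval₂Hom, MvPowerSeries.eval₂_C]
  · rw [MvPowerSeries.coe_eval₂Hom, MvPowerSeries.eval₂_X]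

theorem wittHom (p : ℕ) [Fact p.Prime] {R : Type*} [CommRing R] [IsNoetherianRing R] [IsLocalRing R] [IsAdicComplete (maximalIdeal R) R]
    [CharP (ResidueField R) p] [PerfectRing (ResidueField R) p] :
    ∃ w : WittVector p (ResidueField R) →+* R, ∀ z, residue R (w z) = z.coeff 0 := by
  have hpm : (p : R) ∈ maximalIdeal R := by
    rw [← residue_eq_zero_iff, map_natCast, CharP.cast_eq_zero]
  have := adic_p (p : R) hpm
  have : Fact (¬ IsUnit (p : R)) := ⟨by rwa [mem_maximalIdeal, mem_nonunits_iff] at hpm⟩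
  have : CharP (R ⧸ maximalIdeal R) p := ‹CharP (ResidueField R) p›
  let f : ModP R p →+* R ⧸ maximalIdeal R := Ideal.Quotient.factor (by rwa [Ideal.span_singleton_le_iff_mem])
  have hf : ∀ z, Perfection.map p f (Perfection.quotientMulEquiv p (Ideal.span {(p : R)}) z) = Perfection.quotientMulEquiv p (maximalIdeal R) z := by
    intro z
    ext n
    rw [Perfection.coeff_map, Perfection.coeff_quotientMulEquiv, Perfection.coeff_quotientMulEquiv]
    rfl
  have hb : Function.Bijective (Perfection.map p f) := by
    have : ⇑(Perfection.map p f) = Perfection.quotientMulEquiv p (maximalIdeal R) ∘ (Perfection.quotientMulEquiv p (Ideal.span {(p : R)})).symm := by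
      funext z
      rw [Function.comp_apply, ← hf, MulEquiv.apply_symm_apply]
    rw [this]
    exact (MulEquiv.bijective _).comp (MulEquiv.bijective _)
  have : PerfectRing (R ⧸ maximalIdeal R) p := ‹PerfectRing (ResidueField R) p›
  let σ : (R ⧸ maximalIdeal R) →+* Perfection (ModP R p) p := (RingEquiv.ofBijective _ hb).symm.toRingHom.comp (Perfection.lift p _ _ (RingHom.id _))
  have hσ : ∀ a, f (Perfection.coeff _ p 0 (σ a)) = a := by
    intro a
    rw [← Perfection.coeff_map]
    have : Perfection.map p f (σ a) = Perfection.lift p _ _ (RingHom.id _) a := (RingEquiv.ofBijective _ hb).apply_symm_apply _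
    rw [this]
    exact congrFun (congrArg DFunLike.coe ((Perfection.lift p (R ⧸ maximalIdeal R) (R ⧸ maximalIdeal R)).symm_apply_apply (RingHom.id _))) a
  refine ⟨(WittVector.fontaineTheta R p).comp (WittVector.map σ), fun z => ?_⟩
  have h1 := WittVector.mk_fontaineTheta (R := R) (p := p) (WittVector.map σ z)
  have h2 := congrArg f h1
  exact h2.trans (hσ (z.coeff 0))
end S1
end

section
section S2
open MvPowerSeries

theorem psFrob_k (p : ℕ) [hp : Fact p.Prime] {k : Type*} [Field k] [CharP k p] [PerfectRing k p] {d : ℕ} (g : MvPowerSeries (Fin d) k) :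
    ∃ h : (Fin d → Fin p) → MvPowerSeries (Fin d) k,
      g = ∑ J, monomial (Finsupp.equivFunOnFinite.symm (fun i => (J i : ℕ))) (1 : k) * h J ^ p := by
  classical
  have hp0 : p ≠ 0 := hp.out.ne_zero
  obtain ⟨h, hh⟩ : ∃ h : (Fin d → Fin p) → MvPowerSeries (Fin d) k, ∀ J I, coeff I (h J) =
      (frobeniusEquiv k p).symm (coeff (p • I + Finsupp.equivFunOnFinite.symm (fun i => (J i : ℕ))) g) :=
    ⟨fun J I => (frobeniusEquiv k p).symm (coeff (p • I + Finsupp.equivFunOnFinite.symm (fun i => (J i : ℕ))) g), fun _ _ => rfl⟩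
  refine ⟨h, ?_⟩
  ext e
  rw [map_sum]
  have hJ0 : ∀ i, e i % p < p := fun i => Nat.mod_lt _ hp.out.pos
  rw [Finset.sum_eq_single (fun i => (⟨e i % p, hJ0 i⟩ : Fin p))]
  · rw [coeff_monomial_mul, if_pos (by intro i; simp [Nat.mod_le]), one_mul, ← map_frobenius_expand p hp0]
    have he : e - Finsupp.equivFunOnFinite.symm (fun i => e i % p) = p • Finsupp.equivFunOnFinite.symm (fun i => e i / p) := by
      ext i
      have := Nat.div_add_mod (e i) p
      simp only [Finsupp.coe_tsub, Pi.sub_apply, Finsupp.coe_equivFunOnFinite_symm, Finsupp.smul_apply, smul_eq_mul]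
      omega
    rw [coeff_map, he, coeff_expand_smul]
    rw [hh, frobenius_apply_frobeniusEquiv_symm, ← he, tsub_add_cancel_of_le (by intro i; simp [Nat.mod_le])]
  · intro J _ hJ
    rw [coeff_monomial_mul]
    split_ifs with hle
    · rw [one_mul, ← map_frobenius_expand p hp0, coeff_map]
      have : ∃ i, ¬ p ∣ (e - Finsupp.equivFunOnFinite.symm (fun i => (J i : ℕ))) i := by
        by_contra! hh
        apply hJ
        funext i
        apply Fin.ext
        have h1 := hh i
        have h2 := hle i
        simp only [Finsupp.coe_tsub, Pi.sub_apply, Finsupp.coe_equivFunOnFinite_symm] at h1 h2 ⊢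
        have h3 := (Nat.modEq_iff_dvd' h2).2 h1
        rw [← Nat.mod_eq_of_lt (J i).2]; exact h3
      obtain ⟨i, hi⟩ := this
      rw [coeff_expand_of_not_dvd p hp0 _ hi, map_zero]
    · rfl
  · intro h; exact absurd (Finset.mem_univ _) h

theorem psFrob (p : ℕ) [hp : Fact p.Prime] {k W : Type*} [CommRing W] [Field k] [CharP k p] [PerfectRing k p] (r : W →+* k) (hr : Function.Surjective r)
    (hk : ∀ w, r w = 0 → ∃ w', w = p * w') {d : ℕ} (G : MvPowerSeries (Fin d) W) :
    ∃ (H : (Fin d → Fin p) → MvPowerSeries (Fin d) W) (G' : MvPowerSeries (Fin d) W),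
      G = ∑ J, (∏ i, X i ^ (J i : ℕ)) * H J ^ p + p * G' := by
  obtain ⟨h, hh⟩ := psFrob_k p (G.map r)
  choose s hs using hr
  let H : (Fin d → Fin p) → MvPowerSeries (Fin d) W := fun J I => s (coeff I (h J))
  have hH : ∀ J, (H J).map r = h J := by
    intro J; ext I
    rw [coeff_map]; exact hs _
  have hX : ∀ J : Fin d → Fin p, (∏ i, (X i : MvPowerSeries (Fin d) W) ^ (J i : ℕ)) = monomial (Finsupp.equivFunOnFinite.symm (fun i => (J i : ℕ))) 1 := by
    intro J
    rw [monomial_eq', Finsupp.prod_fintype _ _ (by simp)]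
    simp
  have h0 : (G - ∑ J, (∏ i, X i ^ (J i : ℕ)) * H J ^ p).map r = 0 := by
    rw [map_sub, hh, map_sum, sub_eq_zero]
    refine Finset.sum_congr rfl fun J _ => ?_
    rw [hX, map_mul, map_pow, hH, map_monomial, map_one r]
  have h1 : ∀ I, ∃ w', coeff I (G - ∑ J, (∏ i, X i ^ (J i : ℕ)) * H J ^ p) = (p : W) * w' := fun I => hk _ (by
    rw [← coeff_map, h0, coeff_zero])
  choose G' hG' using h1
  refine ⟨H, G', ?_⟩
  rw [← sub_eq_iff_eq_add']
  ext I
  have h2 : ∀ F : MvPowerSeries (Fin d) W, coeff I ((p : MvPowerSeries (Fin d) W) * F) = (p : W) * coeff I F := by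
    intro F
    rw [← map_natCast (C : W →+* MvPowerSeries (Fin d) W), coeff_C_mul]
  exact (hG' I).trans (h2 G').symm
end S2
end

section
section S3
open IsLocalRing

theorem ps_span {W : Type*} [CommRing W] {d : ℕ} (hd : 0 < d) (G : MvPowerSeries (Fin d) W) :
    ∃ H : Fin d → MvPowerSeries (Fin d) W, G = MvPowerSeries.C (MvPowerSeries.constantCoeff G) + ∑ i, MvPowerSeries.X i * H i := by
  classical
  have hF : ∀ I : Fin d →₀ ℕ, I ≠ 0 → ∃ i, I i ≠ 0 := by
    intro I hI; by_contra! h; exact hI (Finsupp.ext h)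
  have : Nonempty (Fin d) := ⟨⟨0, hd⟩⟩
  choose! F hF using hF
  obtain ⟨H, hH⟩ : ∃ H : Fin d → MvPowerSeries (Fin d) W, ∀ i I, MvPowerSeries.coeff I (H i) =
      if F (I + Finsupp.single i 1) = i then MvPowerSeries.coeff (I + Finsupp.single i 1) G else 0 :=
    ⟨fun i I => if F (I + Finsupp.single i 1) = i then MvPowerSeries.coeff (I + Finsupp.single i 1) G else 0, fun _ _ => rfl⟩
  refine ⟨H, ?_⟩
  ext I
  rw [map_add, map_sum, MvPowerSeries.coeff_C]
  have h1 : ∀ i, MvPowerSeries.coeff I (MvPowerSeries.X i * H i) = if Finsupp.single i 1 ≤ I then (if F I = i then MvPowerSeries.coeff I G else 0) else 0 := by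
    intro i
    rw [MvPowerSeries.X, MvPowerSeries.coeff_monomial_mul]
    split_ifs with h2 h3 h3
    · rw [one_mul, hH, tsub_add_cancel_of_le h2, if_pos h3]
    · rw [one_mul, hH, tsub_add_cancel_of_le h2, if_neg h3]
    · rfl
  simp_rw [h1]
  by_cases h0 : I = 0
  · subst h0
    rw [if_pos rfl, MvPowerSeries.coeff_zero_eq_constantCoeff, Finset.sum_eq_zero, add_zero]
    intro i _
    rw [if_neg]
    intro h; have := h i; simp at this
  · rw [if_neg h0, zero_add, Finset.sum_eq_single (F I)]
    · rw [if_pos, if_pos rfl]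
      rw [Finsupp.single_le_iff]; exact Nat.one_le_iff_ne_zero.2 (hF I h0)
    · intro j _ hj
      rw [if_neg (Ne.symm hj)]; split_ifs <;> rfl
    · intro h; exact absurd (Finset.mem_univ _) h

theorem prec_pi {S : Type*} [CommRing S] (I : Ideal S) [IsPrecomplete I S] (n : ℕ) : IsPrecomplete I (Fin n → S) := by
  refine ⟨fun f hf => ?_⟩
  have h1 : ∀ i, ∃ L, ∀ n, f n i - L ∈ I ^ n := by
    intro i
    obtain ⟨L, hL⟩ := IsPrecomplete.prec' (I := I) (M := S) (fun n => f n i) (fun {a b} hab => by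
      have h2 := hf hab
      rw [SModEq.sub_mem] at h2 ⊢
      have h3 := Submodule.mem_map_of_mem (f := LinearMap.proj (R := S) (φ := fun _ : Fin n => S) i) h2
      rw [Submodule.map_smul''] at h3
      exact Submodule.smul_mono le_rfl le_top h3)
    exact ⟨L, fun n => by have := hL n; rwa [SModEq.sub_mem, smul_eq_mul, Ideal.mul_top] at this⟩
  choose L hL using h1
  refine ⟨L, fun m => ?_⟩
  rw [SModEq.sub_mem, pi_eq_sum_univ' (f m - L)]
  exact Submodule.sum_mem _ fun i _ => Submodule.smul_mem_smul (hL i m) trivial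

theorem fin_mod {S R : Type*} [CommRing S] [CommRing R] [IsNoetherianRing R] [IsLocalRing R] [Algebra S R]
    (hres : ∀ r : R, ∃ s : S, r - algebraMap S R s ∈ maximalIdeal R) (I : Ideal S) [IsAdicComplete I S] (hI1 : I.map (algebraMap S R) ≤ maximalIdeal R)
    (hI2 : maximalIdeal R ≤ (I.map (algebraMap S R)).radical) : Module.Finite S R := by
  obtain ⟨N, hN⟩ := Ideal.exists_pow_le_of_le_radical_of_fg hI2 (IsNoetherian.noetherian _)
  have key : ∀ j : ℕ, ∃ s : Finset R, ∀ r : R, ∃ u ∈ Submodule.span S (s : Set R), r - u ∈ maximalIdeal R ^ j := by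
    classical
    intro j
    induction j with
    | zero => exact ⟨∅, fun r => ⟨0, Submodule.zero_mem _, by simp⟩⟩
    | succ j ih =>
      obtain ⟨s, hs⟩ := ih
      obtain ⟨t, ht⟩ := IsNoetherian.noetherian (maximalIdeal R ^ j)
      refine ⟨s ∪ t, fun r => ?_⟩
      obtain ⟨u, hu, hru⟩ := hs r
      have h1 : ∀ v ∈ Submodule.span R (t : Set R), ∃ u ∈ Submodule.span S ((s ∪ t : Finset R) : Set R), v - u ∈ maximalIdeal R ^ (j + 1) := by
        intro v hv
        induction hv using Submodule.span_induction with
        | mem x hx => exact ⟨x, Submodule.subset_span (by simp [show x ∈ t from hx]), by simp⟩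
        | zero => exact ⟨0, Submodule.zero_mem _, by simp⟩
        | add x y _ _ hx hy =>
          obtain ⟨a, ha, ha'⟩ := hx
          obtain ⟨b, hb, hb'⟩ := hy
          exact ⟨a + b, Submodule.add_mem _ ha hb, by rw [add_sub_add_comm]; exact Ideal.add_mem _ ha' hb'⟩
        | smul c x hx' hx =>
          obtain ⟨a, ha, ha'⟩ := hx
          obtain ⟨e, he⟩ := hres c
          refine ⟨e • a, Submodule.smul_mem _ _ ha, ?_⟩
          rw [smul_eq_mul, Algebra.smul_def, show c * x - algebraMap S R e * a = (c - algebraMap S R e) * x + algebraMap S R e * (x - a) by ring]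
          refine Ideal.add_mem _ ?_ (Ideal.mul_mem_left _ _ ha')
          rw [pow_succ']
          exact Ideal.mul_mem_mul he (by rw [← ht]; exact hx')
      obtain ⟨u', hu', hru'⟩ := h1 (r - u) (by rw [ht]; exact hru)
      refine ⟨u + u', Submodule.add_mem _ (Submodule.span_mono (by simp) hu) hu', by rwa [← sub_sub]⟩
  obtain ⟨s, hs⟩ := key N
  have := prec_pi I s.card
  have hsm : ∀ n, (I ^ n • (⊤ : Submodule S R)) = ((I.map (algebraMap S R)) ^ n).restrictScalars S := by
    intro n
    rw [← Ideal.map_pow, ← Ideal.smul_top_eq_map]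
  have hH : IsHausdorff I R := ⟨fun r hr => (inferInstance : IsHausdorff (maximalIdeal R) R).haus' r (fun n => by
    have := hr n
    rw [SModEq.zero, hsm] at this
    rw [SModEq.zero, smul_eq_mul, Ideal.mul_top]
    exact Ideal.pow_right_mono hI1 n this)⟩
  let f : (Fin s.card → S) →ₗ[S] R := Fintype.linearCombination S (fun i => (s.equivFin.symm i : R))
  have hf : Function.Surjective f := by
    apply surjective_of_mkQ_comp_surjective (I := I)
    intro r
    obtain ⟨r, rfl⟩ := Submodule.mkQ_surjective _ r
    obtain ⟨u, hu, hru⟩ := hs r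
    have hr : Set.range (fun i => (s.equivFin.symm i : R)) = (s : Set R) := by
      ext z; constructor
      · rintro ⟨i, rfl⟩; exact (s.equivFin.symm i).2
      · intro hz; exact ⟨s.equivFin ⟨z, hz⟩, by simp⟩
    rw [← hr, ← Fintype.range_linearCombination] at hu
    obtain ⟨v, rfl⟩ := hu
    refine ⟨v, ?_⟩
    rw [LinearMap.comp_apply, ← sub_eq_zero, ← map_sub, Submodule.mkQ_apply, Submodule.Quotient.mk_eq_zero]
    rw [← neg_sub]
    refine Submodule.neg_mem _ ?_
    have h5 := hsm 1
    rw [pow_one, pow_one] at h5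
    rw [h5]
    exact hN hru
  exact Module.Finite.of_surjective f hf

theorem exists_base (p : ℕ) [hp : Fact p.Prime] {R : Type*} [CommRing R] [IsNoetherianRing R] [IsLocalRing R] [IsAdicComplete (maximalIdeal R) R]
    [CharP (ResidueField R) p] [PerfectRing (ResidueField R) p] {d : ℕ} (hd0 : 0 < d) (x : Fin d → R) (hx0 : x ⟨0, hd0⟩ = (p : R))
    (hsop₁ : Ideal.span (Set.range x) ≤ maximalIdeal R) (hsop₂ : maximalIdeal R ≤ (Ideal.span (Set.range x)).radical) :
    ∃ A₀ : Subring R, IsNoetherianRing A₀ ∧ (∀ r : R, IsIntegral A₀ r) ∧ (∃ S : Finset R, ∀ r, r ∈ Algebra.adjoin A₀ (S : Set R)) ∧ (∀ i, x i ∈ A₀) ∧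
      (∀ a ∈ A₀, a ∈ maximalIdeal R → ∃ c : Fin d → R, (∀ i, c i ∈ A₀) ∧ a = ∑ i, x i * c i) ∧
      (∀ a ∈ A₀, ∃ h : (Fin d → Fin p) → R, (∀ J, h J ∈ A₀) ∧ ∃ c ∈ A₀, a = ∑ J, (∏ i, x i ^ (J i : ℕ)) * h J ^ p + p * c) := by
  obtain ⟨w, hw⟩ := wittHom p (R := R)
  have hx : ∀ i, x i ∈ maximalIdeal R := fun i => hsop₁ (Ideal.subset_span ⟨i, rfl⟩)
  obtain ⟨φ, hφC, hφX⟩ := psLift (maximalIdeal R) w x hx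
  have hφs : ∀ H : Fin d → MvPowerSeries (Fin d) (WittVector p (ResidueField R)), φ (∑ i, MvPowerSeries.X i * H i) = ∑ i, x i * φ (H i) := by
    intro H; rw [map_sum]; exact Finset.sum_congr rfl fun i _ => by rw [map_mul, hφX]
  have hsm : ∀ c : Fin d → R, ∑ i, x i * c i ∈ maximalIdeal R := fun c => Ideal.sum_mem _ fun i _ => Ideal.mul_mem_right _ _ (hx i)
  have hspan : Ideal.map φ (Ideal.span (Set.range MvPowerSeries.X)) = Ideal.span (Set.range x) := by
    rw [Ideal.map_span, ← Set.range_comp]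
    congr 2; funext i; exact hφX i
  let _ : Algebra (MvPowerSeries (Fin d) (WittVector p (ResidueField R))) R := φ.toAlgebra
  have hfin : Module.Finite (MvPowerSeries (Fin d) (WittVector p (ResidueField R))) R := by
    refine fin_mod (fun r => ?_) (Ideal.span (Set.range MvPowerSeries.X)) ?_ ?_
    · refine ⟨MvPowerSeries.C (WittVector.teichmuller p (residue R r)), ?_⟩
      rw [← residue_eq_zero_iff, map_sub, sub_eq_zero, RingHom.algebraMap_toAlgebra, hφC, hw, WittVector.teichmuller_coeff_zero]
    · rw [RingHom.algebraMap_toAlgebra, hspan]; exact hsop₁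
    · rw [RingHom.algebraMap_toAlgebra, hspan]; exact hsop₂
  refine ⟨φ.range, ?_, ?_, ?_, fun i => ⟨_, hφX i⟩, ?_, ?_⟩
  · exact isNoetherianRing_of_surjective _ _ φ.rangeRestrict φ.rangeRestrict_surjective
  · intro r
    obtain ⟨P, hP, hP'⟩ := Algebra.IsIntegral.isIntegral (R := MvPowerSeries (Fin d) (WittVector p (ResidueField R))) r
    refine ⟨P.map φ.rangeRestrict, hP.map _, ?_⟩
    rw [Polynomial.eval₂_map]
    exact hP'
  · obtain ⟨S, hS⟩ := hfin.fg_top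
    refine ⟨S, fun r => ?_⟩
    have hr : r ∈ Submodule.span (MvPowerSeries (Fin d) (WittVector p (ResidueField R))) (S : Set R) := by rw [hS]; trivial
    induction hr using Submodule.span_induction with
    | mem z hz => exact Algebra.subset_adjoin hz
    | zero => exact Subalgebra.zero_mem _
    | add _ _ _ _ h1 h2 => exact Subalgebra.add_mem _ h1 h2
    | smul c _ _ h1 =>
      rw [Algebra.smul_def]
      exact Subalgebra.mul_mem _ (Subalgebra.algebraMap_mem _ (⟨φ c, c, rfl⟩ : φ.range)) h1
  · rintro a ⟨G, rfl⟩ ha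
    obtain ⟨H, hH⟩ := ps_span hd0 G
    have h1 : φ G = w (MvPowerSeries.constantCoeff G) + ∑ i, x i * φ (H i) := by
      conv_lhs => rw [hH, map_add, hφC, hφs]
    have h2 : (MvPowerSeries.constantCoeff G).coeff 0 = 0 := by
      rw [← hw, residue_eq_zero_iff]
      have := Ideal.sub_mem _ ha (hsm fun i => φ (H i))
      rwa [h1, add_sub_cancel_right] at this
    rw [← WittVector.mem_span_p_iff_coeff_zero_eq_zero, Ideal.mem_span_singleton] at h2
    obtain ⟨w', hw'⟩ := h2
    refine ⟨fun i => φ (H i) + (if i = ⟨0, hd0⟩ then w w' else 0), fun i => ?_, ?_⟩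
    · refine Subring.add_mem _ ⟨_, rfl⟩ ?_
      split_ifs
      · exact ⟨MvPowerSeries.C w', hφC _⟩
      · exact Subring.zero_mem _
    · rw [h1, hw', map_mul, map_natCast, ← hx0, add_comm]
      simp only [mul_add, Finset.sum_add_distrib, mul_ite, mul_zero, Finset.sum_ite_eq', Finset.mem_univ, if_true]
  · rintro a ⟨G, rfl⟩
    obtain ⟨H, G', hG⟩ := psFrob p (WittVector.constantCoeff (p := p) (R := ResidueField R))
      (fun a => ⟨WittVector.teichmuller p a, WittVector.teichmuller_coeff_zero p a⟩)
      (fun w hw => by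
        have : w.coeff 0 = 0 := hw
        rwa [← WittVector.mem_span_p_iff_coeff_zero_eq_zero, Ideal.mem_span_singleton] at this) G
    refine ⟨fun J => φ (H J), fun J => ⟨_, rfl⟩, φ G', ⟨_, rfl⟩, ?_⟩
    conv_lhs => rw [hG]
    simp only [map_add, map_sum, map_mul, map_prod, map_pow, hφX, map_natCast]
end S3
end

section
section T1
theorem dim_le₁ {A B : Type*} [CommRing A] [CommRing B] [Algebra A B] [Algebra.IsIntegral A B] : ringKrullDim B ≤ ringKrullDim A :=
  Order.krullDim_le_of_strictMono (PrimeSpectrum.comap (algebraMap A B)) fun _ _ h => Ideal.IsIntegral.comap_lt_comap h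

theorem dim_le₂ {A B : Type*} [CommRing A] [CommRing B] [Algebra A B] [Algebra.IsIntegral A B] [FaithfulSMul A B] (n : ℕ)
    (h : (n : WithBot ℕ∞) ≤ ringKrullDim A) : (n : WithBot ℕ∞) ≤ ringKrullDim B := by
  obtain ⟨l, hl⟩ := Order.le_krullDim_iff.1 h
  obtain ⟨Q, -, h1, h2⟩ := Ideal.exists_ideal_over_prime_of_isIntegral l.head.asIdeal (⊥ : Ideal B) (by
    rw [show Ideal.comap (algebraMap A B) ⊥ = ⊥ from (RingHom.injective_iff_ker_eq_bot _).1 (FaithfulSMul.algebraMap_injective A B)]; exact bot_le)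
  have : Q.LiesOver l.head.asIdeal := ⟨h2.symm⟩
  obtain ⟨L, hL, -⟩ := Ideal.exists_ltSeries_of_hasGoingUp l Q
  exact Order.le_krullDim_iff.2 ⟨L, hL.trans hl⟩

theorem WR_ofFn {Q : Type*} [CommRing Q] {d : ℕ} (f : Fin d → Q) :
    WR ⊥ (List.ofFn f) ↔ ∀ i : Fin d, NZ (Ideal.span (f '' {k : Fin d | (k : ℕ) < i})) (f i) := by
  have hI : ∀ i : ℕ, Ideal.ofList ((List.ofFn f).take i) = Ideal.span (f '' {k : Fin d | (k : ℕ) < i}) := by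
    intro i
    unfold Ideal.ofList
    congr 1
    ext z
    simp only [Set.mem_ofPred_eq, List.mem_take_iff_getElem, Set.mem_image, List.getElem_ofFn]
    constructor
    · rintro ⟨j, hj, rfl⟩; exact ⟨_, (lt_min_iff.1 hj).1, rfl⟩
    · rintro ⟨k, hk, rfl⟩; exact ⟨k, by simp [hk], rfl⟩
  rw [WR_iff]
  constructor
  · intro h i
    have := h ((List.ofFn f).take i) (f i) ((List.ofFn f).drop (i + 1)) (by
      conv_lhs => rw [← List.take_append_drop i (List.ofFn f), List.drop_eq_getElem_cons (by simp)]
      simp)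
    rwa [hI, bot_sup_eq] at this
  · intro h l₁ a l₂ hl
    have h1 : l₁.length < d := by have := congrArg List.length hl; simp at this; lia
    have h2 : l₁ = (List.ofFn f).take l₁.length := by rw [hl]; simp
    have h3 : a = f ⟨l₁.length, h1⟩ := by
      have : (List.ofFn f)[l₁.length]'(by simpa using h1) = a := by simp [hl]
      rw [← this]; simp
    rw [bot_sup_eq, h2, hI, h3]; exact h ⟨_, h1⟩

theorem level {Ω : Type*} [Field Ω] (B Rp : Subring Ω) [IsNoetherianRing B] (hint : ∀ z ∈ Rp, IsIntegral B z) {d : ℕ}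
    (hdim : (d : WithBot ℕ∞) ≤ ringKrullDim Rp) (x y : Fin d → Ω) (N : ℕ) (hyx : ∀ i, y i ^ N = x i) (hx : ∀ i, x i ∈ B)
    (hmax : ∀ a ∈ B, (a ≠ 0 ∧ a⁻¹ ∈ B) ∨ ∃ c : Fin d → Ω, (∀ i, c i ∈ B) ∧ a = ∑ i, x i * c i)
    (Q : Ideal Rp) [hQ : Q.IsPrime] (hxQ : ∀ z : Rp, ∀ i, (z : Ω) = x i → z ∈ Q) (hyR : ∀ i, y i ∈ Rp)
    (hBR : B ≤ Rp) (A : Subalgebra B Ω) (hA : Algebra.adjoin B (Set.range y) = A) (y' : Fin d → A) (hy' : ∀ i, (y' i : Ω) = y i) (x' : Fin d → A) (hx' : ∀ i, (x' i : Ω) = x i) :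
    (∀ i : Fin d, NZ (Ideal.span (x' '' {k : Fin d | (k : ℕ) < i})) (x' i)) ∧ CIC A := by
  have hAR : ∀ z ∈ A, z ∈ Rp := by
    intro z hz
    rw [← hA] at hz
    induction hz using Algebra.adjoin_induction with
    | mem z hz => obtain ⟨i, rfl⟩ := hz; exact hyR i
    | algebraMap r => exact hBR r.2
    | add _ _ _ _ h1 h2 => exact Rp.add_mem h1 h2
    | mul _ _ _ _ h1 h2 => exact Rp.mul_mem h1 h2
  have hno : IsNoetherianRing A := by
    have : Algebra.FiniteType B A := (Subalgebra.fg_iff_finiteType _).1 ⟨(Set.finite_range y).toFinset, by simpa using hA⟩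
    exact Algebra.FiniteType.isNoetherianRing B A
  have hAint : Algebra.IsIntegral B A := ⟨fun z => (isIntegral_algHom_iff A.val Subtype.val_injective).1 (hint _ (hAR z z.2))⟩
  set J : Ideal A := Ideal.span (Set.range y') with hJ
  have hxy : ∀ i, x' i = y' i ^ N := fun i => Subtype.ext (by rw [hx', ← hyx]; simp [hy'])
  let φ : A →+* Rp := Subring.inclusion (show A.toSubring ≤ Rp from hAR)
  let P := Q.comap φ
  have hP : P.IsPrime := Ideal.comap_isPrime _ _
  have hxP : ∀ i, x' i ∈ P := fun i => hxQ _ i (hx' i)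
  have hyP : ∀ i, y' i ∈ P := fun i => hP.mem_of_pow_mem N (by rw [← hxy]; exact hxP i)
  have hJP : J ≤ P := Ideal.span_le.2 (by rintro _ ⟨i, rfl⟩; exact hyP i)
  have hdec : ∀ z : A, ∃ b : B, z - algebraMap B A b ∈ J := by
    suffices h : ∀ z ∈ Algebra.adjoin B (Set.range y), ∃ b : B, ∀ hz : z ∈ A, (⟨z, hz⟩ - algebraMap B A b : A) ∈ J by
      intro z; obtain ⟨b, hb⟩ := h z (hA ▸ z.2); exact ⟨b, hb z.2⟩
    intro z hz
    induction hz using Algebra.adjoin_induction with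
    | mem z hz =>
      obtain ⟨i, rfl⟩ := hz
      refine ⟨0, fun hz => ?_⟩
      rw [map_zero, sub_zero]
      exact Ideal.subset_span ⟨i, Subtype.ext (hy' i)⟩
    | algebraMap r => exact ⟨r, fun _ => by convert J.zero_mem; exact sub_self _⟩
    | add z w hz hw h1 h2 =>
      obtain ⟨a, ha⟩ := h1; obtain ⟨b, hb⟩ := h2
      have ha := ha (hA ▸ hz); have hb := hb (hA ▸ hw)
      refine ⟨a + b, fun _ => ?_⟩
      convert J.add_mem ha hb using 1
      rw [map_add, ← add_sub_add_comm]; rfl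
    | mul z w hz hw h1 h2 =>
      obtain ⟨a, ha⟩ := h1; obtain ⟨b, hb⟩ := h2
      rw [hA] at hz hw
      have ha := ha hz; have hb := hb hw
      refine ⟨a * b, fun _ => ?_⟩
      convert J.add_mem (J.mul_mem_right ⟨w, hw⟩ ha) (J.mul_mem_left (algebraMap B A a) hb) using 1
      rw [map_mul, show (⟨z * w, _⟩ : A) = ⟨z, hz⟩ * ⟨w, hw⟩ from rfl]; ring
  have hyN : ∀ i : Fin d, N ≠ 0 := by
    rintro i rfl
    have := hxP i; rw [hxy, pow_zero] at this
    exact hP.ne_top ((Ideal.eq_top_iff_one _).2 this)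
  have hBx : ∀ b : B, ¬ IsUnit b → ∃ c : Fin d → B, b = ∑ i, ⟨x i, hx i⟩ * c i := by
    intro b hb
    rcases hmax b b.2 with ⟨h1, h2⟩ | ⟨c, hc, h⟩
    · exact absurd (IsUnit.of_mul_eq_one ⟨_, h2⟩ (Subtype.ext (mul_inv_cancel₀ h1))) hb
    · refine ⟨fun i => ⟨c i, hc i⟩, Subtype.ext ?_⟩
      rw [h]; simp
  have hBJ : ∀ c : Fin d → B, algebraMap B A (∑ i, ⟨x i, hx i⟩ * c i) ∈ J := by
    intro c
    rw [map_sum]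
    refine J.sum_mem fun i _ => ?_
    rw [map_mul]
    refine J.mul_mem_right _ ?_
    rw [show algebraMap B A ⟨x i, hx i⟩ = x' i from Subtype.ext (hx' i).symm, hxy]
    exact Ideal.pow_mem_of_mem J (Ideal.subset_span (Set.mem_range_self i)) _ (Nat.pos_of_ne_zero (hyN i))
  have hun : ∀ z : A, z ∉ J → IsUnit z := by
    intro z hz
    by_contra hu
    obtain ⟨n, hn, hzn⟩ := exists_max_ideal_of_mem_nonunits hu
    have hq : (n.comap (algebraMap B A)).IsMaximal := Ideal.isMaximal_comap_of_isIntegral_of_isMaximal n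
    have hqn : ∀ b : B, algebraMap B A b ∈ n → ¬ IsUnit b := fun b hb h => hq.ne_top (Ideal.eq_top_of_isUnit_mem _ hb h)
    have hyn : ∀ i, y' i ∈ n := by
      intro i
      apply hn.isPrime.mem_of_pow_mem N
      by_contra hc
      rw [← hxy, show x' i = algebraMap B A ⟨x i, hx i⟩ from Subtype.ext (hx' i)] at hc
      obtain ⟨e, b, hb, heb⟩ := Ideal.IsMaximal.exists_inv hq hc
      obtain ⟨c, hc'⟩ := hBx b (hqn b hb)
      have h1 : (1 : A) ∈ P := by
        rw [← map_one (algebraMap B A), ← heb, map_add, hc', map_mul]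
        refine P.add_mem (P.mul_mem_left _ ?_) (hJP (hBJ c))
        rw [show algebraMap B A ⟨x i, hx i⟩ = x' i from Subtype.ext (hx' i).symm]; exact hxP i
      exact hP.ne_top ((Ideal.eq_top_iff_one _).2 h1)
    have hJn : J ≤ n := Ideal.span_le.2 (by rintro _ ⟨i, rfl⟩; exact hyn i)
    obtain ⟨b, hb⟩ := hdec z
    have hbn : algebraMap B A b ∈ n := by
      have := n.sub_mem hzn (hJn hb); rwa [sub_sub_cancel] at this
    obtain ⟨c, hc⟩ := hBx b (hqn b hbn)
    apply hz
    have h3 := J.add_mem hb (hBJ c)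
    rw [← hc, sub_add_cancel] at h3
    exact h3
  have hPu : ∀ z ∈ P, ¬ IsUnit z := fun z hz h => hP.ne_top (Ideal.eq_top_of_isUnit_mem _ hz h)
  have hloc : IsLocalRing A := by
    refine IsLocalRing.of_nonunits_add fun a b ha hb => ?_
    have ha' : a ∈ J := by by_contra h; exact ha (hun a h)
    have hb' : b ∈ J := by by_contra h; exact hb (hun b h)
    exact hPu _ (hJP (J.add_mem ha' hb'))
  have hJm : Ideal.ofList (List.ofFn y') = IsLocalRing.maximalIdeal A := by
    have : Ideal.ofList (List.ofFn y') = J := by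
      unfold Ideal.ofList; congr 1; ext z; simp [List.mem_ofFn]
    rw [this]
    apply le_antisymm
    · intro z hz; exact hPu z (hJP hz)
    · intro z hz; by_contra h; exact hz (hun z h)
  let _ : Algebra A Rp := φ.toAlgebra
  have hRint : Algebra.IsIntegral A Rp := ⟨fun z => by
    obtain ⟨F, hF, hF'⟩ := hint z z.2
    refine ⟨F.map (algebraMap B A), hF.map _, Subtype.ext ?_⟩
    rw [Polynomial.eval₂_map, ← Rp.coe_subtype, Polynomial.hom_eval₂]
    exact hF'⟩
  have hdA : ((List.ofFn y').length : WithBot ℕ∞) ≤ ringKrullDim A := by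
    rw [List.length_ofFn]; exact hdim.trans dim_le₁
  obtain ⟨-, h1, h2⟩ := Reg (List.replicate d 0) A (List.ofFn y') (by simp) hJm hdA
  refine ⟨?_, h2⟩
  rw [← WR_ofFn]
  have := h1.pow N
  rwa [List.map_ofFn, show ((fun z : A => z ^ N) ∘ y') = x' from funext fun i => (hxy i).symm] at this
end T1
end

section
section T2
theorem den {Ω : Type*} [Field Ω] (S : Subring Ω) (hC : CIC S) (z : Ω) (hz : IsIntegral S z) (a b : Ω) (ha : a ∈ S) (hb : b ∈ S) (hab : z = a / b) : z ∈ S := by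
  by_cases hb0 : b = 0
  · rw [hab, hb0, div_zero]; exact S.zero_mem
  have hzb : b * z = a := by rw [hab]; field_simp
  obtain ⟨P, hP, hP'⟩ := hz
  have hP' : Polynomial.aeval z P = 0 := hP'
  set n := P.natDegree
  have h1 : ∀ j ≤ n, b ^ n * z ^ j ∈ S := by
    intro j hj
    rw [show b ^ n * z ^ j = b ^ (n - j) * a ^ j by rw [← hzb, mul_pow, ← mul_assoc, ← pow_add, Nat.sub_add_cancel hj]]
    exact S.mul_mem (S.pow_mem hb _) (S.pow_mem ha _)
  have h2 : ∀ j, b ^ n * z ^ j ∈ S := by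
    intro j
    have h3 : Polynomial.aeval z ((Polynomial.X ^ j : Polynomial S) %ₘ P) = z ^ j := by
      rw [Polynomial.aeval_modByMonic_eq_self_of_root hP']; simp
    rw [← h3, Polynomial.aeval_eq_sum_range, Finset.mul_sum]
    refine S.sum_mem fun i hi => ?_
    rw [mul_smul_comm]
    refine S.mul_mem (Subtype.property _) (h1 i ?_)
    have := Polynomial.natDegree_modByMonic_le (Polynomial.X ^ j : Polynomial S) hP
    have := Finset.mem_range.1 hi; lia
  have hb0' : (⟨b, hb⟩ : S) ≠ 0 := fun h => hb0 (congrArg Subtype.val h)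
  obtain ⟨e, he⟩ := hC ⟨a, ha⟩ ⟨b, hb⟩ (⟨b, hb⟩ ^ n) hb0' (pow_ne_zero _ hb0') (fun k => ⟨⟨_, h2 k⟩, Subtype.ext (by
    simp only [Subring.coe_mul, Subring.coe_pow, ← hzb]; ring)⟩)
  have he' : a = b * e := congrArg Subtype.val he
  rw [hab, he', mul_div_cancel_left₀ _ hb0]; exact e.2

theorem tower (p : ℕ) [hp : Fact p.Prime] {Ω : Type*} [Field Ω] (B Rp : Subring Ω) [IsNoetherianRing B] (hint : ∀ z ∈ Rp, IsIntegral B z) {d : ℕ}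
    (hdim : (d : WithBot ℕ∞) ≤ ringKrullDim Rp) (x : Fin d → ℕ → Ω) (hxs : ∀ i n, x i (n + 1) ^ p = x i n) (hx : ∀ i, x i 0 ∈ B)
    (hmax : ∀ a ∈ B, (a ≠ 0 ∧ a⁻¹ ∈ B) ∨ ∃ c : Fin d → Ω, (∀ i, c i ∈ B) ∧ a = ∑ i, x i 0 * c i)
    (Q : Ideal Rp) [hQ : Q.IsPrime] (hxQ : ∀ z : Rp, ∀ i, (z : Ω) = x i 0 → z ∈ Q) (hxR : ∀ i n, x i n ∈ Rp) (hBR : B ≤ Rp)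
    (hfr : ∀ a ∈ B, ∃ h : (Fin d → Fin p) → Ω, (∀ J, h J ∈ B) ∧ ∃ c ∈ B, a = ∑ J, (∏ i, x i 0 ^ (J i : ℕ)) * h J ^ p + p * c) :
    (∀ z ∈ Subfield.closure (B : Set Ω), IsIntegral B z → z ∈ B) ∧ ∃ A : Subring Ω, B ≤ A ∧ A ≤ Rp ∧ (∀ i n, x i n ∈ A) ∧ (∀ z ∈ Subfield.closure (A : Set Ω), IsIntegral A z → z ∈ A) ∧
      (∀ o : A, ∃ o' c : A, o = o' ^ p + p * c) ∧
      ∀ f : Fin d → A, (∀ i, (f i : Ω) = x i 0) → ∀ i : Fin d, NZ (Ideal.span (f '' {k : Fin d | (k : ℕ) < i})) (f i) := by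
  let L : ℕ → Subalgebra B Ω := fun m => Algebra.adjoin B (Set.range fun i => x i m)
  have hxL : ∀ i m, x i m ∈ L m := fun i m => Algebra.subset_adjoin ⟨i, rfl⟩
  have hmono : Monotone L := monotone_nat_of_le_succ fun m => Algebra.adjoin_le (by
    rintro _ ⟨i, rfl⟩
    simp only [← hxs i m]
    exact (L (m + 1)).pow_mem (hxL i (m + 1)) p)
  have hx0L : ∀ i m, x i 0 ∈ L m := fun i m => hmono (Nat.zero_le m) (hxL i 0)
  have hBL : ∀ m, ∀ b ∈ B, b ∈ L m := fun m b hb => (L m).algebraMap_mem ⟨b, hb⟩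
  have lev := fun m => level B Rp hint hdim (fun i => x i 0) (fun i => x i m) (p ^ m) (fun i => seq_pow0 p (x i) (hxs i) m) hx hmax Q hxQ
    (fun i => hxR i m) hBR (L m) rfl (fun i => ⟨x i m, hxL i m⟩) (fun i => rfl) (fun i => ⟨x i 0, hx0L i m⟩) (fun i => rfl)
  let A : Subalgebra B Ω := ⨆ m, L m
  have hmem : ∀ z, z ∈ A ↔ ∃ m, z ∈ L m := fun z => by
    rw [← SetLike.mem_coe, Subalgebra.coe_iSup_of_directed hmono.directed_le, Set.mem_iUnion]; rfl
  have hAR : ∀ z ∈ A, z ∈ Rp := by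
    intro z hz
    obtain ⟨m, hm⟩ := (hmem z).1 hz
    clear hz
    induction hm using Algebra.adjoin_induction with
    | mem z hz => obtain ⟨i, rfl⟩ := hz; exact hxR i m
    | algebraMap r => exact hBR r.2
    | add _ _ _ _ h1 h2 => exact Rp.add_mem h1 h2
    | mul _ _ _ _ h1 h2 => exact Rp.mul_mem h1 h2
  have hxA : ∀ i n, x i n ∈ A := fun i n => (hmem _).2 ⟨n, hxL i n⟩
  have hB0 : ∀ z ∈ L 0, z ∈ B := fun z hz => by
    have h1 : L 0 ≤ ⊥ := Algebra.adjoin_le (by rintro _ ⟨i, rfl⟩; exact (⊥ : Subalgebra B Ω).algebraMap_mem ⟨_, hx i⟩)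
    obtain ⟨b, rfl⟩ := Algebra.mem_bot.1 (h1 hz)
    exact b.2
  refine ⟨?_, A.toSubring, fun b hb => (hmem b).2 ⟨0, hBL 0 b hb⟩, hAR, hxA, ?_, ?_, ?_⟩
  · intro z hz hzi
    obtain ⟨a, ha, b, hb, hab⟩ := Subfield.mem_closure_iff.1 hz
    rw [Subring.closure_eq] at ha hb
    exact hB0 z (den (L 0).toSubring (lev _).2 z (hzi.tower_top (A := L 0)) a b (hBL 0 a ha) (hBL 0 b hb) hab.symm)
  · intro z hz hzi
    obtain ⟨a, ha, b, hb, hab⟩ := Subfield.mem_closure_iff.1 hz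
    rw [Subring.closure_eq] at ha hb
    obtain ⟨m₁, ha⟩ := (hmem a).1 ha
    obtain ⟨m₂, hb⟩ := (hmem b).1 hb
    have hAi : Algebra.IsIntegral B A := ⟨fun z => (isIntegral_algHom_iff A.val Subtype.val_injective).1 (hint _ (hAR z z.2))⟩
    have hzB : IsIntegral B z := isIntegral_trans (A := A) z hzi
    refine (hmem z).2 ⟨max m₁ m₂, den (L (max m₁ m₂)).toSubring (lev _).2 z ?_ a b (hmono (le_max_left _ _) ha) (hmono (le_max_right _ _) hb) hab.symm⟩
    exact hzB.tower_top (A := L (max m₁ m₂))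
  · have hadd : ∀ o₁ o₂ : A, (∃ o' c : A, o₁ = o' ^ p + p * c) → (∃ o' c : A, o₂ = o' ^ p + p * c) → ∃ o' c : A, o₁ + o₂ = o' ^ p + p * c := by
      rintro _ _ ⟨a, c, rfl⟩ ⟨b, e, rfl⟩
      obtain ⟨r, hr⟩ := exists_add_pow_prime_eq hp.out a b
      exact ⟨a + b, c + e - a * b * r, by rw [hr]; ring⟩
    have hmul : ∀ o₁ o₂ : A, (∃ o' c : A, o₁ = o' ^ p + p * c) → (∃ o' c : A, o₂ = o' ^ p + p * c) → ∃ o' c : A, o₁ * o₂ = o' ^ p + p * c := by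
      rintro _ _ ⟨a, c, rfl⟩ ⟨b, e, rfl⟩
      exact ⟨a * b, a ^ p * e + c * b ^ p + p * c * e, by ring⟩
    have hroot : ∀ i n (h : x i n ∈ A), ∃ o' c : A, (⟨x i n, h⟩ : A) = o' ^ p + p * c := fun i n h =>
      ⟨⟨x i (n + 1), hxA i _⟩, 0, by rw [mul_zero, add_zero]; exact Subtype.ext (hxs i n).symm⟩
    have h1 : ∃ o' c : A, (1 : A) = o' ^ p + p * c := ⟨1, 0, by simp⟩
    have h0 : ∃ o' c : A, (0 : A) = o' ^ p + p * c := ⟨0, 0, by simp [hp.out.ne_zero]⟩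
    let S : Subsemiring A := { carrier := {o | ∃ o' c : A, o = o' ^ p + p * c}, add_mem' := fun {a b} => hadd a b, mul_mem' := fun {a b} => hmul a b, one_mem' := h1, zero_mem' := h0 }
    have hB : ∀ b (hb : b ∈ B), (⟨b, (hmem b).2 ⟨0, hBL 0 b hb⟩⟩ : A) ∈ S := by
      intro b hb
      obtain ⟨h, hh, c, hc, e⟩ := hfr b hb
      have e' : (⟨b, (hmem b).2 ⟨0, hBL 0 b hb⟩⟩ : A) = ∑ J, (∏ i, (⟨x i 0, hxA i 0⟩ : A) ^ (J i : ℕ)) * (⟨h J, (hmem _).2 ⟨0, hBL 0 _ (hh J)⟩⟩ : A) ^ p + p * ⟨c, (hmem c).2 ⟨0, hBL 0 c hc⟩⟩ := by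
        apply Subtype.ext
        refine e.trans ?_; push_cast; rfl
      rw [e']
      refine S.add_mem (S.sum_mem fun J _ => S.mul_mem (S.prod_mem fun i _ => S.pow_mem (hroot i 0 _) _) ⟨_, 0, by rw [mul_zero, add_zero]⟩) ⟨0, _, by rw [zero_pow hp.out.ne_zero, zero_add]⟩
    rintro ⟨o, ho⟩
    obtain ⟨m, hm⟩ := (hmem o).1 ho
    change (⟨o, ho⟩ : A) ∈ S
    induction hm using Algebra.adjoin_induction with
    | mem z hz => obtain ⟨i, rfl⟩ := hz; exact hroot i m _
    | algebraMap r => exact hB r r.2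
    | add _ _ h3 h4 h1 h2 => exact S.add_mem (h1 ((hmem _).2 ⟨m, h3⟩)) (h2 ((hmem _).2 ⟨m, h4⟩))
    | mul _ _ h3 h4 h1 h2 => exact S.mul_mem (h1 ((hmem _).2 ⟨m, h3⟩)) (h2 ((hmem _).2 ⟨m, h4⟩))
  · intro f hf i z hz
    have himg : ∀ {Q : Type _} [CommRing Q] (f : Fin d → Q), f '' {k : Fin d | (k : ℕ) < i} = f '' ((Finset.univ.filter fun k : Fin d => (k : ℕ) < i : Finset (Fin d)) : Set (Fin d)) := by
      intro Q _ f; congr 1; ext; simp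
    rw [himg, Submodule.mem_span_image_finset_iff_exists_fun] at hz
    obtain ⟨c, hc⟩ := hz
    choose m hm using fun j => (hmem (c j)).1 (c j).2
    obtain ⟨m₀, hm₀⟩ := (hmem z).1 z.2
    set M := max m₀ (Finset.univ.sup m)
    have hcM : ∀ j, (c j : Ω) ∈ L M := fun j => hmono ((Finset.le_sup (Finset.mem_univ j)).trans (le_max_right _ _)) (hm j)
    have hzM : (z : Ω) ∈ L M := hmono (le_max_left _ _) hm₀
    have h1 := (lev M).1 i ⟨z, hzM⟩ (by
      rw [himg, Submodule.mem_span_image_finset_iff_exists_fun]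
      refine ⟨fun j => ⟨c j, hcM j⟩, Subtype.ext ?_⟩
      have := congrArg Subtype.val hc
      simp only [AddSubmonoidClass.coe_finsetSum, smul_eq_mul, MulMemClass.coe_mul, hf] at this ⊢
      exact this)
    rw [himg, Submodule.mem_span_image_finset_iff_exists_fun] at h1 ⊢
    obtain ⟨e, he⟩ := h1
    refine ⟨fun j => ⟨e j, (hmem _).2 ⟨M, (e j).2⟩⟩, Subtype.ext ?_⟩
    have := congrArg Subtype.val he
    simp only [AddSubmonoidClass.coe_finsetSum, smul_eq_mul, MulMemClass.coe_mul, hf] at this ⊢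
    exact this
end T2
end

section
section U1
open Polynomial in
theorem scale_sep {B : Type*} [CommRing B] [IsDomain B] (F s r : Polynomial B) (c : B) (hF : F.Monic) (h : derivative F * s + F * r = C c) :
    ∃ e s₁ r₁, derivative (F.scaleRoots c) * s₁ + F.scaleRoots c * r₁ = X ^ e := by
  set f := F.scaleRoots c with hf
  have hX : (X : Polynomial B) ∈ (Ideal.span {derivative f, f}).radical := by
    rw [Ideal.radical_eq_sInf, Ideal.mem_sInf]
    rintro P ⟨hP, hPp⟩
    have hfP : f ∈ P := hP (Ideal.subset_span (by simp))
    have hf'P : derivative f ∈ P := hP (Ideal.subset_span (by simp))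
    by_cases hc : C c ∈ P
    · have h1 : f - X ^ F.natDegree ∈ P := by
        rw [hf, as_sum_range_C_mul_X_pow (F.scaleRoots c), natDegree_scaleRoots, Finset.sum_range_succ, coeff_scaleRoots, Nat.sub_self, pow_zero, mul_one,
          hF.coeff_natDegree, map_one, one_mul, add_sub_cancel_right]
        refine P.sum_mem fun i hi => P.mul_mem_right _ ?_
        rw [coeff_scaleRoots, map_mul, map_pow]
        exact P.mul_mem_left _ (P.pow_mem_of_mem hc _ (Nat.sub_pos_of_lt (Finset.mem_range.1 hi)))
      have h2 := P.sub_mem hfP h1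
      rw [sub_sub_cancel] at h2
      exact hPp.mem_of_pow_mem _ h2
    · exfalso
      let k := FractionRing (Polynomial B ⧸ P)
      let ι : Polynomial B →+* k := (algebraMap (Polynomial B ⧸ P) k).comp (Ideal.Quotient.mk P)
      have hι : ∀ q, ι q = 0 ↔ q ∈ P := fun q => by
        rw [RingHom.comp_apply, map_eq_zero_iff _ (IsFractionRing.injective _ _), Ideal.Quotient.eq_zero_iff_mem]
      let φ : B →+* k := ι.comp C
      have hφc : φ c ≠ 0 := fun h => hc ((hι _).1 h)
      have hev : ∀ q : Polynomial B, ι q = (q.map φ).eval (ι X) := fun q => by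
        rw [eval_map]; conv_lhs => rw [← eval₂_C_X (p := q), hom_eval₂]
      have h1 : (f.map φ).comp (C (φ c) * X) = C (φ c) ^ F.natDegree * F.map φ := by
        have := scaleRoots_eval₂_mul (p := F) ((C : k →+* Polynomial k).comp φ) X c
        rw [← eval₂_map, ← eval₂_map, eval₂_C_X] at this
        exact this
      have h2 := congrArg derivative h1
      rw [derivative_comp, ← C_pow, derivative_C_mul, derivative_C_mul, derivative_X, mul_one, derivative_map, derivative_map] at h2
      set y := (φ c)⁻¹ * ι X
      have hy : (C (φ c) * X : Polynomial k).eval y = ι X := by rw [eval_mul, eval_C, eval_X]; exact mul_inv_cancel_left₀ hφc _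
      have h3 := congrArg (eval y) h1
      have h4 := congrArg (eval y) h2
      rw [eval_comp, hy, ← hev, (hι _).2 hfP, eval_mul, ← C_pow, eval_C] at h3
      rw [eval_mul, eval_comp, hy, ← hev, (hι _).2 hf'P, mul_zero, eval_mul, eval_C] at h4
      have h5 := congrArg (fun q => (q.map φ).eval y) h
      simp only [Polynomial.map_add, Polynomial.map_mul, eval_add, eval_mul, map_C, eval_C] at h5
      rw [(mul_eq_zero.1 h3.symm).resolve_left (pow_ne_zero _ hφc), (mul_eq_zero.1 h4.symm).resolve_left (pow_ne_zero _ hφc), zero_mul, zero_mul, add_zero] at h5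
      exact hφc h5.symm
  obtain ⟨e, he⟩ := hX
  obtain ⟨a, b, hab⟩ := Ideal.mem_span_pair.1 he
  exact ⟨e, a, b, by rw [← hab]; ring⟩

open Polynomial in
theorem prim {Ω : Type*} [Field Ω] [CharZero Ω] (B Rr : Subring Ω) (hBR : B ≤ Rr) (hcl : ∀ z ∈ Subfield.closure (B : Set Ω), IsIntegral B z → z ∈ B)
    (hint : ∀ r ∈ Rr, IsIntegral B r) (S : Finset Ω) (hS : ∀ z ∈ S, z ∈ Rr) (hRS : ∀ r ∈ Rr, r ∈ Algebra.adjoin B (S : Set Ω)) :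
    ∃ g ∈ Rr, g ≠ 0 ∧ ∃ f s₁ r₁ : Polynomial B, ∃ e, f.Monic ∧ aeval g f = 0 ∧ f.coeff 0 ≠ 0 ∧ derivative f * s₁ + f * r₁ = X ^ e ∧
      ∀ r ∈ Rr, ∃ b : B, b ≠ 0 ∧ ∃ u : Polynomial B, (b : Ω) * r = aeval g u := by
  let k := FractionRing B
  let _ : Algebra k Ω := FractionRing.liftAlgebra B Ω
  have ht : IsScalarTower B k Ω := FractionRing.isScalarTower_liftAlgebra B Ω
  have hmap : ∀ b : B, algebraMap k Ω (algebraMap B k b) = b := fun b => (IsScalarTower.algebraMap_apply B k Ω b).symm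
  have hc0 : CharZero k := ⟨fun m n h => by have := congrArg (algebraMap k Ω) h; simpa using this⟩
  have hfrac : ∀ q : k, ∃ b : B, b ≠ 0 ∧ ∃ a : B, (b : Ω) * algebraMap k Ω q = a := by
    intro q
    obtain ⟨a, b, hb, rfl⟩ := IsFractionRing.div_surjective B q
    have hb0 := nonZeroDivisors.ne_zero hb
    refine ⟨b, hb0, a, ?_⟩
    rw [map_div₀, hmap, hmap, mul_div_cancel₀]
    exact fun h => hb0 (Subtype.ext h)
  have hnorm : IsIntegrallyClosed B := by
    rw [isIntegrallyClosed_iff k]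
    intro q hq
    obtain ⟨b, hb, a, hab⟩ := hfrac q
    have hb' : (b : Ω) ≠ 0 := fun h => hb (Subtype.ext h)
    have h1 : algebraMap k Ω q ∈ B := by
      refine hcl _ ?_ (hq.map (IsScalarTower.toAlgHom B k Ω))
      rw [show algebraMap k Ω q = a / b by rw [← hab]; field_simp]
      exact div_mem (Subfield.subset_closure a.2) (Subfield.subset_closure b.2)
    exact ⟨⟨_, h1⟩, (algebraMap k Ω).injective (hmap _)⟩
  have hSi : ∀ z ∈ (S : Set Ω), IsIntegral k z := fun z hz => (hint z (hS z hz)).tower_top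
  let L := IntermediateField.adjoin k (S : Set Ω)
  have : FiniteDimensional k L := IntermediateField.finiteDimensional_adjoin hSi
  obtain ⟨α, hα0, hα⟩ : ∃ α : L, α ≠ 0 ∧ IntermediateField.adjoin k {α} = ⊤ := by
    obtain ⟨α, hα⟩ := Field.exists_primitive_element k L
    by_cases h : α = 0
    · refine ⟨1, one_ne_zero, ?_⟩
      rw [IntermediateField.adjoin_one, ← hα, h, IntermediateField.adjoin_zero]
    · exact ⟨α, h, hα⟩
  have hα0' : (α : Ω) ≠ 0 := fun h => hα0 (Subtype.ext h)
  have hden : ∀ z ∈ L, ∃ b : B, b ≠ 0 ∧ (b : Ω) * z ∈ Rr := by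
    intro z hz'
    have hz : z ∈ Algebra.adjoin k (S : Set Ω) := by
      rw [← IntermediateField.adjoin_toSubalgebra_of_isAlgebraic fun z hz => (hSi z hz).isAlgebraic]; exact hz'
    clear hz'
    induction hz using Algebra.adjoin_induction with
    | mem z hz => exact ⟨1, one_ne_zero, by simpa using hS z hz⟩
    | algebraMap q => obtain ⟨b, hb, a, hab⟩ := hfrac q; exact ⟨b, hb, by rw [hab]; exact hBR a.2⟩
    | add z w _ _ h1 h2 =>
      obtain ⟨a, ha, ha'⟩ := h1; obtain ⟨b, hb, hb'⟩ := h2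
      refine ⟨a * b, mul_ne_zero ha hb, ?_⟩
      rw [show ((a * b : B) : Ω) * (z + w) = b * (a * z) + a * (b * w) by push_cast; ring]
      exact Rr.add_mem (Rr.mul_mem (hBR b.2) ha') (Rr.mul_mem (hBR a.2) hb')
    | mul z w _ _ h1 h2 =>
      obtain ⟨a, ha, ha'⟩ := h1; obtain ⟨b, hb, hb'⟩ := h2
      refine ⟨a * b, mul_ne_zero ha hb, ?_⟩
      rw [show ((a * b : B) : Ω) * (z * w) = (a * z) * (b * w) by push_cast; ring]
      exact Rr.mul_mem ha' hb'
  obtain ⟨b, hb, hbα⟩ := hden α α.2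
  have hb' : (b : Ω) ≠ 0 := fun h => hb (Subtype.ext h)
  set β := (b : Ω) * α
  have hβi := hint β hbα
  have hmp := minpoly.isIntegrallyClosed_eq_field_fractions' k hβi
  set F := minpoly B β
  have hsep : (F.map (algebraMap B k)).Separable := by
    rw [← hmp]; exact (minpoly.irreducible hβi.tower_top).separable
  obtain ⟨u, v, huv⟩ := hsep
  obtain ⟨b₁, hb₁, hu⟩ := IsLocalization.integerNormalization_spec (nonZeroDivisors B) u
  obtain ⟨b₂, hb₂, hv⟩ := IsLocalization.integerNormalization_spec (nonZeroDivisors B) v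
  set U := IsLocalization.integerNormalization (nonZeroDivisors B) u
  set V := IsLocalization.integerNormalization (nonZeroDivisors B) v
  have hbez : derivative F * (C b₁ * V) + F * (C b₂ * U) = C (b₁ * b₂) := by
    apply map_injective (algebraMap B k) (IsFractionRing.injective B k)
    simp only [Polynomial.map_add, Polynomial.map_mul, map_C, hu, hv, ← derivative_map, Algebra.smul_def, Polynomial.algebraMap_apply, map_mul]
    linear_combination (C (algebraMap B k b₁) * C (algebraMap B k b₂)) * huv
  set c := b₁ * b₂
  have hc : c ≠ 0 := mul_ne_zero (nonZeroDivisors.ne_zero hb₁) (nonZeroDivisors.ne_zero hb₂)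
  have hc' : (c : Ω) ≠ 0 := fun h => hc (Subtype.ext h)
  obtain ⟨e, s₁, r₁, h⟩ := scale_sep F _ _ c (minpoly.monic hβi) hbez
  refine ⟨c * β, Rr.mul_mem (hBR c.2) hbα, mul_ne_zero hc' (mul_ne_zero hb' hα0'), F.scaleRoots c, s₁, r₁, e,
    (monic_scaleRoots_iff c).2 (minpoly.monic hβi), scaleRoots_aeval_eq_zero (r := c) (minpoly.aeval B β), ?_, h, ?_⟩
  · rw [coeff_scaleRoots]
    refine mul_ne_zero (fun h0 => ?_) (pow_ne_zero _ hc)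
    refine minpoly.coeff_zero_ne_zero (A := k) hβi.tower_top (mul_ne_zero hb' hα0') ?_
    rw [hmp, coeff_map, h0, map_zero]
  · intro r hr
    have hrL : r ∈ L := Algebra.adjoin_le (R := B) (S := L.toSubalgebra.restrictScalars B) (IntermediateField.subset_adjoin k _) (hRS r hr)
    have h1 : (⟨r, hrL⟩ : L) ∈ (IntermediateField.adjoin k {α}).toSubalgebra := by rw [hα]; trivial
    rw [IntermediateField.adjoin_simple_toSubalgebra_of_isAlgebraic (Algebra.IsAlgebraic.isAlgebraic α), Algebra.adjoin_singleton_eq_range_aeval] at h1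
    obtain ⟨q, hq⟩ := h1
    have hq : aeval (α : Ω) q = r := by
      exact (aeval_algebraMap_apply Ω α q).trans (congrArg (algebraMap L Ω) hq)
    set q' := q.comp (C (algebraMap B k (c * b))⁻¹ * X)
    obtain ⟨a, ha, ha'⟩ := IsLocalization.integerNormalization_spec (nonZeroDivisors B) q'
    refine ⟨a, nonZeroDivisors.ne_zero ha, IsLocalization.integerNormalization (nonZeroDivisors B) q', Eq.symm (Eq.trans (aeval_map_algebraMap k _ _).symm ?_)⟩
    rw [ha', Algebra.smul_def, map_mul, Polynomial.algebraMap_apply, aeval_C, hmap, aeval_comp, map_mul, aeval_C, aeval_X, map_inv₀, hmap, ← hq]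
    congr 3
    change ((c : Ω) * b)⁻¹ * (c * (b * α)) = α
    field_simp
end U1
end

section
section
open CategoryTheory Abelian Limits RingTheory.Sequence ModuleCat IsSMulRegular

theorem ext_zero.{u} {R : Type u} [CommRing R] (N : ModuleCat.{u} R) :
    ∀ (rs : List R) (M : ModuleCat.{u} R), (∀ r ∈ rs, ∃ k : ℕ, r ^ k ∈ Module.annihilator R N) →
    IsWeaklyRegular M rs → ∀ i < rs.length, Subsingleton (Abelian.Ext N M i) := by
  intro rs
  induction rs with
  | nil => simp
  | cons a rs ih =>
    intro M mem reg i hi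
    obtain ⟨k, hk⟩ := mem a List.mem_cons_self
    rw [isWeaklyRegular_cons_iff] at reg
    match i with
    | 0 =>
      have : Subsingleton (N →ₗ[R] M) := by
        refine subsingleton_of_forall_eq 0 fun f => LinearMap.ext fun z => ?_
        apply reg.1.pow k
        simp only [LinearMap.zero_apply, smul_zero]
        rw [← map_smul, Module.mem_annihilator.mp hk, map_zero]
      exact (Ext.addEquiv₀.trans ModuleCat.homAddEquiv).subsingleton
    | i + 1 =>
      let g := (AddCommGrpCat.ofHom ((Ext.mk₀ (smulShortComplex M a).f).postcomp N
          (add_zero (i + 1))))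
      have mono_g : Mono g := by
        apply (Ext.covariant_sequence_exact₁' N reg.1.smulShortComplex_shortExact i (i + 1)
            rfl).mono_g ((AddCommGrpCat.isZero_of_iff_subsingleton.mpr ?_).eq_zero_of_src _)
        exact ih (ModuleCat.of R (QuotSMulTop a M)) (fun r hr => mem r (List.mem_cons_of_mem _ hr))
          reg.2 i (by simpa using hi)
      let gk := AddCommGrpCat.ofHom ((Ext.mk₀ (M.smulShortComplex (a ^ k)).f).postcomp N
          (add_zero (i + 1)))
      have mono_gk : Mono gk := by
        simp only [smulShortComplex_f_eq_smul_id, g, gk] at mono_g ⊢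
        exact (Ext.postcomp_smul_id_mono_iff (a ^ k) (i + 1)).mpr <|
            ((Ext.postcomp_smul_id_mono_iff a (i + 1)).mp mono_g).pow k
      have zero_gk : gk = 0 := Ext.postcomp_smul_id_eq_zero_of_mem_annihilator hk (i + 1)
      exact AddCommGrpCat.subsingleton_of_isZero (IsZero.of_mono_eq_zero _ zero_gk)

theorem ext_zero'.{u} {R : Type u} [CommRing R] (N M : ModuleCat.{u} R) (i : ℕ)
    (h : Subsingleton (Abelian.Ext N M i)) :
    IsZero (((_root_.Ext R (ModuleCat.{u} R) i).obj (Opposite.op N)).obj M) := by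
  let P := projectiveResolution N
  refine IsZero.of_iso ?_ (P.isoExt i M)
  rw [← HomologicalComplex.exactAt_iff_isZero_homology]
  match i with
  | 0 =>
    rw [HomologicalComplex.exactAt_iff' _ 0 0 1 (by simp) (by simp)]
    rw [ShortComplex.moduleCat_exact_iff]
    intro (f : P.complex.X 0 ⟶ M) hf
    have hf' : P.complex.d 1 0 ≫ f = 0 := hf
    have h0 : Subsingleton (N ⟶ M) := Ext.addEquiv₀.subsingleton_congr.mp h
    have he : Epi (ShortComplex.mk _ _ P.complex_d_comp_π_f_zero).g :=
      inferInstanceAs (Epi (P.π.f 0))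
    have : f = 0 := by
      have e := P.exact₀.g_desc f hf'
      rw [← e, h0.elim (P.exact₀.desc f hf') 0]
      exact comp_zero
    exact ⟨0, by rw [map_zero]; exact this.symm⟩
  | i + 1 =>
    rw [HomologicalComplex.exactAt_iff' _ i (i+1) (i+2) (by simp) (by simp)]
    rw [ShortComplex.moduleCat_exact_iff]
    intro (f : P.complex.X (i+1) ⟶ M) hf
    have hf' : P.complex.d (i+2) (i+1) ≫ f = 0 := hf
    obtain ⟨g, hg⟩ := (P.extMk_eq_zero_iff f (i+2) rfl hf' i rfl).mp (h.elim _ _)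
    exact ⟨g, hg⟩

theorem lc_zero.{u} {R : Type u} [CommRing R] (J : Ideal R) (M : ModuleCat.{u} R) (rs : List R)
    (hrs : ∀ r ∈ rs, r ∈ J) (hreg : IsWeaklyRegular M rs) (i : ℕ) (hi : i < rs.length) :
    Subsingleton ((localCohomology J i).obj M) := by
  have key : IsZero ((localCohomology J i).obj M) := by
    unfold localCohomology localCohomology.ofDiagram
    refine IsZero.of_iso ?_ (colimitObjIsoColimitCompEvaluation
      (localCohomology.diagram (localCohomology.idealPowersDiagram J) i) M)
    rw [IsZero.iff_id_eq_zero]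
    refine colimit.hom_ext fun j => ?_
    refine IsZero.eq_of_src ?_ _ _
    refine ext_zero' (ModuleCat.of R (R ⧸ J ^ (Opposite.unop (Opposite.unop j)))) M i ?_
    refine ext_zero _ rs M (fun r hr => ⟨Opposite.unop (Opposite.unop j), ?_⟩) hreg i hi
    erw [Ideal.annihilator_quotient]
    exact Ideal.pow_mem_pow (hrs r hr) _
  exact ModuleCat.subsingleton_of_isZero key
end
end

section
section
open IsLocalRing

theorem exists_q {R : Type*} [CommRing R] [IsDomain R] [IsNoetherianRing R] [IsLocalRing R]
    (w : R) (hw : w ≠ 0) (hwm : w ∈ maximalIdeal R) :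
    ∃ q : Ideal R, q.IsPrime ∧ w ∉ q ∧ maximalIdeal R ≤ (q ⊔ Ideal.span {w}).radical := by
  classical
  have hwt : Ideal.span {w} ≤ maximalIdeal R := by simpa [Ideal.span_le] using hwm
  have hnt : Nontrivial (R ⧸ Ideal.span {w}) :=
    Ideal.Quotient.nontrivial_iff.mpr (fun h => (Ideal.IsPrime.ne_top inferInstance)
      (top_le_iff.mp (h ▸ hwt)))
  have hloc : IsLocalRing (R ⧸ Ideal.span {w}) :=
    IsLocalRing.of_surjective' _ (Ideal.Quotient.mk_surjective)
  obtain ⟨s', hs', hc⟩ := Ideal.exists_finset_card_eq_height_of_isNoetherianRing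
    (maximalIdeal (R ⧸ Ideal.span {w}))
  let s : Finset R := s'.image Quotient.out
  have hmk : ∀ z : R ⧸ Ideal.span {w}, Ideal.Quotient.mk (Ideal.span {w}) (Quotient.out z) = z :=
    fun z => Quotient.out_eq z
  have key : ∀ P : Ideal R, P.IsPrime → w ∈ P → (∀ z ∈ s, z ∈ P) → P = maximalIdeal R := by
    intro P hP hwP hsP
    have hker : Ideal.span {w} ≤ P := by simpa [Ideal.span_le] using hwP
    have hP' := Ideal.isPrime_map_quotientMk_of_isPrime hker
    have h1 : maximalIdeal (R ⧸ Ideal.span {w}) ≤ P.map (Ideal.Quotient.mk (Ideal.span {w})) := by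
      refine hs'.2 ⟨hP', Ideal.span_le.mpr fun z hz => ?_⟩ (le_maximalIdeal hP'.ne_top)
      rw [← hmk z]
      exact Ideal.mem_map_of_mem _ (hsP _ (Finset.mem_image_of_mem _ hz))
    refine le_antisymm (le_maximalIdeal hP.ne_top) fun z hz => ?_
    have h2 : Ideal.Quotient.mk (Ideal.span {w}) z ∈ P.map (Ideal.Quotient.mk (Ideal.span {w})) := by
      apply h1
      rw [mem_maximalIdeal, mem_nonunits_iff]
      intro hu
      obtain ⟨y, hy⟩ := hu.exists_right_inv
      obtain ⟨y, rfl⟩ := Ideal.Quotient.mk_surjective y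
      rw [← map_mul, ← map_one (Ideal.Quotient.mk (Ideal.span {w})), Ideal.Quotient.eq] at hy
      have : (1:R) ∈ maximalIdeal R := by
        have := (maximalIdeal R).sub_mem ((maximalIdeal R).mul_mem_right y hz) (hwt hy)
        simp at this
      exact (Ideal.ne_top_iff_one _).mp (Ideal.IsPrime.ne_top inferInstance) this
    rwa [Ideal.mem_quotient_iff_mem hker] at h2
  have hsm : Ideal.span (s : Set R) ≤ maximalIdeal R := by
    rw [Ideal.span_le]
    intro z hz
    obtain ⟨z', hz', rfl⟩ := Finset.mem_image.mp (Finset.mem_coe.mp hz)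
    have h1 : z' ∈ maximalIdeal (R ⧸ Ideal.span {w}) := hs'.1.2 (Ideal.subset_span hz')
    rw [← hmk z'] at h1
    rw [SetLike.mem_coe, mem_maximalIdeal, mem_nonunits_iff] at *
    exact fun h => h1 (h.map _)
  have hq : ∃ q ∈ (Ideal.span (s : Set R)).minimalPrimes, w ∉ q := by
    by_contra! hall
    obtain ⟨P, hP⟩ := Ideal.nonempty_minimalPrimes (I := Ideal.span (s : Set R))
      (fun h => (Ideal.IsPrime.ne_top inferInstance) (top_le_iff.mp (h ▸ hsm)))
    have := key P hP.1.1 (hall P hP) (fun z hz => hP.1.2 (Ideal.subset_span hz))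
    subst this
    have h1 := Ideal.height_le_card_of_mem_minimalPrimes_span_finset hP
    have h2 : ((s.card : ℕ∞)) ≤ (maximalIdeal (R ⧸ Ideal.span {w})).height := by
      rw [← hc]; exact_mod_cast Finset.card_image_le
    have h3 := ringKrullDim_quotient_succ_le_of_nonZeroDivisor (mem_nonZeroDivisors_of_ne_zero hw)
    rw [← maximalIdeal_height_eq_ringKrullDim, ← maximalIdeal_height_eq_ringKrullDim] at h3
    have h4 : (maximalIdeal (R ⧸ Ideal.span {w})).height + 1 ≤ (maximalIdeal R).height := by
      exact_mod_cast h3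
    have h5 := h4.trans (h1.trans h2)
    rw [← hc] at h5
    have h6 : s'.card + 1 ≤ s'.card := by exact_mod_cast h5
    omega
  obtain ⟨q, hq, hwq⟩ := hq
  refine ⟨q, hq.1.1, hwq, ?_⟩
  rw [Ideal.radical_eq_sInf]
  refine le_sInf fun P ⟨hP, hPp⟩ => ?_
  rw [key P hPp (hP (Ideal.mem_sup_right (Ideal.mem_span_singleton_self w)))
    (fun z hz => hP (Ideal.mem_sup_left (hq.1.2 (Ideal.subset_span hz))))]

theorem nondeg {R S : Type*} [CommRing R] [IsDomain R] [IsNoetherianRing R] [IsLocalRing R]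
    [CommRing S] [Algebra R S] [Algebra.IsIntegral R S] [FaithfulSMul R S]
    (p : ℕ) (hp : 1 < p) (w : R) (hw : w ≠ 0) (hwm : w ∈ maximalIdeal R) (v : ℕ → S)
    (hv : ∀ n, v n ^ p ^ n = algebraMap R S w)
    (hall : ∀ n, v n ∈ (maximalIdeal R).map (algebraMap R S)) : False := by
  obtain ⟨q, hq, hwq, hm⟩ := exists_q w hw hwm
  obtain ⟨N, hN⟩ := Ideal.exists_pow_le_of_le_radical_of_fg hm (IsNoetherian.noetherian _)
  obtain ⟨Q, -, hQ, hQq⟩ := Ideal.exists_ideal_over_prime_of_isIntegral q (⊥ : Ideal S) (by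
    rw [← RingHom.ker_eq_comap_bot, (RingHom.injective_iff_ker_eq_bot _).mp
      (FaithfulSMul.algebraMap_injective R S)]; exact bot_le)
  have hN' : maximalIdeal R ^ (N+1) ≤ q ⊔ maximalIdeal R * Ideal.span {w} := by
    rw [pow_succ']
    refine (Ideal.mul_mono_right hN).trans ?_
    rw [Ideal.mul_sup]
    exact sup_le_sup_right Ideal.mul_le_right _
  have h1 : algebraMap R S w ∈ ((maximalIdeal R).map (algebraMap R S)) ^ (N+1) := by
    rw [← hv (N+1)]
    exact Ideal.pow_le_pow_right (Nat.lt_pow_self hp).le (Ideal.pow_mem_pow (hall _) _)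
  rw [← Ideal.map_pow] at h1
  have h2 := Ideal.map_mono (f := algebraMap R S) hN' h1
  rw [Ideal.map_sup, Ideal.map_mul, Ideal.map_span, Set.image_singleton, Submodule.mem_sup] at h2
  obtain ⟨a, ha, b, hb, hab⟩ := h2
  obtain ⟨μ, hμ, rfl⟩ := Ideal.mem_mul_span_singleton.mp hb
  have haQ : a ∈ Q := by
    have : q.map (algebraMap R S) ≤ Q := Ideal.map_le_iff_le_comap.mpr hQq.ge
    exact this ha
  have hwQ : algebraMap R S w ∉ Q := fun h => hwq (hQq ▸ (Ideal.mem_comap.mpr h))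
  have h3 : algebraMap R S w * (1 - μ) ∈ Q := by
    have : algebraMap R S w * (1 - μ) = a := by rw [← eq_sub_iff_add_eq] at hab; rw [hab]; ring
    rwa [this]
  have h4 : 1 - μ ∈ Q := (hQ.mem_or_mem h3).resolve_left hwQ
  obtain ⟨Q', hQ', hle⟩ := Ideal.exists_le_maximal Q hQ.ne_top
  have h5 : Q'.comap (algebraMap R S) = maximalIdeal R :=
    eq_maximalIdeal (Ideal.isMaximal_comap_of_isIntegral_of_isMaximal Q')
  have h6 : μ ∈ Q' := (Ideal.map_le_iff_le_comap.mpr h5.ge) hμ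
  exact (Ideal.ne_top_iff_one _).mp hQ'.ne_top (by simpa using Q'.add_mem (hle h4) h6)
end
end

section
section
open RingTheory.Sequence

theorem mem_bigM {T : Type*} [CommRing T] (p : ℕ) (w : ℕ → T) (hw : ∀ n, w (n+1) ^ p = w n)
    (hp : 1 < p) (z : T) :
    z ∈ (⨆ n : ℕ, Ideal.span {w (n+1)} : Ideal T) ↔ ∃ n t, z = w (n+1) * t := by
  rw [Submodule.mem_iSup_of_directed]
  · simp only [Ideal.mem_span_singleton']
    exact ⟨fun ⟨n, t, h⟩ => ⟨n, t, by rw [← h, mul_comm]⟩, fun ⟨n, t, h⟩ => ⟨n, t, by rw [h, mul_comm]⟩⟩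
  · refine Monotone.directed_le (monotone_nat_of_le_succ fun n => ?_)
    rw [Ideal.span_singleton_le_span_singleton, ← hw (n+1)]
    exact dvd_pow_self _ (by omega)

theorem bigM_reg {R T : Type*} [CommRing R] [CommRing T] [IsDomain T] [Algebra R T]
    (p : ℕ) (hp : 1 < p) (w : ℕ → T) (hw : ∀ n, w (n+1) ^ p = w n) (hw0 : w 0 ≠ 0)
    {d : ℕ} (x : Fin d → R)
    (hac : ∀ n : ℕ, 0 < n → ∀ i : Fin d, ∀ t : T,
      algebraMap R T (x i) * t ∈ Ideal.span ((fun k : Fin d => algebraMap R T (x k)) ''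
                  {k : Fin d | (k : ℕ) < (i : ℕ)}) →
      w n * t ∈ Ideal.span ((fun k : Fin d => algebraMap R T (x k)) ''
                  {k : Fin d | (k : ℕ) < (i : ℕ)})) :
    IsWeaklyRegular (Submodule.restrictScalars R (⨆ n : ℕ, Ideal.span {w (n+1)} : Ideal T))
      (List.ofFn x) := by
  have hwn : ∀ n, w n ≠ 0 := fun n h => hw0 (by
    rw [← seq_pow0 p w hw n, h, zero_pow]; positivity)
  have hmem := mem_bigM p w hw hp
  refine ⟨fun i hi => ?_⟩
  have hi' : i < d := by simpa using hi
  have hI : ∀ i : ℕ, Ideal.ofList ((List.ofFn x).take i)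
      = Ideal.span (x '' {k : Fin d | (k : ℕ) < i}) := by
    intro i
    unfold Ideal.ofList
    congr 1
    ext z
    simp only [Set.mem_image, Set.mem_ofPred_eq, List.mem_take_iff_getElem, List.getElem_ofFn,
      List.length_ofFn, lt_min_iff]
    constructor
    · rintro ⟨k, hk, rfl⟩
      exact ⟨⟨k, hk.2⟩, hk.1, rfl⟩
    · rintro ⟨k, hk, rfl⟩
      exact ⟨k, ⟨hk, k.2⟩, rfl⟩
  rw [hI i, List.getElem_ofFn]
  generalize hIdef : Ideal.span (x '' {k : Fin d | (k : ℕ) < i}) = I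
  have hJ : Ideal.span ((fun k : Fin d => algebraMap R T (x k)) '' {k : Fin d | (k : ℕ) < i})
      = I.map (algebraMap R T) := by
    rw [← hIdef, Ideal.map_span, Set.image_image]
  have hac' := fun n hn t => hac n hn ⟨i, hi'⟩ t
  simp only [hJ] at hac'
  clear hJ hac hI hIdef
  generalize x ⟨i, hi'⟩ = a at hac' ⊢
  let M := Submodule.restrictScalars R (⨆ n : ℕ, Ideal.span {w (n+1)} : Ideal T)
  have step : ∀ k m, ∃ c, w (k+1) = w (k+m+1) * c := fun k m =>
    ⟨w (k+m+1) ^ (p^m - 1), by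
      rw [← pow_succ', Nat.sub_add_cancel (Nat.one_le_pow _ _ (by omega)),
        show k+m+1 = k+1+m by omega, seq_pow p w hw]⟩
  have cA : ∀ z : M, z ∈ (I • ⊤ : Submodule R M) →
      ∃ n, ∃ s ∈ I.map (algebraMap R T), (z : T) = w (n+1) * s := by
    intro z hz
    induction hz using Submodule.smul_induction_on' with
    | smul r hr m hm =>
      obtain ⟨n, t, h⟩ := (hmem m).mp m.2
      refine ⟨n, algebraMap R T r * t, Ideal.mul_mem_right _ _ (Ideal.mem_map_of_mem _ hr), ?_⟩
      rw [Submodule.coe_smul, h, Algebra.smul_def]; ring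
    | add y hy z hz h1 h2 =>
      obtain ⟨n, s, hs, h1⟩ := h1
      obtain ⟨k, t, ht, h2⟩ := h2
      obtain ⟨c, hc⟩ := step n k
      obtain ⟨c', hc'⟩ := step k n
      refine ⟨n+k, c*s+c'*t, Ideal.add_mem _ (Ideal.mul_mem_left _ _ hs)
        (Ideal.mul_mem_left _ _ ht), ?_⟩
      rw [Submodule.coe_add, h1, h2, hc, hc', add_comm k n]; ring
  have cB : ∀ z : M, ∀ n, ∀ s ∈ I.map (algebraMap R T), (z : T) = w (n+1) * s →
      z ∈ (I • ⊤ : Submodule R M) := by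
    intro z n s hs hz
    let f : T →ₗ[R] M := LinearMap.codRestrict M (LinearMap.mulLeft R (w (n+1)))
      (fun t => (hmem _).mpr ⟨n, t, rfl⟩)
    have h1 : s ∈ (I • ⊤ : Submodule R T) := by rw [Ideal.smul_top_eq_map]; exact hs
    have h2 := Submodule.mem_map_of_mem (f := f) h1
    rw [Submodule.map_smul''] at h2
    have h3 : f s = z := Subtype.ext hz.symm
    rw [h3] at h2
    exact Submodule.smul_mono le_rfl le_top h2
  rw [isSMulRegular_iff_right_eq_zero_of_smul]
  intro z
  obtain ⟨z, rfl⟩ := Submodule.Quotient.mk_surjective _ z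
  rw [← Submodule.Quotient.mk_smul, Submodule.Quotient.mk_eq_zero, Submodule.Quotient.mk_eq_zero]
  intro hz
  obtain ⟨n, s, hs, h1⟩ := cA _ hz
  obtain ⟨k, t, h2⟩ := (hmem z).mp z.2
  obtain ⟨c, hc⟩ := step n k
  obtain ⟨c', hc'⟩ := step k n
  rw [Submodule.coe_smul, h2, Algebra.smul_def, hc, hc', add_comm k n] at h1
  have h3 : algebraMap R T a * (c' * t) = c * s :=
    mul_left_cancel₀ (hwn (n+k+1)) (by linear_combination h1)
  have h4 := hac' (n+k+2) (by omega) (c'*t) (h3 ▸ Ideal.mul_mem_left _ _ hs)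
  refine cB z (n+k+1) (w (n+k+2) ^ (p-2) * (w (n+k+2) * (c' * t))) (Ideal.mul_mem_left _ _ h4) ?_
  have h5 : w (n+k+2) * w (n+k+2) ^ (p-2) * w (n+k+2) = w (n+k+1) := by
    rw [← hw (n+k+1), ← pow_succ', ← pow_succ]; congr 1; omega
  rw [h2, hc', add_comm k n, ← h5]
  ring

theorem bigM_ne {R T : Type*} [CommRing R] [CommRing T] [Algebra R T] (I : Ideal R)
    (p : ℕ) (hp : 1 < p) (w : ℕ → T) (hw : ∀ n, w (n+1) ^ p = w n)
    (h : ∃ n, w n ∉ I.map (algebraMap R T)) :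
    Submodule.restrictScalars R (⨆ n : ℕ, Ideal.span {w (n+1)} : Ideal T) ≠
      I • Submodule.restrictScalars R (⨆ n : ℕ, Ideal.span {w (n+1)} : Ideal T) := by
  intro he
  have h1 : ∀ n, w (n+1) ∈ I.map (algebraMap R T) := by
    intro n
    have : w (n+1) ∈ I • Submodule.restrictScalars R
        (⨆ n : ℕ, Ideal.span {w (n+1)} : Ideal T) := by
      rw [← he]; exact (mem_bigM p w hw hp _).mpr ⟨n, 1, (mul_one _).symm⟩
    have h2 : w (n+1) ∈ (I • ⊤ : Submodule R T) := Submodule.smul_mono le_rfl le_top this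
    rw [Ideal.smul_top_eq_map] at h2
    exact h2
  obtain ⟨n, hn⟩ := h
  rw [← hw n] at hn
  exact hn (Ideal.pow_mem_of_mem _ (h1 n) _ (by omega))
end
end

section
theorem exists_roots {Ω : Type*} [Field Ω] [IsAlgClosed Ω] (p : ℕ) (hp : 0 < p) (a : Ω) :
    ∃ s : ℕ → Ω, s 0 = a ∧ ∀ n, s (n+1) ^ p = s n := by
  choose f hf using fun z : Ω => IsAlgClosed.exists_pow_nat_eq z hp
  exact ⟨fun n => Nat.rec a (fun _ z => f z) n, rfl, fun n => hf _⟩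

theorem exists_L {Ω : Type*} [Field Ω] (p : ℕ) (K : Subfield Ω) (θ : ℕ → Ω)
    (hθ : ∀ n, θ (n+1) ^ p = θ n) (hp : 0 < p) (halg : IsAlgebraic K (θ 0)) :
    ∃ L : Subfield Ω, ∀ z, z ∈ L ↔ ∃ m, ∃ u : Polynomial K, Polynomial.aeval (θ m) u = z := by
  have ha : ∀ n, IsAlgebraic K (θ n) := fun n =>
    IsAlgebraic.of_pow (n := p^n) (by positivity) (by rwa [seq_pow0 p θ hθ n])
  have hdir : Directed (· ≤ ·) (fun n => IntermediateField.adjoin K {θ n}) := by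
    refine Monotone.directed_le (monotone_nat_of_le_succ fun n => ?_)
    rw [IntermediateField.adjoin_simple_le_iff, ← hθ n]
    exact pow_mem (IntermediateField.mem_adjoin_simple_self K _) _
  refine ⟨(⨆ n, IntermediateField.adjoin K {θ n}).toSubfield, fun z => ?_⟩
  have h1 : z ∈ (⨆ n, IntermediateField.adjoin K {θ n}) ↔
      ∃ n, z ∈ IntermediateField.adjoin K {θ n} := by
    rw [← SetLike.mem_coe, IntermediateField.coe_iSup_of_directed hdir]
    simp
  rw [IntermediateField.mem_toSubfield, h1]
  refine exists_congr fun n => ?_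
  rw [← IntermediateField.mem_toSubalgebra,
    IntermediateField.adjoin_simple_toSubalgebra_of_isAlgebraic (ha n),
    Algebra.adjoin_singleton_eq_range_aeval]
  exact Iff.rfl

theorem T_closed {R Ω : Type*} [CommRing R] [Field Ω] [Algebra R Ω] (L : Subfield Ω)
    (T : Subalgebra R Ω) (hT : ∀ z, z ∈ T ↔ IsIntegral R z ∧ z ∈ L) : IsIntegrallyClosed T := by
  rw [isIntegrallyClosed_iff (FractionRing T)]
  intro z hz
  let φ : FractionRing T →ₐ[T] Ω := IsFractionRing.liftAlgHom (g := Algebra.ofId T Ω)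
    (fun a b h => Subtype.ext h)
  have hi : Algebra.IsIntegral R T := ⟨fun t => (isIntegral_algHom_iff T.val
    Subtype.val_injective).mp ((hT _).mp t.2).1⟩
  have h1 : IsIntegral T (φ z) := hz.map φ
  have h2 : IsIntegral R (φ z) := isIntegral_trans _ h1
  have h3 : φ z ∈ L := by
    obtain ⟨a, b, hb, rfl⟩ := IsFractionRing.div_surjective (A := T) z
    rw [map_div₀, AlgHom.commutes, AlgHom.commutes]
    exact div_mem ((hT _).mp a.2).2 ((hT _).mp b.2).2
  refine ⟨⟨φ z, (hT _).mpr ⟨h2, h3⟩⟩, φ.injective ?_⟩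
  exact φ.commutes _

theorem int_mono {Ω : Type*} [Field Ω] {A B : Subring Ω} (h : A ≤ B) {z : Ω} (hz : IsIntegral A z) :
    IsIntegral B z :=
  IsIntegral.map_of_comp_eq (Subring.inclusion h) (RingHom.id Ω) rfl hz

theorem span_split {T : Type*} [CommRing T] {d : ℕ} (X : Fin d → T) (r : ℕ) (hr : r + 1 < d)
    (z : T) : z ∈ Ideal.span (X '' {k : Fin d | (k : ℕ) < r + 1}) ↔
      ∃ t0, ∃ tj : Fin r → T, z = X ⟨0, by omega⟩ * t0 + ∑ j : Fin r, X ⟨j + 1, by omega⟩ * tj j := by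
  have h : X '' {k : Fin d | (k : ℕ) < r + 1} =
      insert (X ⟨0, by omega⟩) (Set.range fun j : Fin r => X ⟨j + 1, by omega⟩) := by
    ext z
    simp only [Set.mem_image, Set.mem_ofPred_eq, Set.mem_insert_iff, Set.mem_range]
    constructor
    · rintro ⟨⟨k, hk⟩, h1, rfl⟩
      rcases k with - | k
      · exact Or.inl rfl
      · exact Or.inr ⟨⟨k, by simpa using h1⟩, rfl⟩
    · rintro (rfl | ⟨j, rfl⟩)
      · exact ⟨_, Nat.succ_pos r, rfl⟩
      · exact ⟨_, Nat.succ_lt_succ j.2, rfl⟩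
  rw [h, Ideal.mem_span_insert]
  constructor
  · rintro ⟨a, b, hb, rfl⟩
    obtain ⟨c, rfl⟩ := Ideal.mem_span_range_iff_exists_fun.mp hb
    exact ⟨a, c, by rw [mul_comm a]; congr 1; exact Finset.sum_congr rfl fun j _ => mul_comm _ _⟩
  · rintro ⟨a, c, rfl⟩
    exact ⟨a, _, Ideal.mem_span_range_iff_exists_fun.mpr ⟨c, rfl⟩, by
      rw [mul_comm a]; congr 1; exact Finset.sum_congr rfl fun j _ => mul_comm _ _⟩
end

section
section
open IsLocalRing Polynomial

theorem core (p : ℕ) [hp : Fact p.Prime] {R : Type*} [CommRing R] [IsDomain R] [IsNoetherianRing R]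
    [IsLocalRing R] [IsAdicComplete (maximalIdeal R) R] [CharP (ResidueField R) p]
    [PerfectRing (ResidueField R) p] {d : ℕ} (hd0 : 0 < d) (hdim : ringKrullDim R = d)
    (x : Fin d → R) (hx0 : x ⟨0, hd0⟩ = (p : R))
    (hsop₁ : Ideal.span (Set.range x) ≤ maximalIdeal R)
    (hsop₂ : maximalIdeal R ≤ (Ideal.span (Set.range x)).radical)
    {Ω : Type*} [Field Ω] [CharZero Ω] [IsAlgClosed Ω] [Algebra R Ω] [FaithfulSMul R Ω] :
    ∃ g : R, g ≠ 0 ∧ ∃ L : Subfield Ω, (∀ r : R, algebraMap R Ω r ∈ L) ∧ ∃ π θ : ℕ → Ω,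
      (π 0 = p ∧ ∀ n, π (n+1) ^ p = π n) ∧ (θ 0 = algebraMap R Ω g ∧ ∀ n, θ (n+1) ^ p = θ n) ∧
      (∀ n, π n ∈ L) ∧ (∀ n, θ n ∈ L) ∧
      (∃ n, ∀ z : integralClosure R Ω, (z : Ω) = π n * θ n →
        z ∉ (maximalIdeal R).map (algebraMap R (integralClosure R Ω))) ∧
      ∀ r (hr : r + 1 < d) (t t0 : Ω) (tj : Fin r → Ω), (IsIntegral R t ∧ t ∈ L) →
        (IsIntegral R t0 ∧ t0 ∈ L) → (∀ j, IsIntegral R (tj j) ∧ tj j ∈ L) →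
        algebraMap R Ω (x ⟨r+1, hr⟩) * t = p * t0 + ∑ j : Fin r,
          algebraMap R Ω (x ⟨j+1, by omega⟩) * tj j → ∀ n : ℕ,
        ∃ s0, (IsIntegral R s0 ∧ s0 ∈ L) ∧ ∃ sj : Fin r → Ω,
          (∀ j, IsIntegral R (sj j) ∧ sj j ∈ L) ∧
          π n * θ n * t = p * s0 + ∑ j : Fin r, algebraMap R Ω (x ⟨j+1, by omega⟩) * sj j := by
  classical
  have hpp := hp.out
  obtain ⟨A₀, hA₀n, hA₀i, ⟨S₀, hS₀⟩, hxA₀, hmaxA₀, hfrA₀⟩ := exists_base p hd0 x hx0 hsop₁ hsop₂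
  have hinj : Function.Injective (algebraMap R Ω) := FaithfulSMul.algebraMap_injective R Ω
  have hpm : (p : R) ∈ maximalIdeal R := hx0 ▸ hsop₁ (Ideal.subset_span ⟨_, rfl⟩)
  let Rp : Subring Ω := (integralClosure R Ω).toSubring
  have hRp : ∀ z, z ∈ Rp ↔ IsIntegral R z := fun z => Iff.rfl
  let e : Rp →+* integralClosure R Ω := RingHom.id _
  let B : Subring Ω := A₀.map (algebraMap R Ω)
  have hBn : IsNoetherianRing B :=
    isNoetherianRing_of_ringEquiv A₀ (A₀.equivMapOfInjective _ hinj)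
  have hiA : Algebra.IsIntegral A₀ R := ⟨hA₀i⟩
  have hint : ∀ z ∈ Rp, IsIntegral B z := by
    intro z hz
    have h1 : IsIntegral A₀ z := isIntegral_trans (R := A₀) (A := R) z hz
    exact IsIntegral.map_of_comp_eq ((algebraMap R Ω).restrict A₀ B fun a ha => ⟨a, ha, rfl⟩)
      (RingHom.id Ω) rfl h1
  have hBR : B ≤ Rp := by
    rintro _ ⟨a, -, rfl⟩
    exact isIntegral_algebraMap
  have hdim' : (d : WithBot ℕ∞) ≤ ringKrullDim Rp :=
    dim_le₂ (A := R) (B := integralClosure R Ω) d hdim.ge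
  obtain ⟨Q₀, -, hQ₀, hQ₀m⟩ := Ideal.exists_ideal_over_prime_of_isIntegral (maximalIdeal R)
    (⊥ : Ideal (integralClosure R Ω)) (by
    rw [← RingHom.ker_eq_comap_bot, (RingHom.injective_iff_ker_eq_bot _).mp
      (FaithfulSMul.algebraMap_injective R _)]; exact bot_le)
  let Q : Ideal Rp := Q₀.comap e
  have hQ : Q.IsPrime := hQ₀.comap e
  have hQm : ∀ z : Rp, ∀ r ∈ maximalIdeal R, (z : Ω) = algebraMap R Ω r → z ∈ Q := by
    intro z r hr hz
    have h1 : algebraMap R (integralClosure R Ω) r ∈ Q₀ := by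
      rw [← hQ₀m] at hr; exact hr
    have h2 : e z = algebraMap R (integralClosure R Ω) r := Subtype.ext hz
    exact Ideal.mem_comap.mpr (h2 ▸ h1)
  choose X hX0 hXs using fun i => exists_roots p hpp.pos (algebraMap R Ω (x i))
  have hXR : ∀ i n, X i n ∈ Rp := by
    intro i n
    refine IsIntegral.of_pow (n := p^n) (pow_pos hpp.pos n) ?_
    rw [seq_pow0 p (X i) (hXs i) n, hX0]
    exact isIntegral_algebraMap
  have hmax : ∀ a ∈ B, (a ≠ 0 ∧ a⁻¹ ∈ B) ∨
      ∃ c : Fin d → Ω, (∀ i, c i ∈ B) ∧ a = ∑ i, X i 0 * c i := by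
    rintro _ ⟨a, ha, rfl⟩
    by_cases ham : a ∈ maximalIdeal R
    · right
      obtain ⟨c, hc, h⟩ := hmaxA₀ a ha ham
      refine ⟨fun i => algebraMap R Ω (c i), fun i => ⟨c i, hc i, rfl⟩, ?_⟩
      conv_lhs => rw [h, map_sum]
      exact Finset.sum_congr rfl fun i _ => by rw [map_mul, hX0]
    · left
      have hu : IsUnit (algebraMap A₀ R ⟨a, ha⟩) := by
        by_contra h; exact ham ((mem_maximalIdeal _).mpr h)
      have hloc : IsLocalHom (algebraMap A₀ R) :=
        RingHom.IsIntegral.isLocalHom (fun r => hA₀i r) Subtype.val_injective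
      obtain ⟨b, hb⟩ := (isUnit_of_map_unit (algebraMap A₀ R) _ hu).exists_right_inv
      have hb' : algebraMap R Ω a * algebraMap R Ω b = 1 := by
        rw [← map_mul, ← map_one (algebraMap R Ω)]
        exact congrArg _ (congrArg Subtype.val hb)
      refine ⟨left_ne_zero_of_mul_eq_one hb', b, b.2, ?_⟩
      exact eq_inv_of_mul_eq_one_right hb'
  have hfr : ∀ a ∈ B, ∃ h : (Fin d → Fin p) → Ω, (∀ J, h J ∈ B) ∧ ∃ c ∈ B,
      a = ∑ J, (∏ i, X i 0 ^ (J i : ℕ)) * h J ^ p + p * c := by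
    rintro _ ⟨a, ha, rfl⟩
    obtain ⟨h, hh, c, hc, h1⟩ := hfrA₀ a ha
    refine ⟨fun J => algebraMap R Ω (h J), fun J => ⟨_, hh J, rfl⟩, algebraMap R Ω c, ⟨c, hc, rfl⟩, ?_⟩
    conv_lhs => rw [h1]
    simp only [map_add, map_sum, map_mul, map_prod, map_pow, map_natCast, hX0]
  obtain ⟨hclB, A, hBA, hAR, hXA, hclA, hfrA, hNZ⟩ := tower p B Rp hint hdim' X hXs
    (fun i => by rw [hX0]; exact ⟨x i, hxA₀ i, rfl⟩) hmax Q
    (fun z i hz => hQm z (x i) (hsop₁ (Ideal.subset_span ⟨i, rfl⟩)) (by rw [hz, hX0])) hXR hBR hfr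
  let Rr : Subring Ω := (algebraMap R Ω).range
  have hRrR : Rr ≤ Rp := by
    rintro _ ⟨r, rfl⟩
    exact isIntegral_algebraMap
  obtain ⟨_, ⟨g, rfl⟩, hg0, f, s₁, r₁, e₁, hmon, hroot, hc0, hsep, hgen⟩ := prim B Rr
    (by rintro _ ⟨a, -, rfl⟩; exact ⟨a, rfl⟩) hclB (fun r hr => hint r (hRrR hr))
    (S₀.image (algebraMap R Ω)) (by
      intro z hz
      obtain ⟨r, -, rfl⟩ := Finset.mem_image.mp hz
      exact ⟨r, rfl⟩) (by
      rintro _ ⟨r, rfl⟩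
      have hr := hS₀ r
      induction hr using Algebra.adjoin_induction with
      | mem z hz => exact Algebra.subset_adjoin (Finset.mem_coe.mpr (Finset.mem_image_of_mem _ hz))
      | algebraMap a =>
        exact Subalgebra.algebraMap_mem _ (⟨algebraMap R Ω a, a, a.2, rfl⟩ : B)
      | add _ _ _ _ h1 h2 => rw [map_add]; exact add_mem h1 h2
      | mul _ _ _ _ h1 h2 => rw [map_mul]; exact mul_mem h1 h2)
  have hg : g ≠ 0 := fun h => hg0 (by rw [h, map_zero])
  obtain ⟨θ, hθ0, hθs⟩ := exists_roots p hpp.pos (algebraMap R Ω g)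
  let π := X ⟨0, hd0⟩
  have hπ0 : π 0 = p := (hX0 _).trans (by rw [hx0, map_natCast])
  have hθR : ∀ n, θ n ∈ Rp := by
    intro n
    refine IsIntegral.of_pow (n := p^n) (pow_pos hpp.pos n) ?_
    rw [seq_pow0 p θ hθs n, hθ0]
    exact isIntegral_algebraMap
  have hp0R : (p : R) ≠ 0 := fun h => by
    have := congrArg (algebraMap R Ω) h
    rw [map_natCast, map_zero] at this
    exact hpp.ne_zero (by exact_mod_cast this)
  have hnd : ∃ n, ∀ z : integralClosure R Ω, (z : Ω) = π n * θ n →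
        z ∉ (maximalIdeal R).map (algebraMap R (integralClosure R Ω)) := by
    by_contra! hall
    refine nondeg (S := integralClosure R Ω) p hpp.one_lt (p * g) (mul_ne_zero hp0R hg)
      (Ideal.mul_mem_right _ _ hpm) (fun n => ⟨π n * θ n, mul_mem (hXR _ n) (hθR n)⟩) (fun n => ?_)
      (fun n => ?_)
    · refine Subtype.ext ?_
      change (π n * θ n) ^ p ^ n = algebraMap R Ω (p * g)
      rw [mul_pow, seq_pow0 p θ hθs n, seq_pow0 p π (hXs _) n, hθ0, hπ0, map_mul, map_natCast]
    · obtain ⟨z, hz, h⟩ := hall n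
      convert h
      exact hz.symm
  let K := Subfield.closure (A : Set Ω)
  have hAK : ∀ a ∈ A, a ∈ K := fun a ha => Subfield.subset_closure ha
  let i₁ : B →+* A := Subring.inclusion hBA
  have hfd : FD p A Rp K π θ (f.map i₁) (s₁.map i₁) (r₁.map i₁) e₁ :=
    { AR := hAR
      AK := hAK
      cl := hclA
      fr := hfrA
      Rcl := fun z hz => by
        have h1 : IsIntegral (integralClosure R Ω) z :=
          IsIntegral.map_of_comp_eq e (RingHom.id Ω) rfl hz
        exact isIntegral_trans (R := R) z h1
      Rint := fun z hz => int_mono hBA (hint z hz)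
      inv := fun h => by
        have h1 : (⟨(p : Ω), natCast_mem Rp p⟩ : Rp) ∈ Q :=
          hQm _ p hpm (by rw [map_natCast])
        have h2 := Q.mul_mem_right ⟨(p : Ω)⁻¹, h⟩ h1
        have h3 : (⟨(p : Ω), natCast_mem Rp p⟩ : Rp) * ⟨(p : Ω)⁻¹, h⟩ = 1 :=
          Subtype.ext (mul_inv_cancel₀ (Nat.cast_ne_zero.mpr hpp.ne_zero))
        rw [h3] at h2
        exact (Ideal.ne_top_iff_one _).mp hQ.ne_top h2
      πA := fun n => hXA _ n
      π0 := hπ0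
      πs := hXs _
      θs := hθs
      mon := hmon.map _
      root := by
        rw [hθ0, aeval_def, eval₂_map]; exact hroot
      c0 := by
        rw [coeff_map]
        exact fun h => hc0 (Subtype.ext (congrArg (Subtype.val : A → Ω) h))
      sep := by
        rw [derivative_map, ← Polynomial.map_mul, ← Polynomial.map_mul, ← Polynomial.map_add, hsep,
          Polynomial.map_pow, map_X]
      θ0 := by
        obtain ⟨n, hn⟩ := hnd
        refine ⟨n, fun c hc h => hn ⟨π n * θ n, mul_mem (hXR _ n) (hθR n)⟩ rfl ?_⟩
        have : (⟨π n * θ n, mul_mem (hXR _ n) (hθR n)⟩ : integralClosure R Ω) =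
            algebraMap R (integralClosure R Ω) p * (⟨π n, hXR _ n⟩ * ⟨c, hc⟩) := by
          refine Subtype.ext ?_
          change π n * θ n = algebraMap R Ω p * (π n * c)
          rw [h, map_natCast]; ring
        rw [this]
        exact Ideal.mul_mem_right _ _ (Ideal.mem_map_of_mem _ hpm) }
  have halg : IsAlgebraic K (θ 0) := by
    have h1 : IsIntegral A (θ 0) := int_mono hBA (hint _ (hθR 0))
    have h2 : IsIntegral K (θ 0) := IsIntegral.map_of_comp_eq
      ((RingHom.id Ω).restrict A K hAK) (RingHom.id Ω) rfl h1
    exact h2.isAlgebraic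
  obtain ⟨L, hL⟩ := exists_L p K θ hθs hpp.pos halg
  have hKL : ∀ k ∈ K, k ∈ L := fun k hk => (hL k).mpr ⟨0, C ⟨k, hk⟩, by rw [aeval_C]; rfl⟩
  refine ⟨g, hg, L, ?_, π, θ, ⟨hπ0, hXs _⟩, ⟨hθ0, hθs⟩, fun n => hKL _ (hAK _ (hXA _ n)),
    fun n => (hL _).mpr ⟨n, Polynomial.X, aeval_X _⟩, hnd, ?_⟩
  · intro r
    obtain ⟨b, hb, u, hu⟩ := hgen _ ⟨r, rfl⟩
    have hb0 : (b : Ω) ≠ 0 := fun h => hb (Subtype.ext h)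
    have h1 : aeval (algebraMap R Ω g) u ∈ L := by
      rw [aeval_def, eval₂_eq_sum_range]
      refine sum_mem fun k _ => mul_mem (hKL _ (hAK _ (hBA (u.coeff k).2))) (pow_mem ?_ _)
      rw [← hθ0]
      exact (hL _).mpr ⟨0, Polynomial.X, aeval_X _⟩
    have h2 : algebraMap R Ω r = (b : Ω)⁻¹ * aeval (algebraMap R Ω g) u := by
      rw [← hu, inv_mul_cancel_left₀ hb0]
    rw [h2]
    exact mul_mem (inv_mem (hKL _ (hAK _ (hBA b.2)))) h1
  · intro r hr t t0 tj ht ht0 htj hrel n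
    let T : Subring Ω := Rp ⊓ L.toSubring
    have hT : ∀ z, z ∈ T ↔ z ∈ Rp ∧ ∃ m, ∃ u : Polynomial K, aeval (θ m) u = z :=
      fun z => Iff.and Iff.rfl (hL z)
    let F : Fin d → A := fun i => ⟨X i 0, hXA i 0⟩
    have hF := hNZ F (fun i => rfl)
    have hWR : WR ⊥ (List.ofFn fun k : Fin (r+2) => F ⟨k, by omega⟩) := by
      rw [WR_ofFn]
      intro i
      have h1 := hF ⟨i, by omega⟩
      convert h1 using 2
      ext z
      simp only [Set.mem_image, Set.mem_ofPred_eq]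
      constructor
      · rintro ⟨k, hk, rfl⟩; exact ⟨⟨k, by omega⟩, hk, rfl⟩
      · rintro ⟨k, hk, rfl⟩; exact ⟨⟨k, lt_trans hk i.2⟩, hk, rfl⟩
    have hlist : (List.ofFn fun k : Fin (r+2) => F ⟨k, by omega⟩) =
        (p : A) :: (List.ofFn (fun j : Fin r => F ⟨j+1, by omega⟩) ++ [F ⟨r+1, hr⟩]) := by
      rw [List.ofFn_succ, List.ofFn_succ_last]
      congr 1
      exact Subtype.ext hπ0
    rw [hlist] at hWR
    have hmain := hfd.main T hT (fun j n => ⟨X ⟨j+1, by omega⟩ n, hXA _ n⟩)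
      (fun j n => Subtype.ext (hXs _ n)) (fun n => ⟨X ⟨r+1, hr⟩ n, hXA _ n⟩)
      (fun n => Subtype.ext (hXs _ n)) hWR t t0 tj ht ht0 htj (by
        simp only [hX0]; exact hrel) n
    obtain ⟨s0, hs0, sj, hsj, h⟩ := hmain
    simp only [hX0] at h
    exact ⟨s0, hs0, sj, hsj, h⟩
end
end

theorem exists_big_CohenMacaulay_module.{u}
    (p : ℕ) (hp : p.Prime)
    (R : Type u) [CommRing R] [IsDomain R] [IsNoetherianRing R] [IsLocalRing R]
    [IsAdicComplete (IsLocalRing.maximalIdeal R) R]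
    [CharZero R]
    (hres : CharP (IsLocalRing.ResidueField R) p)
    [ExpChar (IsLocalRing.ResidueField R) p]
    [PerfectRing (IsLocalRing.ResidueField R) p]
    (d : ℕ) (hd0 : 0 < d) (hdim : ringKrullDim R = d)
    (x : Fin d → R) (hx0 : x ⟨0, hd0⟩ = (p : R))
    (hsop₁ : Ideal.span (Set.range x) ≤ IsLocalRing.maximalIdeal R)
    (hsop₂ : IsLocalRing.maximalIdeal R ≤ (Ideal.span (Set.range x)).radical) :
    ∃ g : R, g ≠ 0 ∧
    ∃ T : Subalgebra R (AlgebraicClosure (FractionRing R)),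
      T ≤ integralClosure R (AlgebraicClosure (FractionRing R)) ∧
      ∃ pr gr : ℕ → ↥T,
        (pr 0 = (p : ↥T) ∧ ∀ n, pr (n + 1) ^ p = pr n) ∧
        (gr 0 = algebraMap R ↥T g ∧ ∀ n, gr (n + 1) ^ p = gr n) ∧
        IsIntegrallyClosed ↥T ∧
        (∃ n : ℕ, pr n * gr n ∉
            Ideal.map (algebraMap R ↥T) (IsLocalRing.maximalIdeal R)) ∧
        (∀ n : ℕ, 0 < n → ∀ i : Fin d, ∀ t : ↥T,
            algebraMap R ↥T (x i) * t ∈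
                Ideal.span ((fun k : Fin d => algebraMap R ↥T (x k)) ''
                  {k : Fin d | (k : ℕ) < (i : ℕ)}) →
            pr n * gr n * t ∈
                Ideal.span ((fun k : Fin d => algebraMap R ↥T (x k)) ''
                  {k : Fin d | (k : ℕ) < (i : ℕ)})) ∧
        (∀ n : ℕ, 0 < n → ∀ t : ↥T,
            pr n * gr n * t ∈
              (⨆ n : ℕ, Ideal.span {pr (n + 1) * gr (n + 1)} : Ideal ↥T)) ∧
        (∀ i : ℕ, i < d →
            Subsingleton
              ((localCohomology (IsLocalRing.maximalIdeal R) i).obj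
                (ModuleCat.of R
                  ↥(Submodule.restrictScalars R
                      (⨆ n : ℕ, Ideal.span {pr (n + 1) * gr (n + 1)} : Ideal ↥T))))) ∧
        Submodule.restrictScalars R
            (⨆ n : ℕ, Ideal.span {pr (n + 1) * gr (n + 1)} : Ideal ↥T)
          ≠ IsLocalRing.maximalIdeal R •
              Submodule.restrictScalars R
                (⨆ n : ℕ, Ideal.span {pr (n + 1) * gr (n + 1)} : Ideal ↥T) := by
  have hpf : Fact p.Prime := ⟨hp⟩
  have hinj : Function.Injective (algebraMap R (AlgebraicClosure (FractionRing R))) := by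
    rw [IsScalarTower.algebraMap_eq R (FractionRing R)]
    exact (algebraMap (FractionRing R) _).injective.comp (IsFractionRing.injective R _)
  have hF : FaithfulSMul R (AlgebraicClosure (FractionRing R)) :=
    (faithfulSMul_iff_algebraMap_injective R _).mpr hinj
  have hC : CharZero (AlgebraicClosure (FractionRing R)) := charZero_of_injective_algebraMap hinj
  obtain ⟨g, hg, L, hRL, π, θ, ⟨hπ0, hπs⟩, ⟨hθ0, hθs⟩, hπL, hθL, hnd, hmain⟩ :=
    core p hd0 hdim x hx0 hsop₁ hsop₂ (Ω := AlgebraicClosure (FractionRing R))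
  let T : Subalgebra R (AlgebraicClosure (FractionRing R)) :=
    { carrier := {z | IsIntegral R z ∧ z ∈ L}
      mul_mem' := fun ha hb => ⟨ha.1.mul hb.1, mul_mem ha.2 hb.2⟩
      add_mem' := fun ha hb => ⟨ha.1.add hb.1, add_mem ha.2 hb.2⟩
      algebraMap_mem' := fun r => ⟨isIntegral_algebraMap, hRL r⟩ }
  have hT : ∀ z, z ∈ T ↔ IsIntegral R z ∧ z ∈ L := fun z => Iff.rfl
  have hint : ∀ (s : ℕ → AlgebraicClosure (FractionRing R)), (∀ n, s (n+1) ^ p = s n) →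
      (∃ r, s 0 = algebraMap R _ r) → ∀ n, IsIntegral R (s n) := by
    rintro s hs ⟨r, hr⟩ n
    refine IsIntegral.of_pow (n := p^n) (pow_pos hp.pos n) ?_
    rw [seq_pow0 p s hs n, hr]
    exact isIntegral_algebraMap
  have hTi : T ≤ integralClosure R (AlgebraicClosure (FractionRing R)) := fun z hz => hz.1
  let pr : ℕ → T := fun n => ⟨π n, hint π hπs ⟨p, by rw [hπ0, map_natCast]⟩ n, hπL n⟩
  let gr : ℕ → T := fun n => ⟨θ n, hint θ hθs ⟨g, hθ0⟩ n, hθL n⟩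
  have hprs : ∀ n, pr (n+1) ^ p = pr n := fun n => Subtype.ext (hπs n)
  have hgrs : ∀ n, gr (n+1) ^ p = gr n := fun n => Subtype.ext (hθs n)
  have hpr0 : pr 0 = (p : T) := Subtype.ext hπ0
  have hgr0 : gr 0 = algebraMap R T g := Subtype.ext hθ0
  have hws : ∀ n, (fun n => pr n * gr n) (n+1) ^ p = (fun n => pr n * gr n) n := fun n => by
    change (pr (n+1) * gr (n+1)) ^ p = pr n * gr n
    rw [mul_pow, hprs, hgrs]
  have hnd' : ∃ n : ℕ, pr n * gr n ∉
      Ideal.map (algebraMap R ↥T) (IsLocalRing.maximalIdeal R) := by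
    obtain ⟨n, hn⟩ := hnd
    refine ⟨n, fun h => hn (Subalgebra.inclusion hTi (pr n * gr n)) rfl ?_⟩
    have h1 := Ideal.mem_map_of_mem (Subalgebra.inclusion hTi).toRingHom h
    rw [Ideal.map_map] at h1
    exact h1
  have hac : ∀ n : ℕ, 0 < n → ∀ i : Fin d, ∀ t : ↥T,
            algebraMap R ↥T (x i) * t ∈
                Ideal.span ((fun k : Fin d => algebraMap R ↥T (x k)) ''
                  {k : Fin d | (k : ℕ) < (i : ℕ)}) →
            pr n * gr n * t ∈
                Ideal.span ((fun k : Fin d => algebraMap R ↥T (x k)) ''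
                  {k : Fin d | (k : ℕ) < (i : ℕ)}) := by
    rintro n - ⟨i, hi⟩ t
    rcases i with - | r
    · have he : {k : Fin d | (k : ℕ) < 0} = ∅ := by ext; simp
      simp only [he, Set.image_empty, Ideal.span_empty, Ideal.mem_bot]
      rw [hx0, map_natCast]
      intro h
      have hp0 : (p : T) ≠ 0 := by
        intro h
        have := congrArg Subtype.val h
        exact hp.ne_zero (Nat.cast_eq_zero (R := AlgebraicClosure (FractionRing R)).mp this)
      rw [(mul_eq_zero.mp h).resolve_left hp0, mul_zero]
    · rw [span_split _ r hi, span_split _ r hi]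
      rintro ⟨t0, tj, h⟩
      have h' := congrArg (Subtype.val : T → _) h
      obtain ⟨s0, hs0, sj, hsj, hs⟩ := hmain r hi t t0 (fun j => tj j) t.2 t0.2 (fun j => (tj j).2) (by
        rw [hx0, map_natCast] at h'
        simpa using h') n
      refine ⟨⟨s0, hs0⟩, fun j => ⟨sj j, hsj j⟩, Subtype.ext ?_⟩
      rw [hx0, map_natCast]
      simpa using hs
  have hdom : IsDomain T := inferInstance
  refine ⟨g, hg, T, hTi, pr, gr, ⟨hpr0, hprs⟩, ⟨hgr0, hgrs⟩, T_closed L T hT, hnd', hac, ?_, ?_, ?_⟩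
  · intro n hn t
    obtain ⟨n, rfl⟩ := Nat.exists_eq_succ_of_ne_zero hn.ne'
    exact (mem_bigM p (fun n => pr n * gr n) hws hp.one_lt _).mpr ⟨n, t, rfl⟩
  · intro i hi
    refine lc_zero _ _ (List.ofFn x) ?_ (bigM_reg p hp.one_lt (fun n => pr n * gr n) hws ?_ x hac)
      i (by simpa using hi)
    · intro r hr
      obtain ⟨k, rfl⟩ := List.mem_ofFn.mp hr
      exact hsop₁ (Ideal.subset_span ⟨k, rfl⟩)
    · intro h
      have h1 : π 0 * θ 0 = 0 := congrArg Subtype.val h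
      rw [hπ0, hθ0] at h1
      rcases mul_eq_zero.mp h1 with h2 | h2
      · exact hp.ne_zero (Nat.cast_eq_zero.mp h2)
      · exact hg (hinj (by rw [h2, map_zero]))
  · exact bigM_ne _ p hp.one_lt (fun n => pr n * gr n) hws hnd'
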